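/- arXiv:2312.11185 — 2 statements merged into one kernel-verified Lean document; each statement's English description precedes it below -/
import Mathlib

section
/- Let f ∈ AP(ℍ) with spec(f) ⊂ {0} ∪ [b,∞) for some b > 0, and let F : ℍ → ℂ be holomorphic with iF'/F = f. Then F ∈ AP(ℍ) and spec(F) ⊂ {−ℰf(0)/(2π)} ∪ [−ℰf(0)/(2π) + b, ∞). Moreover, if spec(f) is locally finite, then spec(F) is locally finite. -/
open MeasureTheory Complex Filter Topology Set
open scoped ENNReal

noncomputable section

/-- The open upper half-plane, as a subset of `ℂ`. -/
def UHP : Set ℂ := {z : ℂ | 0 < z.im}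

/-- A relatively dense subset of `ℝ`. -/
def RelDense (τ : Set ℝ) : Prop := ∃ l > (0:ℝ), ∀ x : ℝ, ∃ t ∈ τ, x < t ∧ t < x + l

/-- Bohr almost periodic continuous functions on `ℝ`. -/
def APR (f : ℝ → ℂ) : Prop :=
  Continuous f ∧ ∀ ε > (0:ℝ), RelDense {t : ℝ | ∀ x : ℝ, ‖f x - f (x + t)‖ ≤ ε}

/-- Holomorphic almost periodic functions on the upper half-plane. -/
def APH (f : ℂ → ℂ) : Prop :=
  DifferentiableOn ℂ f UHP ∧
  ∀ α β ε : ℝ, 0 < α → α < β → 0 < ε →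
    ∃ τ : Set ℝ, RelDense τ ∧
      ∀ t ∈ τ, ∀ z : ℂ, α < z.im → z.im < β → ‖f z - f (z + (t : ℂ))‖ ≤ ε

/-- `HasMeanAt f y lam c` : the mean `(1/2T)∫_{-T+iy}^{T+iy} f(z) e^{-2πiλz} dz` tends to `c`. -/
def HasMeanAt (f : ℂ → ℂ) (y lam : ℝ) (c : ℂ) : Prop :=
  Tendsto (fun T : ℝ => (1 / (2 * (T : ℂ))) *
      ∫ x in (-T)..T, f ((x : ℂ) + (y : ℂ) * Complex.I) *
        Complex.exp (-(2 * (Real.pi : ℂ) * Complex.I * (lam : ℂ) * ((x : ℂ) + (y : ℂ) * Complex.I))))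
    atTop (𝓝 c)

/-- `HasMeanR f lam c` : the Bohr mean `(1/2T)∫_{-T}^{T} f(x) e^{-2πiλx} dx` tends to `c`. -/
def HasMeanR (f : ℝ → ℂ) (lam : ℝ) (c : ℂ) : Prop :=
  Tendsto (fun T : ℝ => (1 / (2 * (T : ℂ))) *
      ∫ x in (-T)..T, f x *
        Complex.exp (-(2 * (Real.pi : ℂ) * Complex.I * (lam : ℂ) * (x : ℂ))))
    atTop (𝓝 c)

/-- The spectrum of a function on the upper half-plane: frequencies where the mean is not `0`. -/
def specH (f : ℂ → ℂ) : Set ℝ := {lam : ℝ | ∃ y > (0:ℝ), ¬ HasMeanAt f y lam 0}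

/-- A locally finite subset of `ℝ`. -/
def LocFinSet (S : Set ℝ) : Prop := ∀ a b : ℝ, (S ∩ Set.Ioo a b).Finite

/-- A uniformly discrete subset of `ℝ`. -/
def UnifDiscrete (S : Set ℝ) : Prop :=
  ∃ d > (0:ℝ), ∀ x ∈ S, ∀ y ∈ S, x ≠ y → d ≤ |x - y|

/-- Locally summable coefficient functions. -/
def LocSummable (a : ℝ → ℂ) : Prop :=
  (Function.support a).Countable ∧
  ∀ T > (0:ℝ), Summable (Set.indicator (Set.Icc (-T) T) fun l => ‖a l‖)

/-- Exponential growth of a coefficient function. -/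
def ExpGrowth (a : ℝ → ℂ) : Prop :=
  ∃ c > (0:ℝ), Summable fun lam : ℝ => ‖a lam‖ * Real.exp (-c * |lam|)

/-- `a(-λ) = conj (a(λ))`. -/
def Antipodal (a : ℝ → ℂ) : Prop := ∀ lam : ℝ, a (-lam) = (starRingEnd ℂ) (a lam)

/-- The Fourier transform `φ̂(ξ) = ∫ φ(x) e^{-2πixξ} dx`. -/
def FT (φ : ℝ → ℂ) (ξ : ℝ) : ℂ :=
  ∫ x : ℝ, φ x * Complex.exp (-(2 * (Real.pi : ℂ) * Complex.I * (x : ℂ) * (ξ : ℂ)))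

/-- A complex-valued measure on `ℝ`, encoded by its total variation `ν` together with a
unimodular density `w`, so that `dμ = w dν` and `|μ| = ν`. -/
structure CMeasure where
  ν : Measure ℝ
  w : ℝ → ℂ
  meas : Measurable w
  unit : ∀ᵐ t ∂ν, ‖w t‖ = 1

/-- Integration against a complex measure. -/
def CMeasure.integral (μ : CMeasure) (φ : ℝ → ℂ) : ℂ := ∫ t, φ t * μ.w t ∂μ.ν

/-- Strongly tempered: every Schwartz function is `|μ|`-integrable. -/
def CMeasure.IsStronglyTempered (μ : CMeasure) : Prop :=
  ∀ φ : SchwartzMap ℝ ℂ, Integrable (fun t => φ t) μ.ν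

/-- Real-valued complex measure. -/
def CMeasure.RealValued (μ : CMeasure) : Prop := ∀ᵐ t ∂μ.ν, (μ.w t).im = 0

/-- Nonnegative complex measure. -/
def CMeasure.Nonneg (μ : CMeasure) : Prop := ∀ᵐ t ∂μ.ν, μ.w t = 1

/-- `deg(μ) ≤ n` : `∫ (1+t²)^{-n/2} d|μ| < ∞`. -/
def CMeasure.DegLE (μ : CMeasure) (n : ℕ) : Prop :=
  Integrable (fun t : ℝ => (1 + t ^ 2) ^ (-(n : ℝ) / 2)) μ.ν

/-- The mass `μ({x})` of an atom. -/
def CMeasure.atom (μ : CMeasure) (x : ℝ) : ℂ := ∫ t in {x}, μ.w t ∂μ.ν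

/-- The (closed) support of a measure on `ℝ`. -/
def measSupport (ν : Measure ℝ) : Set ℝ := {x : ℝ | ∀ U ∈ 𝓝 x, ν U ≠ 0}

/-- `(μ, a)` is a Fourier summation pair. -/
def IsFSPair (μ : CMeasure) (a : ℝ → ℂ) : Prop :=
  μ.IsStronglyTempered ∧ LocSummable a ∧
    ∀ φ : ℝ → ℂ, ContDiff ℝ (⊤ : ℕ∞) φ → HasCompactSupport φ →
      μ.integral (FT φ) = ∑' lam : ℝ, a lam * φ lam

/-- Trigonometric polynomials. -/
def IsTrigPoly (f : ℂ → ℂ) : Prop :=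
  ∃ (N : ℕ) (p : Fin N → ℂ) (θ : Fin N → ℝ),
    ∀ z : ℂ, f z = ∑ n, p n * Complex.exp (2 * (Real.pi : ℂ) * Complex.I * (θ n : ℂ) * z)

/-- Functions of bounded type on the upper half-plane. -/
def BoundedType (g : ℂ → ℂ) : Prop :=
  ∃ P Q : ℂ → ℂ, DifferentiableOn ℂ P UHP ∧ DifferentiableOn ℂ Q UHP ∧
    (∃ C : ℝ, ∀ z ∈ UHP, ‖P z‖ ≤ C) ∧ (∃ C : ℝ, ∀ z ∈ UHP, ‖Q z‖ ≤ C) ∧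
    (∀ z ∈ UHP, Q z ≠ 0) ∧ ∀ z ∈ UHP, g z = P z / Q z

/-- Mean type `ϑ(g) = limsup_{y→∞} log|g(iy)|/y`. -/
def MeanType (g : ℂ → ℂ) : ℝ :=
  Filter.limsup (fun y : ℝ => Real.log ‖g ((y : ℂ) * Complex.I)‖ / y) atTop

/-- `E*(z) = conj (E (conj z))`. -/
def fstar (E : ℂ → ℂ) : ℂ → ℂ := fun z => (starRingEnd ℂ) (E ((starRingEnd ℂ) z))

/-- Hermite–Biehler class: entire with `|E*(z)| < |E(z)|` on the upper half-plane. -/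
def HB (E : ℂ → ℂ) : Prop := Differentiable ℂ E ∧ ∀ z ∈ UHP, ‖fstar E z‖ < ‖E z‖

/-- `A = (E* + E)/2`. -/
def HBA (E : ℂ → ℂ) : ℂ → ℂ := fun z => (fstar E z + E z) / 2

/-- `B = (E* - E)/(2i)`. -/
def HBB (E : ℂ → ℂ) : ℂ → ℂ := fun z => (fstar E z - E z) / (2 * Complex.I)

/-- `φ` is a phase function for `E`, with derivative `φd > 0`. -/
def IsPhaseFor (φ φd : ℝ → ℝ) (E : ℂ → ℂ) : Prop :=
  (∀ x : ℝ, HasDerivAt φ (φd x) x) ∧ (∀ x : ℝ, 0 < φd x) ∧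
    ∀ x : ℝ, (Complex.exp (Complex.I * (φ x : ℂ)) * E (x : ℂ)).im = 0

/-- The points where `φ ≡ 0 (mod π)`. -/
def phaseZeros (φ : ℝ → ℝ) : Set ℝ := {γ : ℝ | ∃ k : ℤ, φ γ = k * Real.pi}

/-- The nonnegative measure `2π Σ_{φ(γ)≡0 (mod π)} (1/φ'(γ)) δ_γ`. -/
def phaseMeasure (φ φd : ℝ → ℝ) : Measure ℝ :=
  Measure.sum fun γ : phaseZeros φ =>
    (ENNReal.ofReal (2 * Real.pi / φd (γ : ℝ))) • Measure.dirac (γ : ℝ)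

/-- `μ` is an `ℕ`-valued nonnegative measure. -/
def CMeasure.NValued (μ : CMeasure) : Prop :=
  μ.Nonneg ∧ ∃ (Λ : Set ℝ) (m : ℝ → ℕ), LocFinSet Λ ∧ (∀ γ ∈ Λ, 0 < m γ) ∧
    μ.ν = Measure.sum fun γ : Λ => (m (γ : ℝ) : ℝ≥0∞) • Measure.dirac (γ : ℝ)

/-- Bounded on every horizontal substrip of the upper half-plane. -/
def BddOnStrips (f : ℂ → ℂ) : Prop :=
  ∀ ε > (0:ℝ), ∃ C : ℝ, ∀ z : ℂ, ε < z.im → z.im < 1/ε → ‖f z‖ ≤ C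

/-- The Fejér-type partial sums in formula (eq:fdef). -/
def fdefSum (a : ℝ → ℂ) (T : ℝ) (z : ℂ) : ℂ :=
  a 0 / 2 + ∑' lam : ℝ,
    Set.indicator (Set.Ioo (0 : ℝ) T)
      (fun l => a l * (1 - (l : ℂ) / (T : ℂ)) *
        Complex.exp (2 * (Real.pi : ℂ) * Complex.I * (l : ℂ) * z)) lam

/-- The exponential of frequency `μ`. -/
def freqExp (μ : ℝ) (z : ℂ) : ℂ := Complex.exp (2 * (Real.pi : ℂ) * Complex.I * (μ : ℂ) * z)

lemma freqExp_add (μ : ℝ) (z w : ℂ) : freqExp μ (z + w) = freqExp μ z * freqExp μ w := by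
  simp only [freqExp, ← Complex.exp_add]; ring_nf

lemma freqExp_zero_left (z : ℂ) : freqExp 0 z = 1 := by simp [freqExp]

lemma freqExp_add_left (μ ν : ℝ) (z : ℂ) :
    freqExp (μ + ν) z = freqExp μ z * freqExp ν z := by
  simp only [freqExp, ← Complex.exp_add]; push_cast; ring_nf

lemma norm_freqExp (μ : ℝ) (z : ℂ) : ‖freqExp μ z‖ = Real.exp (-(2 * Real.pi * μ * z.im)) := by
  simp only [freqExp, Complex.norm_exp]
  congr 1
  simp [Complex.mul_re, Complex.mul_im]

lemma norm_freqExp_real (μ x : ℝ) : ‖freqExp μ x‖ = 1 := by simp [norm_freqExp]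

lemma freqExp_neg_left (μ : ℝ) (z : ℂ) :
    freqExp (-μ) z = Complex.exp (-(2 * (Real.pi : ℂ) * Complex.I * (μ : ℂ) * z)) := by
  simp [freqExp]

@[fun_prop]
lemma differentiable_freqExp (μ : ℝ) : Differentiable ℂ (freqExp μ) := by
  unfold freqExp; fun_prop

@[fun_prop]
lemma continuous_freqExp (μ : ℝ) : Continuous (freqExp μ) := (differentiable_freqExp μ).continuous

lemma APR.exists_bound {u : ℝ → ℂ} (hu : APR u) : ∃ C > (0:ℝ), ∀ x, ‖u x‖ ≤ C := by
  obtain ⟨l, hl, h⟩ := hu.2 1 one_pos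
  obtain ⟨M, hM⟩ := (isCompact_Icc (a := (0:ℝ)) (b := l)).exists_bound_of_continuousOn
    hu.1.continuousOn
  refine ⟨max (M + 1) 1, by positivity, fun x => ?_⟩
  obtain ⟨t, ht, h1, h2⟩ := h (-x)
  have h3 := hM (x + t) ⟨by linarith, by linarith⟩
  have h4 := ht x
  have h5 := norm_add_le (u x - u (x + t)) (u (x + t))
  rw [sub_add_cancel] at h5
  exact le_max_of_le_left (by linarith)

lemma APR.uniform {u : ℝ → ℂ} (hu : APR u) {ε : ℝ} (hε : 0 < ε) :
    ∃ δ > (0:ℝ), δ ≤ 1 ∧ ∀ x h, |h| ≤ δ → ‖u (x + h) - u x‖ ≤ ε := by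
  obtain ⟨l, hl, H⟩ := hu.2 (ε / 3) (by positivity)
  have huc := (isCompact_Icc (a := (-1:ℝ)) (b := l + 1)).uniformContinuousOn_of_continuous
    hu.1.continuousOn
  rw [Metric.uniformContinuousOn_iff] at huc
  obtain ⟨δ, hδ, h⟩ := huc (ε / 3) (by positivity)
  refine ⟨min (δ / 2) 1, by positivity, min_le_right _ _, fun x h' hh => ?_⟩
  obtain ⟨t, ht, h1, h2⟩ := H (-x)
  have hh1 : |h'| ≤ δ / 2 := hh.trans (min_le_left _ _)
  have hh2 : |h'| ≤ 1 := hh.trans (min_le_right _ _)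
  rw [abs_le] at hh2
  have e1 := h (x + t + h') ⟨by linarith, by linarith⟩ (x + t) ⟨by linarith, by linarith⟩
    (by rw [Real.dist_eq, add_sub_cancel_left]; linarith)
  rw [dist_eq_norm] at e1
  have e2 := ht x
  have e3 := ht (x + h')
  rw [norm_sub_rev] at e2
  rw [show x + h' + t = x + t + h' by ring] at e3
  have : u (x + h') - u x = (u (x + h') - u (x + t + h')) + (u (x + t + h') - u (x + t)) +
    (u (x + t) - u x) := by ring
  rw [this]
  refine (norm_add₃_le).trans (by linarith)

lemma RelDense.mono {σ τ : Set ℝ} (h : RelDense σ) (hst : σ ⊆ τ) : RelDense τ := by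
  obtain ⟨l, hl, H⟩ := h
  refine ⟨l, hl, fun x => ?_⟩
  obtain ⟨t, ht, h1⟩ := H x
  exact ⟨t, hst ht, h1⟩

/-- Differences of elements of a relatively dense set that almost are periods of an exponential. -/
lemma RelDense.sub_freqExp {τ : Set ℝ} (hτ : RelDense τ) (μ : ℝ) {δ : ℝ} (hδ : 0 < δ) :
    RelDense {t | ∃ s ∈ τ, ∃ s' ∈ τ, t = s - s' ∧ ‖freqExp μ t - 1‖ ≤ δ} := by
  obtain ⟨l, hl, H⟩ := hτ
  have htb : TotallyBounded ((fun s : ℝ => freqExp μ s) '' τ) := by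
    refine (isCompact_closedBall (0:ℂ) 1).totallyBounded.subset ?_
    rintro _ ⟨s, -, rfl⟩
    simp [norm_freqExp_real]
  obtain ⟨A, hA, hAf, hcov⟩ := Metric.finite_approx_of_totallyBounded htb δ hδ
  obtain ⟨σ, hσ, hσf, rfl⟩ := Set.exists_subset_image_finite_and.mp ⟨A, hA, hAf, rfl⟩
  obtain ⟨L, hL⟩ := hσf.isBounded.exists_norm_le
  have hL' : ∀ s ∈ σ, |s| ≤ |L| := fun s hs => (hL s hs).trans (le_abs_self L)
  refine ⟨l + 2 * |L|, by positivity, fun x => ?_⟩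
  obtain ⟨s, hs, h1, h2⟩ := H (x + |L|)
  have := hcov (mem_image_of_mem _ hs)
  simp only [mem_iUnion, Metric.mem_ball, dist_eq_norm] at this
  obtain ⟨_, ⟨s', hs', rfl⟩, hd⟩ := this
  have hb := abs_le.mp (hL' s' hs')
  refine ⟨s - s', ⟨s, hs, s', hσ hs', rfl, ?_⟩, by linarith, by linarith⟩
  have e : freqExp μ s - freqExp μ s' = freqExp μ s' * (freqExp μ (s - s' : ℝ) - 1) := by
    rw [mul_sub, ← freqExp_add]; push_cast; ring_nf
  rw [e, norm_mul, norm_freqExp_real, one_mul] at hd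
  exact hd.le

lemma APR.mul_freqExp {u : ℝ → ℂ} (hu : APR u) (μ : ℝ) : APR (fun x => u x * freqExp μ x) := by
  obtain ⟨C, hC, hb⟩ := hu.exists_bound
  refine ⟨hu.1.mul ((continuous_freqExp μ).comp Complex.continuous_ofReal), fun ε hε => ?_⟩
  refine ((hu.2 (ε / 4) (by positivity)).sub_freqExp μ (δ := ε / (2 * C)) (by positivity)).mono ?_
  rintro t ⟨s, hs, s', hs', rfl, ht⟩ x
  have e1 := hs (x - s')
  have e2 := hs' (x - s')
  rw [sub_add_cancel] at e2
  have e3 : ‖u x - u (x + (s - s'))‖ ≤ ε / 2 := by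
    rw [show x + (s - s') = x - s' + s by ring]
    have := norm_sub_le (u (x - s') - u (x - s' + s)) (u (x - s') - u x)
    rw [sub_sub_sub_cancel_left] at this
    linarith
  have e4 : u x * freqExp μ x - u (x + (s - s')) * freqExp μ ((x + (s - s') : ℝ) : ℂ) =
    (u x - u (x + (s - s'))) * freqExp μ ((x + (s - s') : ℝ) : ℂ) -
      u x * freqExp μ x * (freqExp μ (s - s' : ℝ) - 1) := by
    push_cast
    rw [freqExp_add μ x]; ring
  rw [e4]
  refine (norm_sub_le _ _).trans ?_
  rw [norm_mul, norm_mul, norm_mul, norm_freqExp_real, norm_freqExp_real, mul_one, mul_one]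
  have : ‖u x‖ * ‖freqExp μ (s - s' : ℝ) - 1‖ ≤ C * (ε / (2 * C)) := by
    gcongr; exact hb x
  have h2 : C * (ε / (2 * C)) = ε / 2 := by field_simp
  linarith

/-- `v` has mean `c`, uniformly over all windows. -/
def HasUniformMean (v : ℝ → ℂ) (c : ℂ) : Prop :=
  ∀ ε > (0:ℝ), ∃ T₀ > (0:ℝ), ∀ T ≥ T₀, ∀ a, ‖(∫ x in a..a + T, v x) - T * c‖ ≤ ε * T

lemma HasUniformMean.tendsto_window {v : ℝ → ℂ} {c : ℂ} (h : HasUniformMean v c) (s : ℝ) :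
    Tendsto (fun T : ℝ => (1 / (2 * (T : ℂ))) * ∫ x in (-T - s)..(T - s), v x) atTop (𝓝 c) := by
  rw [Metric.tendsto_atTop]
  intro ε hε
  obtain ⟨T₀, hT₀, H⟩ := h (ε / 2) (by positivity)
  refine ⟨T₀, fun T hT => ?_⟩
  have hT0 : 0 < T := hT₀.trans_le hT
  have h1 := H (2 * T) (by linarith) (-T - s)
  rw [show -T - s + 2 * T = T - s by ring] at h1
  have hTc : (T : ℂ) ≠ 0 := by exact_mod_cast hT0.ne'
  have e : (1 / (2 * (T : ℂ))) * (∫ x in (-T - s)..(T - s), v x) - c =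
      (1 / (2 * (T : ℂ))) * ((∫ x in (-T - s)..(T - s), v x) - (2 * T : ℝ) * c) := by
    push_cast; field_simp
  rw [dist_eq_norm, e, norm_mul]
  have : ‖1 / (2 * (T : ℂ))‖ = 1 / (2 * T) := by simp [abs_of_pos hT0]
  rw [this]
  calc 1 / (2 * T) * _ ≤ 1 / (2 * T) * (ε / 2 * (2 * T)) := by gcongr
    _ = ε / 2 := by field_simp
    _ < ε := by linarith

lemma HasUniformMean.tendsto {v : ℝ → ℂ} {c : ℂ} (h : HasUniformMean v c) :
    Tendsto (fun T : ℝ => (1 / (2 * (T : ℂ))) * ∫ x in (-T)..T, v x) atTop (𝓝 c) := by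
  simpa using h.tendsto_window 0

lemma HasUniformMean.hasMeanR {u : ℝ → ℂ} {lam : ℝ} {c : ℂ}
    (h : HasUniformMean (fun x => u x * freqExp (-lam) x) c) : HasMeanR u lam c := by
  simpa only [HasMeanR, freqExp_neg_left] using h.tendsto

lemma norm_integral_shift_sub_le {v : ℝ → ℂ} {C : ℝ} (hv : Continuous v) (hC : ∀ x, ‖v x‖ ≤ C)
    (a a' b b' : ℝ) :
    ‖(∫ x in a..b, v x) - ∫ x in a'..b', v x‖ ≤ C * |a' - a| + C * |b' - b| := by
  have hi : ∀ p q : ℝ, IntervalIntegrable v volume p q := fun p q => hv.intervalIntegrable p q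
  have h1 := intervalIntegral.integral_add_adjacent_intervals (hi a a') (hi a' b')
  have h2 := intervalIntegral.integral_add_adjacent_intervals (hi a b) (hi b b')
  have e : (∫ x in a..b, v x) - ∫ x in a'..b', v x = (∫ x in a..a', v x) - ∫ x in b..b', v x := by
    have := h1.trans h2.symm
    linear_combination -this
  rw [e]
  refine (norm_sub_le _ _).trans (add_le_add ?_ ?_) <;>
    exact intervalIntegral.norm_integral_le_of_norm_le_const (fun x _ => hC x)

lemma APR.windows_close {v : ℝ → ℂ} (hv : APR v) {ε : ℝ} (hε : 0 < ε) :
    ∃ T₀ > (0:ℝ), ∀ T ≥ T₀, ∀ a a',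
      ‖(∫ x in a..a + T, v x) - ∫ x in a'..a' + T, v x‖ ≤ ε * T := by
  obtain ⟨C, hC, hb⟩ := hv.exists_bound
  obtain ⟨l, hl, H⟩ := hv.2 (ε / 2) (by positivity)
  refine ⟨4 * C * l / ε, by positivity, fun T hT a a' => ?_⟩
  have hT0 : 0 < T := lt_of_lt_of_le (by positivity) hT
  obtain ⟨t, ht, h1, h2⟩ := H (a - a')
  have e1 := norm_integral_shift_sub_le hv.1 hb a (a' + t) (a + T) (a' + T + t)
  have habs : |a' + t - a| ≤ l := by rw [abs_le]; constructor <;> linarith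
  have habs' : |a' + T + t - (a + T)| ≤ l := by rw [abs_le]; constructor <;> linarith
  have e2 : ‖(∫ x in a'..a' + T, v (x + t)) - ∫ x in a'..a' + T, v x‖ ≤ ε / 2 * |a' + T - a'| := by
    rw [← intervalIntegral.integral_sub]
    · refine intervalIntegral.norm_integral_le_of_norm_le_const (fun x _ => ?_)
      rw [norm_sub_rev]; exact ht x
    · exact (hv.1.comp (continuous_id.add continuous_const)).intervalIntegrable _ _
    · exact hv.1.intervalIntegrable _ _
  rw [intervalIntegral.integral_comp_add_right] at e2
  rw [add_sub_cancel_left, abs_of_pos hT0] at e2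
  have e3 : 4 * C * l ≤ T * ε := by rwa [ge_iff_le, div_le_iff₀ hε] at hT
  have e4 := norm_sub_le_norm_sub_add_norm_sub (∫ x in a..a + T, v x)
    (∫ x in (a' + t)..(a' + T + t), v x) (∫ x in a'..a' + T, v x)
  nlinarith

lemma APR.exists_hasUniformMean {v : ℝ → ℂ} (hv : APR v) : ∃ c, HasUniformMean v c := by
  obtain ⟨C, hC, hb⟩ := hv.exists_bound
  have hi : ∀ p q : ℝ, IntervalIntegrable v volume p q := fun p q => hv.1.intervalIntegrable p q
  have key : ∀ ε > (0:ℝ), ∃ T₀ > (0:ℝ), ∃ T₁ > (0:ℝ), ∀ T ≥ T₁,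
      ‖(∫ x in (0:ℝ)..T, v x) - T * ((∫ x in (0:ℝ)..T₀, v x) / T₀)‖ ≤ ε * T := by
    intro ε hε
    obtain ⟨T₀, hT₀, H⟩ := hv.windows_close (half_pos hε)
    refine ⟨T₀, hT₀, 4 * C * T₀ / ε, by positivity, fun T hT => ?_⟩
    have hT0 : 0 < T := lt_of_lt_of_le (by positivity) hT
    have hn : ∀ n : ℕ, ‖(∫ x in (0:ℝ)..n * T₀, v x) - n * ∫ x in (0:ℝ)..T₀, v x‖
        ≤ n * (ε / 2 * T₀) := by
      intro n
      induction n with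
      | zero => simp
      | succ k ih =>
        have h1 := intervalIntegral.integral_add_adjacent_intervals (hi 0 (k * T₀))
          (hi (k * T₀) (k * T₀ + T₀))
        have h2 := H T₀ le_rfl (k * T₀) 0
        rw [zero_add] at h2
        have e : ((k + 1 : ℕ) : ℝ) * T₀ = k * T₀ + T₀ := by push_cast; ring
        rw [e, ← h1]
        push_cast
        have e' : (∫ x in (0:ℝ)..k * T₀, v x) + (∫ x in k * T₀..k * T₀ + T₀, v x) -
          (k + 1) * (∫ x in (0:ℝ)..T₀, v x) = ((∫ x in (0:ℝ)..k * T₀, v x) -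
            k * (∫ x in (0:ℝ)..T₀, v x)) + ((∫ x in k * T₀..k * T₀ + T₀, v x) -
            (∫ x in (0:ℝ)..T₀, v x)) := by ring
        rw [e']
        refine (norm_add_le _ _).trans ?_
        linarith
    set n := ⌊T / T₀⌋₊ with hndef
    have f1 : (n : ℝ) * T₀ ≤ T := by
      have := Nat.floor_le (a := T / T₀) (by positivity)
      rwa [le_div_iff₀ hT₀] at this
    have f2 : T < n * T₀ + T₀ := by
      have := Nat.lt_floor_add_one (T / T₀)
      rw [div_lt_iff₀ hT₀] at this
      linarith
    have g1 := norm_integral_shift_sub_le hv.1 hb 0 0 T (n * T₀)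
    have g2 : ‖∫ x in (0:ℝ)..T₀, v x‖ ≤ C * T₀ := by
      have := intervalIntegral.norm_integral_le_of_norm_le_const (a := 0) (b := T₀)
        (fun x _ => hb x)
      rwa [sub_zero, abs_of_pos hT₀] at this
    have g3 : ‖(n * ∫ x in (0:ℝ)..T₀, v x) - T * ((∫ x in (0:ℝ)..T₀, v x) / T₀)‖ ≤ C * T₀ := by
      have hTc : (T₀ : ℂ) ≠ 0 := by exact_mod_cast hT₀.ne'
      have e : (n * ∫ x in (0:ℝ)..T₀, v x) - T * ((∫ x in (0:ℝ)..T₀, v x) / T₀) =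
        (((n * T₀ - T) / T₀ : ℝ) : ℂ) * ∫ x in (0:ℝ)..T₀, v x := by
        push_cast; field_simp
      rw [e, norm_mul]
      have : ‖(((n * T₀ - T) / T₀ : ℝ) : ℂ)‖ ≤ 1 := by
        rw [Complex.norm_real, Real.norm_eq_abs, abs_div, abs_of_pos hT₀, div_le_one hT₀, abs_le]
        constructor <;> linarith
      calc _ ≤ 1 * (C * T₀) := by gcongr
        _ = _ := one_mul _
    have g4 : |n * T₀ - T| ≤ T₀ := by rw [abs_le]; constructor <;> linarith
    have g5 : 4 * C * T₀ ≤ T * ε := by rwa [ge_iff_le, div_le_iff₀ hε] at hT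
    have g6 := hn n
    have g7 : ∀ A B D E : ℂ, ‖A - E‖ ≤ ‖A - B‖ + ‖B - D‖ + ‖D - E‖ := fun A B D E => by
      have : A - E = (A - B) + (B - D) + (D - E) := by ring
      rw [this]; exact norm_add₃_le
    refine (g7 _ _ _ _).trans (add_le_add (add_le_add g1 g6) g3 |>.trans ?_)
    simp only [sub_self, abs_zero, mul_zero, zero_add]
    have : (n : ℝ) * (ε / 2 * T₀) ≤ ε / 2 * T := by nlinarith
    nlinarith
  have hcau : Cauchy (map (fun T : ℝ => (∫ x in (0:ℝ)..T, v x) / T) atTop) := by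
    change CauchySeq _
    rw [Metric.cauchySeq_iff']
    intro ε hε
    obtain ⟨T₀, hT₀, T₁, hT₁, H⟩ := key (ε / 3) (by positivity)
    have H' : ∀ T ≥ T₁, ‖(∫ x in (0:ℝ)..T, v x) / T - (∫ x in (0:ℝ)..T₀, v x) / T₀‖ ≤ ε / 3 := by
      intro T hT
      have hT0 : 0 < T := hT₁.trans_le hT
      have hTc : (T : ℂ) ≠ 0 := by exact_mod_cast hT0.ne'
      have e : (∫ x in (0:ℝ)..T, v x) / T - (∫ x in (0:ℝ)..T₀, v x) / T₀ =
        ((∫ x in (0:ℝ)..T, v x) - T * ((∫ x in (0:ℝ)..T₀, v x) / T₀)) / T := by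
        field_simp
      rw [e, norm_div, Complex.norm_real, Real.norm_eq_abs, abs_of_pos hT0, div_le_iff₀ hT0]
      exact H T hT
    refine ⟨T₁, fun T hT => ?_⟩
    rw [dist_eq_norm]
    have a1 := H' T hT
    have a2 := H' T₁ le_rfl
    rw [norm_sub_rev] at a2
    have := norm_sub_le_norm_sub_add_norm_sub ((∫ x in (0:ℝ)..T, v x) / T)
      ((∫ x in (0:ℝ)..T₀, v x) / T₀) ((∫ x in (0:ℝ)..T₁, v x) / T₁)
    linarith
  obtain ⟨c, hc⟩ := cauchy_map_iff_exists_tendsto.mp hcau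
  refine ⟨c, fun ε hε => ?_⟩
  obtain ⟨T₀, hT₀, H⟩ := hv.windows_close (half_pos hε)
  rw [Metric.tendsto_atTop] at hc
  obtain ⟨T₁, H₁⟩ := hc (ε / 2) (by positivity)
  refine ⟨max T₀ T₁, by positivity, fun T hT a => ?_⟩
  have hT0 : 0 < T := hT₀.trans_le ((le_max_left _ _).trans hT)
  have hTc : (T : ℂ) ≠ 0 := by exact_mod_cast hT0.ne'
  have a1 := H T ((le_max_left _ _).trans hT) a 0
  have a2 := H₁ T ((le_max_right _ _).trans hT)
  have e : (∫ x in (0:ℝ)..T, v x) - T * c = T * ((∫ x in (0:ℝ)..T, v x) / T - c) := by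
    field_simp
  have a3 : ‖(∫ x in (0:ℝ)..T, v x) - T * c‖ ≤ T * (ε / 2) := by
    rw [e, norm_mul, Complex.norm_real, Real.norm_eq_abs, abs_of_pos hT0, ← dist_eq_norm]
    gcongr
  rw [zero_add] at a1
  have := norm_sub_le_norm_sub_add_norm_sub (∫ x in a..a + T, v x) (∫ x in (0:ℝ)..T, v x) (T * c)
  linarith

lemma APR.hasUniformMean {u : ℝ → ℂ} (hu : APR u) {lam : ℝ} {c : ℂ} (h : HasMeanR u lam c) :
    HasUniformMean (fun x => u x * freqExp (-lam) x) c := by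
  obtain ⟨d, hd⟩ := (hu.mul_freqExp (-lam)).exists_hasUniformMean
  rwa [tendsto_nhds_unique h hd.hasMeanR]

lemma norm_freqExp_real_sub_one_le (μ x : ℝ) : ‖freqExp μ x - 1‖ ≤ 2 * Real.pi * |μ| * |x| := by
  have e : freqExp μ x = Complex.exp (Complex.I * ((2 * Real.pi * μ * x : ℝ) : ℂ)) := by
    simp only [freqExp]; push_cast; ring_nf
  rw [e]
  refine (Real.norm_exp_I_mul_ofReal_sub_one_le).trans ?_
  rw [Real.norm_eq_abs, abs_mul, abs_mul, abs_of_pos Real.two_pi_pos]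

lemma continuous_freqExp_real (μ : ℝ) : Continuous fun x : ℝ => freqExp μ x :=
  (continuous_freqExp μ).comp Complex.continuous_ofReal

/-- Riemann–Lebesgue, uniformly over all windows. -/
lemma APR.integral_freqExp_le_of_large {u : ℝ → ℂ} (hu : APR u) {ε : ℝ} (hε : 0 < ε) :
    ∃ Λ > (0:ℝ), ∃ T₀ > (0:ℝ), ∀ lam : ℝ, Λ ≤ |lam| → ∀ T ≥ T₀,
      ‖∫ x in (0:ℝ)..T, u x * freqExp lam x‖ ≤ ε * T := by
  obtain ⟨C, hC, hb⟩ := hu.exists_bound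
  obtain ⟨δ, hδ, hδ1, hmod⟩ := hu.uniform hε
  refine ⟨1 / δ, by positivity, 2 * C / ε, by positivity, fun lam hlam T hT => ?_⟩
  have hT0 : 0 < T := lt_of_lt_of_le (by positivity) hT
  have hlam0 : 0 < |lam| := lt_of_lt_of_le (by positivity) hlam
  have hlamne : lam ≠ 0 := abs_pos.mp hlam0
  set h : ℝ := 1 / (2 * lam) with hh
  have habs : |h| ≤ δ := by
    rw [hh, abs_div, abs_one, abs_mul, abs_two, div_le_iff₀ (by positivity)]
    rw [div_le_iff₀ hδ] at hlam
    nlinarith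
  have hhalf : ∀ x : ℝ, freqExp lam ((x + h : ℝ) : ℂ) = -freqExp lam x := by
    intro x
    have : freqExp lam (h : ℂ) = -1 := by
      rw [freqExp, hh, ← Complex.exp_pi_mul_I]
      congr 1
      have : (lam : ℂ) ≠ 0 := by exact_mod_cast hlamne
      push_cast; field_simp
    push_cast
    rw [freqExp_add, this]; ring
  have hvc : Continuous fun x : ℝ => u x * freqExp lam x := hu.1.mul (continuous_freqExp_real lam)
  have hvb : ∀ x : ℝ, ‖u x * freqExp lam x‖ ≤ C := fun x => by
    rw [norm_mul, norm_freqExp_real, mul_one]; exact hb x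
  have e1 := norm_integral_shift_sub_le hvc hvb 0 (0 + h) T (T + h)
  rw [← intervalIntegral.integral_comp_add_right] at e1
  simp only [hhalf] at e1
  have e2 : ‖(∫ x in (0:ℝ)..T, (u (x + h) * -freqExp lam x)) +
      ∫ x in (0:ℝ)..T, u x * freqExp lam x‖ ≤ ε * |T - 0| := by
    rw [← intervalIntegral.integral_add]
    · refine intervalIntegral.norm_integral_le_of_norm_le_const (fun x _ => ?_)
      have : u (x + h) * -freqExp lam x + u x * freqExp lam x =
        -((u (x + h) - u x) * freqExp lam x) := by ring
      rw [this, norm_neg, norm_mul, norm_freqExp_real, mul_one]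
      exact hmod x h habs
    · exact ((hu.1.comp (continuous_id.add continuous_const)).mul
        (continuous_freqExp_real lam).neg).intervalIntegrable _ _
    · exact hvc.intervalIntegrable _ _
  rw [sub_zero, abs_of_pos hT0] at e2
  have e3 := norm_add_le ((∫ x in (0:ℝ)..T, u x * freqExp lam x) -
    ∫ x in (0:ℝ)..T, (u (x + h) * -freqExp lam x)) ((∫ x in (0:ℝ)..T, (u (x + h) * -freqExp lam x)) +
      ∫ x in (0:ℝ)..T, u x * freqExp lam x)
  have e4 : (∫ x in (0:ℝ)..T, u x * freqExp lam x) -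
    (∫ x in (0:ℝ)..T, (u (x + h) * -freqExp lam x)) + ((∫ x in (0:ℝ)..T, (u (x + h) * -freqExp lam x)) +
      ∫ x in (0:ℝ)..T, u x * freqExp lam x) = 2 * ∫ x in (0:ℝ)..T, u x * freqExp lam x := by ring
  rw [e4, norm_mul] at e3
  simp only [zero_add, sub_zero, add_sub_cancel_left] at e1
  have e5 : C * |h| + C * |h| ≤ 2 * C := by nlinarith
  have e6 : 2 * C ≤ T * ε := by rwa [ge_iff_le, div_le_iff₀ hε] at hT
  have : ‖(2:ℂ)‖ = 2 := by simp
  rw [this] at e3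
  linarith

lemma HasUniformMean.eventually_near {u : ℝ → ℂ} (hu : APR u) {lam : ℝ}
    (h : HasUniformMean (fun x => u x * freqExp lam x) 0) {ε : ℝ} (hε : 0 < ε) :
    ∃ δ > (0:ℝ), ∃ T₀ > (0:ℝ), ∀ lam', |lam' - lam| ≤ δ → ∀ T ≥ T₀,
      ‖∫ x in (0:ℝ)..T, u x * freqExp lam' x‖ ≤ ε * T := by
  obtain ⟨C, hC, hb⟩ := hu.exists_bound
  obtain ⟨S, hS, H⟩ := h (ε / 4) (by positivity)
  refine ⟨ε / (4 * C * (2 * Real.pi * S)), by positivity, 2 * C * S / ε, by positivity,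
    fun lam' hlam T hT => ?_⟩
  have hT0 : 0 < T := lt_of_lt_of_le (by positivity) hT
  have hvc : ∀ m : ℝ, Continuous fun x : ℝ => u x * freqExp m x :=
    fun m => hu.1.mul (continuous_freqExp_real m)
  have hvb : ∀ m x : ℝ, ‖u x * freqExp m x‖ ≤ C := fun m x => by
    rw [norm_mul, norm_freqExp_real, mul_one]; exact hb x
  have hblock : ∀ a : ℝ, ‖∫ x in a..a + S, u x * freqExp lam' x‖ ≤ ε / 2 * S := by
    intro a
    have e : ∀ x : ℝ, u x * freqExp lam' x = freqExp (lam' - lam) a *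
        (u x * freqExp lam x + u x * freqExp lam x * (freqExp (lam' - lam) (x - a : ℝ) - 1)) := by
      intro x
      have h1 : freqExp lam' x = freqExp (lam' - lam) x * freqExp lam x := by
        rw [← freqExp_add_left]; ring_nf
      have h2 : freqExp (lam' - lam) (x : ℂ) =
        freqExp (lam' - lam) a * freqExp (lam' - lam) (x - a : ℝ) := by
        rw [← freqExp_add]; push_cast; ring_nf
      rw [h1, h2]; ring
    simp only [e]
    rw [intervalIntegral.integral_const_mul, norm_mul, norm_freqExp_real, one_mul,
      intervalIntegral.integral_add ((hvc lam).intervalIntegrable _ _)]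
    · have h1 := H S le_rfl a
      rw [mul_zero, sub_zero] at h1
      have h2 : ‖∫ x in a..a + S, u x * freqExp lam x * (freqExp (lam' - lam) (x - a : ℝ) - 1)‖
          ≤ ε / 4 * |a + S - a| := by
        refine intervalIntegral.norm_integral_le_of_norm_le_const (fun x hx => ?_)
        rw [uIoc_of_le (by linarith)] at hx
        rw [norm_mul]
        have hxa : |x - a| ≤ S := by rw [abs_le]; constructor <;> linarith [hx.1, hx.2]
        calc _ ≤ C * (2 * Real.pi * |lam' - lam| * |x - a|) := by
              gcongr
              · exact hvb _ _
              · exact norm_freqExp_real_sub_one_le _ _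
          _ ≤ C * (2 * Real.pi * (ε / (4 * C * (2 * Real.pi * S))) * S) := by gcongr
          _ = ε / 4 := by
            have := Real.pi_pos
            field_simp
      rw [add_sub_cancel_left, abs_of_pos hS] at h2
      refine (norm_add_le _ _).trans (by linarith)
    · refine Continuous.intervalIntegrable ?_ _ _
      exact (hvc lam).mul (((continuous_freqExp_real (lam' - lam)).comp
        (continuous_id.sub continuous_const)).sub continuous_const)
  have hn : ∀ n : ℕ, ‖∫ x in (0:ℝ)..n * S, u x * freqExp lam' x‖ ≤ n * (ε / 2 * S) := by
    intro n
    induction n with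
    | zero => simp
    | succ k ih =>
      have h1 := intervalIntegral.integral_add_adjacent_intervals
        ((hvc lam').intervalIntegrable 0 (k * S)) ((hvc lam').intervalIntegrable (μ := volume) (k * S) (k * S + S))
      have e : ((k + 1 : ℕ) : ℝ) * S = k * S + S := by push_cast; ring
      rw [e, ← h1]
      refine (norm_add_le _ _).trans ?_
      have := hblock (k * S)
      push_cast; linarith
  set n := ⌊T / S⌋₊
  have f1 : (n : ℝ) * S ≤ T := by
    have := Nat.floor_le (a := T / S) (by positivity)
    rwa [le_div_iff₀ hS] at this
  have f2 : T < n * S + S := by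
    have := Nat.lt_floor_add_one (T / S)
    rw [div_lt_iff₀ hS] at this
    linarith
  have g1 := norm_integral_shift_sub_le (hvc lam') (hvb lam') 0 0 T (n * S)
  have g4 : |n * S - T| ≤ S := by rw [abs_le]; constructor <;> linarith
  have g5 : 2 * C * S ≤ T * ε := by rwa [ge_iff_le, div_le_iff₀ hε] at hT
  have g6 := hn n
  have g7 := norm_le_norm_sub_add (∫ x in (0:ℝ)..T, u x * freqExp lam' x)
    (∫ x in (0:ℝ)..n * S, u x * freqExp lam' x)
  simp only [sub_self, abs_zero, mul_zero, zero_add] at g1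
  nlinarith

/-- If all Bohr means vanish, they do so uniformly in the frequency. -/
lemma APR.integral_freqExp_le {u : ℝ → ℂ} (hu : APR u) (h0 : ∀ lam, HasMeanR u lam 0)
    {ε : ℝ} (hε : 0 < ε) :
    ∃ T₀ > (0:ℝ), ∀ T ≥ T₀, ∀ lam : ℝ, ‖∫ x in (0:ℝ)..T, u x * freqExp lam x‖ ≤ ε * T := by
  obtain ⟨Λ, hΛ, T₁, hT₁, H₁⟩ := hu.integral_freqExp_le_of_large hε
  have hK : ∃ T₀ > (0:ℝ), ∀ lam ∈ Icc (-Λ) Λ, ∀ T ≥ T₀,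
      ‖∫ x in (0:ℝ)..T, u x * freqExp lam x‖ ≤ ε * T := by
    refine isCompact_Icc.induction_on
      (p := fun s => ∃ T₀ > (0:ℝ), ∀ lam ∈ s, ∀ T ≥ T₀,
        ‖∫ x in (0:ℝ)..T, u x * freqExp lam x‖ ≤ ε * T) ⟨1, one_pos, by simp⟩ ?_ ?_ ?_
    · rintro s t hst ⟨T₀, hT₀, H⟩
      exact ⟨T₀, hT₀, fun lam hl => H lam (hst hl)⟩
    · rintro s t ⟨T₀, hT₀, H⟩ ⟨T₀', hT₀', H'⟩
      refine ⟨max T₀ T₀', by positivity, ?_⟩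
      rintro lam (hl | hl) T hT
      · exact H lam hl T ((le_max_left _ _).trans hT)
      · exact H' lam hl T ((le_max_right _ _).trans hT)
    · intro lam _
      have hm := hu.hasUniformMean (h0 (-lam))
      rw [neg_neg] at hm
      obtain ⟨δ, hδ, T₀, hT₀, H⟩ := hm.eventually_near hu hε
      refine ⟨Metric.closedBall lam δ, mem_nhdsWithin_of_mem_nhds (Metric.closedBall_mem_nhds _ hδ),
        T₀, hT₀, fun lam' hl => H lam' ?_⟩
      simpa [Real.dist_eq] using hl
  obtain ⟨T₀, hT₀, H⟩ := hK
  refine ⟨max T₀ T₁, by positivity, fun T hT lam => ?_⟩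
  by_cases hl : Λ ≤ |lam|
  · exact H₁ lam hl T ((le_max_right _ _).trans hT)
  · exact H lam (abs_le.mp (not_le.mp hl).le) T ((le_max_left _ _).trans hT)

section Circle

open AddCircle ComplexConjugate

variable {T : ℝ} [hT : Fact (0 < T)]

lemma MemLp.of_measurable_of_norm_le {U : AddCircle T → ℂ} (hU : Measurable U) {C : ℝ}
    (hC : ∀ x, ‖U x‖ ≤ C) : MemLp U 2 (@haarAddCircle T hT) :=
  MemLp.of_bound hU.aestronglyMeasurable C (ae_of_all _ hC)

lemma hasSum_sq_fourierCoeff_of_memLp {U : AddCircle T → ℂ}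
    (hU : MemLp U 2 (@haarAddCircle T hT)) :
    HasSum (fun n => ‖fourierCoeff U n‖ ^ 2) (∫ t, ‖U t‖ ^ 2 ∂(@haarAddCircle T hT)) := by
  convert hasSum_sq_fourierCoeff hU.toLp using 1
  · simp [fourierCoeff_congr_ae hU.coeFn_toLp]
  · apply integral_congr_ae
    filter_upwards [hU.coeFn_toLp] with x hx
    simp [hx]

/-- The autocorrelation of a function on the circle. -/
def circleAutocorr (U : AddCircle T → ℂ) (s : AddCircle T) : ℂ :=
  ∫ x, U (x + s) * conj (U x) ∂(@haarAddCircle T hT)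

lemma measurable_circleAutocorr {U : AddCircle T → ℂ} (hU : Measurable U) :
    Measurable (circleAutocorr U) := by
  have : Measurable (fun p : AddCircle T × AddCircle T => U (p.2 + p.1) * conj (U p.2)) :=
    (hU.comp (measurable_snd.add measurable_fst)).mul
      (Complex.continuous_conj.measurable.comp (hU.comp measurable_snd))
  exact (this.stronglyMeasurable.integral_prod_right' (ν := @haarAddCircle T hT)).measurable

lemma norm_circleAutocorr_le {U : AddCircle T → ℂ} {C : ℝ} (hC0 : 0 ≤ C)
    (hC : ∀ x, ‖U x‖ ≤ C) (s : AddCircle T) : ‖circleAutocorr U s‖ ≤ C * C := by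
  refine (norm_integral_le_of_norm_le_const (C := C * C) (ae_of_all _ fun x => ?_)).trans ?_
  · rw [norm_mul, RCLike.norm_conj]
    exact mul_le_mul (hC _) (hC _) (norm_nonneg _) hC0
  · simp

lemma fourierCoeff_circleAutocorr {U : AddCircle T → ℂ} (hU : Measurable U) {C : ℝ} (hC0 : 0 ≤ C)
    (hC : ∀ x, ‖U x‖ ≤ C) (n : ℤ) :
    fourierCoeff (circleAutocorr U) n = fourierCoeff U n * conj (fourierCoeff U n) := by
  have hmeas : Measurable (fun p : AddCircle T × AddCircle T =>
      fourier (-n) p.1 * (U (p.2 + p.1) * conj (U p.2))) :=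
    ((fourier (-n)).continuous.measurable.comp measurable_fst).mul
      ((hU.comp (measurable_snd.add measurable_fst)).mul
      (Complex.continuous_conj.measurable.comp (hU.comp measurable_snd)))
  have hint : Integrable (fun p : AddCircle T × AddCircle T =>
      fourier (-n) p.1 * (U (p.2 + p.1) * conj (U p.2)))
      ((@haarAddCircle T hT).prod (@haarAddCircle T hT)) := by
    refine Integrable.of_bound hmeas.aestronglyMeasurable (C * C) (ae_of_all _ fun p => ?_)
    rw [norm_mul, norm_mul, RCLike.norm_conj]
    have : ‖fourier (-n) p.1‖ = 1 := Circle.norm_coe _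
    rw [this, one_mul]
    exact mul_le_mul (hC _) (hC _) (norm_nonneg _) hC0
  have inner : ∀ x : AddCircle T, ∫ s, fourier (-n) s * (U (x + s) * conj (U x)) ∂haarAddCircle =
      fourier n x * conj (U x) * fourierCoeff U n := by
    intro x
    rw [fourierCoeff, ← integral_const_mul,
      ← integral_add_left_eq_self (fun s => fourier n x * conj (U x) * fourier (-n) s • U s) x]
    refine integral_congr_ae (ae_of_all _ fun s => ?_)
    have h1 : fourier n x * fourier (-n) (x + s) = fourier (-n) s := by
      simp only [fourier_apply, smul_add, neg_smul, toCircle_add, toCircle_neg, Circle.coe_mul,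
        Circle.coe_inv]
      rw [← mul_assoc, mul_inv_cancel₀ (Circle.coe_ne_zero _), one_mul]
    simp only [smul_eq_mul]
    rw [← h1]; ring
  have e1 : fourierCoeff (circleAutocorr U) n =
      ∫ s, ∫ x, fourier (-n) s * (U (x + s) * conj (U x)) ∂haarAddCircle ∂haarAddCircle := by
    simp only [fourierCoeff, circleAutocorr, smul_eq_mul, integral_const_mul]
  rw [e1, integral_integral_swap hint]
  simp only [inner]
  rw [integral_mul_const, mul_comm]
  congr 1
  rw [fourierCoeff, ← integral_conj]
  refine integral_congr_ae (ae_of_all _ fun x => ?_)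
  simp

lemma integral_sq_circleAutocorr_le {U : AddCircle T → ℂ} (hU : Measurable U) {C ε : ℝ}
    (hC0 : 0 ≤ C) (hC : ∀ x, ‖U x‖ ≤ C) (hε : ∀ n, ‖fourierCoeff U n‖ ≤ ε) :
    ∫ s, ‖circleAutocorr U s‖ ^ 2 ∂(@haarAddCircle T hT) ≤ ε ^ 2 * C ^ 2 := by
  have h1 := hasSum_sq_fourierCoeff_of_memLp (MemLp.of_measurable_of_norm_le hU hC)
  have h2 := hasSum_sq_fourierCoeff_of_memLp (MemLp.of_measurable_of_norm_le
    (measurable_circleAutocorr hU) (norm_circleAutocorr_le hC0 hC))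
  have h3 := hasSum_le (fun n => ?_) h2 (h1.mul_left (ε ^ 2))
  · refine h3.trans ?_
    gcongr
    have : ∫ t, ‖U t‖ ^ 2 ∂(@haarAddCircle T hT) ≤ ∫ _, C ^ 2 ∂(@haarAddCircle T hT) :=
      integral_mono_of_nonneg (ae_of_all _ fun _ => by positivity) (integrable_const _)
        (ae_of_all _ fun x => pow_le_pow_left₀ (norm_nonneg _) (hC x) 2)
    simpa using this
  · rw [fourierCoeff_circleAutocorr hU hC0 hC, norm_mul, RCLike.norm_conj, mul_pow]
    gcongr
    exact hε n

end Circle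

open ComplexConjugate in
lemma integral_sq_autocorr_le {u : ℝ → ℂ} (hu : Continuous u) {C ε L : ℝ} (hL : 0 < L)
    (hC : ∀ x, ‖u x‖ ≤ C) (hε : ∀ lam : ℝ, ‖∫ x in (0:ℝ)..L, u x * freqExp lam x‖ ≤ ε) :
    ∫ s in (0:ℝ)..L, ‖∫ x in (0:ℝ)..(L - s), u (x + s) * conj (u x)‖ ^ 2
      ≤ 2 * L * ε ^ 2 * C ^ 2 := by
  have hC0 : 0 ≤ C := (norm_nonneg _).trans (hC 0)
  set T := 2 * L with hTdef
  have hT0 : 0 < T := by positivity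
  have : Fact (0 < T) := ⟨hT0⟩
  set v : ℝ → ℂ := (Iic L).indicator u with hv
  set U : AddCircle T → ℂ := AddCircle.liftIoc T 0 v with hUdef
  have hvm : Measurable v := hu.measurable.indicator measurableSet_Iic
  have hvC : ∀ x, ‖v x‖ ≤ C := fun x => (norm_indicator_le_norm_self _ _).trans (hC x)
  have hUm : Measurable U :=
    (hvm.comp measurable_subtype_coe).comp (AddCircle.measurableEquivIoc T 0).measurable
  have hUC : ∀ x, ‖U x‖ ≤ C := fun x => hvC _
  have hUv : ∀ x : ℝ, 0 < x → x ≤ T → U x = v x := fun x h0 h1 =>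
    AddCircle.liftIoc_coe_apply ⟨h0, by simpa using h1⟩
  have hcoef : ∀ n, ‖fourierCoeff U n‖ ≤ ε / T := by
    intro n
    rw [fourierCoeff_eq_intervalIntegral _ _ 0, zero_add]
    have e : ∫ x in (0:ℝ)..T, (fourier (-n) (x : AddCircle T)) • U x =
        ∫ x in (0:ℝ)..L, u x * freqExp (-n / T) x := by
      rw [intervalIntegral.integral_of_le hT0.le, intervalIntegral.integral_of_le hL.le]
      have e1 : ∀ x ∈ Ioc 0 T, (fourier (-n) (x : AddCircle T)) • U x =
          (Iic L).indicator (fun x : ℝ => u x * freqExp (-n / T) x) x := by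
        intro x hx
        rw [hUv x hx.1 hx.2, hv]
        by_cases hxL : x ∈ Iic L
        · rw [indicator_of_mem hxL, indicator_of_mem hxL, fourier_coe_apply, smul_eq_mul, mul_comm,
            freqExp]
          congr 2
          push_cast; ring
        · rw [indicator_of_notMem hxL, indicator_of_notMem hxL, smul_zero]
      rw [setIntegral_congr_fun measurableSet_Ioc e1, setIntegral_indicator measurableSet_Iic,
        Ioc_inter_Iic, min_eq_right (by linarith)]
    rw [e, norm_smul, Real.norm_eq_abs, abs_of_pos (by positivity)]
    calc 1 / T * _ ≤ 1 / T * ε := by gcongr; exact hε _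
      _ = ε / T := by ring
  have hmain := integral_sq_circleAutocorr_le hUm hC0 hUC hcoef
  have hw : ∀ s ∈ Ioc 0 L, circleAutocorr U (s : AddCircle T) =
      (1 / T : ℝ) • ∫ x in (0:ℝ)..(L - s), u (x + s) * conj (u x) := by
    intro s hs
    rw [circleAutocorr, AddCircle.integral_haarAddCircle, ← AddCircle.intervalIntegral_preimage T 0,
      zero_add, one_div, intervalIntegral.integral_of_le hT0.le,
      intervalIntegral.integral_of_le (by linarith [hs.2])]
    congr 1
    have e1 : ∀ x ∈ Ioc 0 T, U ((x : AddCircle T) + (s : AddCircle T)) * conj (U x) =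
        (Iic (L - s)).indicator (fun x : ℝ => u (x + s) * conj (u x)) x := by
      intro x hx
      by_cases hxL : x ≤ L
      · rw [← AddCircle.coe_add, hUv x hx.1 hx.2, hUv (x + s) (by linarith [hx.1, hs.1])
          (by linarith [hs.2]), hv, indicator_of_mem (show x ∈ Iic L from hxL)]
        by_cases hxs : x + s ≤ L
        · rw [indicator_of_mem (show x + s ∈ Iic L from hxs),
            indicator_of_mem (show x ∈ Iic (L - s) by simp only [mem_Iic]; linarith)]
        · rw [indicator_of_notMem (show x + s ∉ Iic L from hxs),
            indicator_of_notMem (show x ∉ Iic (L - s) by simp only [mem_Iic]; linarith), zero_mul]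
      · rw [hUv x hx.1 hx.2, hv, indicator_of_notMem (show x ∉ Iic L from hxL),
          indicator_of_notMem (show x ∉ Iic (L - s) by
            simp only [mem_Iic]; linarith [hs.1]), map_zero, mul_zero]
    rw [setIntegral_congr_fun measurableSet_Ioc e1, setIntegral_indicator measurableSet_Iic,
      Ioc_inter_Iic, min_eq_right (by linarith [hs.1])]
  rw [AddCircle.integral_haarAddCircle, ← AddCircle.intervalIntegral_preimage T 0, zero_add] at hmain
  have hmeas := measurable_circleAutocorr hUm
  have hint : IntervalIntegrable (fun s : ℝ => ‖circleAutocorr U (s : AddCircle T)‖ ^ 2) volume 0 T := by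
    rw [intervalIntegrable_iff]
    refine Measure.integrableOn_of_bounded (M := (C * C) ^ 2) (by simp) ?_ (ae_of_all _ fun s => ?_)
    · exact ((hmeas.norm.pow_const 2).comp AddCircle.measurable_mk').aestronglyMeasurable
    · rw [Real.norm_eq_abs, abs_of_nonneg (by positivity)]
      exact pow_le_pow_left₀ (norm_nonneg _) (norm_circleAutocorr_le hC0 hUC _) 2
  have hsub : ∫ s in (0:ℝ)..L, ‖circleAutocorr U (s : AddCircle T)‖ ^ 2 ≤
      ∫ s in (0:ℝ)..T, ‖circleAutocorr U (s : AddCircle T)‖ ^ 2 :=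
    intervalIntegral.integral_mono_interval le_rfl hL.le (by linarith)
      (ae_of_all _ fun _ => by positivity) hint
  have e2 : ∫ s in (0:ℝ)..L, ‖circleAutocorr U (s : AddCircle T)‖ ^ 2 =
      (1 / T) ^ 2 * ∫ s in (0:ℝ)..L, ‖∫ x in (0:ℝ)..(L - s), u (x + s) * conj (u x)‖ ^ 2 := by
    rw [← intervalIntegral.integral_const_mul]
    refine intervalIntegral.integral_congr_ae (ae_of_all _ fun s hs => ?_)
    rw [uIoc_of_le hL.le] at hs
    rw [hw s hs, norm_smul, mul_pow, Real.norm_eq_abs, abs_of_pos (by positivity)]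
  rw [e2] at hsub
  rw [smul_eq_mul, inv_mul_le_iff₀ hT0] at hmain
  have h5 := hsub.trans hmain
  rw [div_pow, one_pow, one_div, inv_mul_le_iff₀ (by positivity)] at h5
  refine h5.trans (le_of_eq ?_)
  field_simp

lemma le_integral_of_window_le {g : ℝ → ℝ} (hg : ∀ a b, IntervalIntegrable g volume a b)
    (h0 : ∀ x, 0 ≤ g x) {l κ : ℝ} (hl : 0 < l) (hκ : 0 ≤ κ)
    (h : ∀ a, κ ≤ ∫ x in a..a + l, g x) {X : ℝ} (hX : l ≤ X) :
    κ / (2 * l) * X ≤ ∫ x in (0:ℝ)..X, g x := by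
  have key : ∀ n : ℕ, n * κ ≤ ∫ x in (0:ℝ)..n * l, g x := by
    intro n
    induction n with
    | zero => simp
    | succ n ih =>
      rw [← intervalIntegral.integral_add_adjacent_intervals (hg 0 (n * l)) (hg _ _)]
      have := h (n * l)
      rw [show (n:ℝ) * l + l = ((n + 1 : ℕ) : ℝ) * l by push_cast; ring] at this
      push_cast at this ⊢
      linarith
  have h1 : 1 ≤ X / l := by rwa [le_div_iff₀ hl, one_mul]
  have hn := Nat.floor_le (a := X / l) (by linarith)
  have hn' := Nat.lt_floor_add_one (X / l)
  have hn1 : (1 : ℝ) ≤ (⌊X / l⌋₊ : ℝ) := by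
    exact_mod_cast (Nat.one_le_floor_iff _).mpr h1
  rw [le_div_iff₀ hl] at hn
  have h2 : ∫ x in (0:ℝ)..⌊X / l⌋₊ * l, g x ≤ ∫ x in (0:ℝ)..X, g x :=
    intervalIntegral.integral_mono_interval le_rfl (by positivity) hn
      (ae_of_all _ fun x => h0 x) (hg _ _)
  refine le_trans ?_ ((key _).trans h2)
  calc κ / (2 * l) * X = (X / l / 2) * κ := by field_simp
    _ ≤ _ := by gcongr; linarith

lemma APR.exists_window_sq_ge {u : ℝ → ℂ} (hu : APR u) {x₀ : ℝ} (hx₀ : u x₀ ≠ 0) :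
    ∃ l > (0:ℝ), ∃ κ > (0:ℝ), ∀ a, κ ≤ ∫ x in a..a + l, ‖u x‖ ^ 2 := by
  have hm : 0 < ‖u x₀‖ := norm_pos_iff.mpr hx₀
  set m := ‖u x₀‖
  obtain ⟨l, hl, H⟩ := hu.2 (m / 4) (by positivity)
  obtain ⟨δ, hδ, hδ1, hU⟩ := hu.uniform (ε := m / 4) (by positivity)
  refine ⟨l + 1, by positivity, δ * (m / 2) ^ 2, by positivity, fun a => ?_⟩
  obtain ⟨t, ht, h1, h2⟩ := H (a - x₀)
  have hi : ∀ a b, IntervalIntegrable (fun x => ‖u x‖ ^ 2) volume a b := fun a b =>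
    (hu.1.norm.pow 2).intervalIntegrable _ _
  have h3 : ∫ x in (x₀ + t)..(x₀ + t + δ), ‖u x‖ ^ 2 ≤ ∫ x in a..a + (l + 1), ‖u x‖ ^ 2 :=
    intervalIntegral.integral_mono_interval (by linarith) (by linarith) (by linarith)
      (ae_of_all _ fun _ => by positivity) (hi _ _)
  refine le_trans ?_ h3
  have h4 : ∫ x in (x₀ + t)..(x₀ + t + δ), (m / 2) ^ 2 ≤ ∫ x in (x₀ + t)..(x₀ + t + δ), ‖u x‖ ^ 2 := by
    refine intervalIntegral.integral_mono_on (by linarith) (by simp) (hi _ _) fun x hx => ?_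
    have e1 := hU (x₀ + t) (x - (x₀ + t)) (abs_le.mpr ⟨by linarith [hx.1], by linarith [hx.2]⟩)
    rw [add_sub_cancel] at e1
    have e2 := ht x₀
    have e3 : u x₀ = (u x₀ - u (x₀ + t)) - (u x - u (x₀ + t)) + u x := by ring
    have e4 : m ≤ m / 4 + m / 4 + ‖u x‖ := by
      calc m = ‖(u x₀ - u (x₀ + t)) - (u x - u (x₀ + t)) + u x‖ := by rw [← e3]
        _ ≤ ‖u x₀ - u (x₀ + t)‖ + ‖u x - u (x₀ + t)‖ + ‖u x‖ :=
          (norm_add_le _ _).trans (by gcongr; exact norm_sub_le _ _)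
        _ ≤ _ := by gcongr
    gcongr
    linarith
  refine le_trans ?_ h4
  rw [intervalIntegral.integral_const, smul_eq_mul]
  simp

/-- The set of translations moving `u` by at most `η` in the sup norm. -/
def almostPeriods (u : ℝ → ℂ) (η : ℝ) : Set ℝ := {s | ∀ x, ‖u (x + s) - u x‖ ≤ η}

lemma isClosed_almostPeriods {u : ℝ → ℂ} (hu : Continuous u) (η : ℝ) :
    IsClosed (almostPeriods u η) := by
  simp only [almostPeriods, ofPred_forall]
  exact isClosed_iInter fun x => isClosed_le (by fun_prop) continuous_const

lemma intervalIntegrable_indicator_one {G : Set ℝ} (hG : MeasurableSet G) (a b : ℝ) :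
    IntervalIntegrable (G.indicator fun _ => (1:ℝ)) volume a b := by
  rw [intervalIntegrable_iff]
  exact (integrableOn_const (by simp)).indicator hG

lemma APR.exists_window_almostPeriods_ge {u : ℝ → ℂ} (hu : APR u) {η : ℝ} (hη : 0 < η) :
    ∃ l > (0:ℝ), ∃ δ > (0:ℝ), ∀ a,
      δ ≤ ∫ s in a..a + l, (almostPeriods u η).indicator (fun _ => (1:ℝ)) s := by
  obtain ⟨l, hl, H⟩ := hu.2 (η / 2) (by positivity)
  obtain ⟨δ, hδ, hδ1, hU⟩ := hu.uniform (ε := η / 2) (by positivity)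
  refine ⟨l + 1, by positivity, δ, hδ, fun a => ?_⟩
  obtain ⟨t, ht, h1, h2⟩ := H a
  have hi := intervalIntegrable_indicator_one (isClosed_almostPeriods hu.1 η).measurableSet
  refine le_trans ?_ (intervalIntegral.integral_mono_interval h1.le (le_add_of_nonneg_right hδ.le)
    (by linarith) (ae_of_all _ fun s => indicator_nonneg (fun _ _ => zero_le_one) s) (hi a _))
  have : ∫ s in t..t + δ, (1:ℝ) ≤
      ∫ s in t..t + δ, (almostPeriods u η).indicator (fun _ => (1:ℝ)) s := by
    refine intervalIntegral.integral_mono_on (by linarith) (by simp) (hi _ _) fun s hs => ?_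
    rw [indicator_of_mem]
    intro x
    have e1 := hU (x + t) (s - t) (abs_le.mpr ⟨by linarith [hs.1], by linarith [hs.2]⟩)
    have e2 := ht x
    rw [norm_sub_rev] at e2
    rw [show x + t + (s - t) = x + s by ring] at e1
    have := norm_add_le (u (x + s) - u (x + t)) (u (x + t) - u x)
    rw [sub_add_sub_cancel] at this
    linarith
  simpa using this

open ComplexConjugate in
lemma continuous_autocorr {u : ℝ → ℂ} (hu : Continuous u) (L : ℝ) :
    Continuous fun s : ℝ => ∫ x in (0:ℝ)..(L - s), u (x + s) * conj (u x) := by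
  refine intervalIntegral.continuous_parametric_intervalIntegral_of_continuous
    (f := fun s x : ℝ => u (x + s) * conj (u x)) ?_ (by fun_prop)
  exact (hu.comp (by fun_prop)).mul (Complex.continuous_conj.comp (hu.comp continuous_snd))

open ComplexConjugate in
lemma norm_autocorr_ge {u : ℝ → ℂ} (hu : Continuous u) {C η : ℝ} (hC : ∀ x, ‖u x‖ ≤ C)
    {s X : ℝ} (hX : 0 ≤ X) (hs : s ∈ almostPeriods u η) :
    (∫ x in (0:ℝ)..X, ‖u x‖ ^ 2) - η * C * X ≤
      ‖∫ x in (0:ℝ)..X, u (x + s) * conj (u x)‖ := by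
  have hη : 0 ≤ η := (norm_nonneg _).trans (hs 0)
  have h1 : ‖∫ x in (0:ℝ)..X, (u (x + s) - u x) * conj (u x)‖ ≤ η * C * |X - 0| := by
    refine intervalIntegral.norm_integral_le_of_norm_le_const fun x _ => ?_
    rw [norm_mul, RCLike.norm_conj]
    gcongr
    exacts [hs x, hC x]
  rw [sub_zero, abs_of_nonneg hX] at h1
  have h2 : ∫ x in (0:ℝ)..X, (u (x + s) - u x) * conj (u x) =
      (∫ x in (0:ℝ)..X, u (x + s) * conj (u x)) - ((∫ x in (0:ℝ)..X, ‖u x‖ ^ 2 : ℝ) : ℂ) := by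
    rw [← intervalIntegral.integral_ofReal, ← intervalIntegral.integral_sub]
    · congr 1; ext x
      rw [sub_mul, Complex.mul_conj, Complex.normSq_eq_norm_sq]
    · exact ((hu.comp (by fun_prop)).mul (Complex.continuous_conj.comp hu)).intervalIntegrable _ _
    · exact (by fun_prop : Continuous fun x => ((‖u x‖ ^ 2 : ℝ) : ℂ)).intervalIntegrable _ _
  rw [h2] at h1
  have h3 := norm_sub_norm_le ((∫ x in (0:ℝ)..X, ‖u x‖ ^ 2 : ℝ) : ℂ)
    (∫ x in (0:ℝ)..X, u (x + s) * conj (u x))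
  rw [norm_sub_rev] at h3
  have h4 := Complex.re_le_norm ((∫ x in (0:ℝ)..X, ‖u x‖ ^ 2 : ℝ) : ℂ)
  rw [Complex.ofReal_re] at h4
  linarith

/-- An almost periodic function all of whose Fourier–Bohr coefficients vanish is zero. -/
theorem APR.eq_zero_of_hasMeanR_zero {u : ℝ → ℂ} (hu : APR u) (h0 : ∀ lam, HasMeanR u lam 0)
    (x₀ : ℝ) : u x₀ = 0 := by
  by_contra hx₀
  obtain ⟨C, hC0, hC⟩ := hu.exists_bound
  obtain ⟨l, hl, κ, hκ, hw⟩ := hu.exists_window_sq_ge hx₀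
  set k := κ / (2 * l) with hk
  have hk0 : 0 < k := by positivity
  set η := k / (4 * C) with hη
  have hη0 : 0 < η := by positivity
  obtain ⟨l', hl', δ, hδ, hw'⟩ := hu.exists_window_almostPeriods_ge hη0
  set d := δ / (2 * l') with hd
  have hd0 : 0 < d := by positivity
  obtain ⟨T₀, hT₀, H⟩ := hu.integral_freqExp_le h0 (ε := k * √d / (16 * C)) (by positivity)
  set M := max T₀ (max l l') with hM
  have hM0 : 0 < M := lt_max_of_lt_left hT₀
  have hup := integral_sq_autocorr_le hu.1 (L := 2 * M) (by positivity) hC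
    (H (2 * M) (by linarith [le_max_left T₀ (max l l')]))
  have hcont := (continuous_autocorr hu.1 (2 * M)).norm.pow 2
  have hsq := le_integral_of_window_le (X := M) (g := fun x => ‖u x‖ ^ 2)
    (fun a b => (hu.1.norm.pow 2).intervalIntegrable a b) (fun _ => by positivity) hl hκ.le hw
    (le_max_of_le_right (le_max_left _ _))
  have hG := (isClosed_almostPeriods hu.1 η).measurableSet
  have hgood := le_integral_of_window_le (X := M) (intervalIntegrable_indicator_one hG)
    (indicator_nonneg fun _ _ => zero_le_one) hl' hδ.le hw'
    (le_max_of_le_right (le_max_right _ _))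
  have hlow : ∫ s in (0:ℝ)..M, (k * M / 2) ^ 2 *
        (almostPeriods u η).indicator (fun _ => (1:ℝ)) s ≤
      ∫ s in (0:ℝ)..M, ‖∫ x in (0:ℝ)..(2 * M - s), u (x + s) * (starRingEnd ℂ) (u x)‖ ^ 2 := by
    refine intervalIntegral.integral_mono_on hM0.le
      ((intervalIntegrable_indicator_one hG _ _).const_mul _) (hcont.intervalIntegrable _ _)
      fun s hs => ?_
    by_cases hsG : s ∈ almostPeriods u η
    · rw [indicator_of_mem hsG, mul_one]
      have h1 := norm_autocorr_ge hu.1 hC (X := 2 * M - s) (by linarith [hs.2]) hsG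
      have h2 : ∫ x in (0:ℝ)..M, ‖u x‖ ^ 2 ≤ ∫ x in (0:ℝ)..(2 * M - s), ‖u x‖ ^ 2 :=
        intervalIntegral.integral_mono_interval le_rfl hM0.le (by linarith [hs.2])
          (ae_of_all _ fun _ => by positivity) ((hu.1.norm.pow 2).intervalIntegrable _ _)
      have h3 : η * C * (2 * M - s) ≤ η * C * (2 * M) := by gcongr; linarith [hs.1]
      have h4 : η * C * (2 * M) = k * M / 2 := by rw [hη]; field_simp; ring
      gcongr
      linarith
    · rw [indicator_of_notMem hsG, mul_zero]; positivity
  rw [intervalIntegral.integral_const_mul] at hlow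
  have hmono : ∫ s in (0:ℝ)..M, ‖∫ x in (0:ℝ)..(2 * M - s), u (x + s) * (starRingEnd ℂ) (u x)‖ ^ 2 ≤
      ∫ s in (0:ℝ)..(2 * M), ‖∫ x in (0:ℝ)..(2 * M - s), u (x + s) * (starRingEnd ℂ) (u x)‖ ^ 2 :=
    intervalIntegral.integral_mono_interval le_rfl hM0.le (by linarith)
      (ae_of_all _ fun _ => by positivity) (hcont.intervalIntegrable _ _)
  have h5 : (k * M / 2) ^ 2 * (d * M) ≤ 2 * (2 * M) * (k * √d / (16 * C) * (2 * M)) ^ 2 * C ^ 2 :=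
    (mul_le_mul_of_nonneg_left hgood (by positivity)).trans (hlow.trans (hmono.trans hup))
  have h6 : 2 * (2 * M) * (k * √d / (16 * C) * (2 * M)) ^ 2 * C ^ 2 = k ^ 2 * M ^ 3 * d / 16 := by
    rw [mul_pow, div_pow, mul_pow k, Real.sq_sqrt hd0.le]
    field_simp; ring
  have h7 : 0 < k ^ 2 * M ^ 3 * d := by positivity
  rw [h6] at h5
  nlinarith

lemma mem_UHP {z : ℂ} : z ∈ UHP ↔ 0 < z.im := Iff.rfl

lemma isOpen_UHP : IsOpen UHP := isOpen_lt continuous_const Complex.continuous_im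

lemma continuous_slice {g : ℂ → ℂ} (hg : ContinuousOn g UHP) {y : ℝ} (hy : 0 < y) :
    Continuous fun x : ℝ => g ((x : ℂ) + (y : ℂ) * Complex.I) :=
  hg.comp_continuous (by fun_prop) fun x => by simpa [mem_UHP] using hy

lemma APH.continuousOn {g : ℂ → ℂ} (hg : APH g) : ContinuousOn g UHP := hg.1.continuousOn

lemma APH.apr_slice {g : ℂ → ℂ} (hg : APH g) {y : ℝ} (hy : 0 < y) :
    APR fun x : ℝ => g ((x : ℂ) + (y : ℂ) * Complex.I) := by
  refine ⟨continuous_slice hg.continuousOn hy, fun ε hε => ?_⟩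
  obtain ⟨τ, hτ, H⟩ := hg.2 (y / 2) (2 * y) ε (by positivity) (by linarith) hε
  refine hτ.mono fun t ht x => ?_
  have := H t ht ((x : ℂ) + (y : ℂ) * Complex.I) (by simp; linarith) (by simp; linarith)
  rwa [show (x : ℂ) + (y : ℂ) * Complex.I + (t : ℂ) = ((x + t : ℝ) : ℂ) + (y : ℂ) * Complex.I by
    push_cast; ring] at this

lemma APH.exists_bound_strip {g : ℂ → ℂ} (hg : APH g) {α : ℝ} (hα : 0 < α) (β : ℝ) :
    ∃ C > (0:ℝ), ∀ z : ℂ, α ≤ z.im → z.im ≤ β → ‖g z‖ ≤ C := by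
  obtain ⟨τ, ⟨l, hl, hτ⟩, H⟩ := hg.2 (α / 2) (max β α + 1) 1 (by positivity)
    (by linarith [le_max_right β α]) one_pos
  have hK : IsCompact (Icc 0 l ×ℂ Icc α β) := isCompact_Icc.reProdIm isCompact_Icc
  obtain ⟨M, hM⟩ := hK.exists_bound_of_continuousOn
    (hg.continuousOn.mono fun z hz => hα.trans_le (Complex.mem_reProdIm.mp hz).2.1)
  refine ⟨max (M + 1) 1, by positivity, fun z h1 h2 => le_max_of_le_left ?_⟩
  obtain ⟨t, ht, h3, h4⟩ := hτ (-z.re)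
  have h5 := hM (z + t) (Complex.mem_reProdIm.mpr
    ⟨⟨by simp; linarith, by simp; linarith⟩, by simpa using h1, by simpa using h2⟩)
  have h6 := H t ht z (by linarith) (by linarith [le_max_left β α])
  have h7 := norm_add_le (g z - g (z + t)) (g (z + t))
  rw [sub_add_cancel] at h7
  linarith

lemma hasMeanAt_iff {g : ℂ → ℂ} {y lam : ℝ} {c : ℂ} :
    HasMeanAt g y lam c ↔ Tendsto (fun T : ℝ => (1 / (2 * (T : ℂ))) *
      ∫ x in (-T)..T, g ((x : ℂ) + (y : ℂ) * Complex.I) *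
        freqExp (-lam) ((x : ℂ) + (y : ℂ) * Complex.I)) atTop (𝓝 c) := by
  simp only [HasMeanAt, freqExp_neg_left]

lemma hasMeanR_iff {u : ℝ → ℂ} {lam : ℝ} {c : ℂ} :
    HasMeanR u lam c ↔ Tendsto (fun T : ℝ => (1 / (2 * (T : ℂ))) *
      ∫ x in (-T)..T, u x * freqExp (-lam) x) atTop (𝓝 c) := by
  simp only [HasMeanR, freqExp_neg_left]

lemma HasMeanR.const_mul {u : ℝ → ℂ} {lam : ℝ} {c : ℂ} (h : HasMeanR u lam c) (k : ℂ) :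
    HasMeanR (fun x => k * u x) lam (k * c) := by
  rw [hasMeanR_iff] at h ⊢
  refine (h.const_mul k).congr fun T => ?_
  simp only [mul_assoc, intervalIntegral.integral_const_mul]
  ring

lemma freqExp_mul_neg (μ : ℝ) (z : ℂ) : freqExp μ z * freqExp (-μ) z = 1 := by
  rw [← freqExp_add_left, add_neg_cancel, freqExp_zero_left]

lemma freqExp_im (μ y : ℝ) : freqExp μ (y * Complex.I) = Real.exp (-(2 * Real.pi * μ * y)) := by
  rw [freqExp, show 2 * (Real.pi : ℂ) * Complex.I * μ * (y * Complex.I) =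
    2 * Real.pi * μ * y * (Complex.I * Complex.I) by ring, Complex.I_mul_I]
  push_cast; ring_nf

lemma hasMeanAt_iff_hasMeanR {g : ℂ → ℂ} {y lam : ℝ} {c : ℂ} :
    HasMeanAt g y lam c ↔ HasMeanR (fun x : ℝ => g ((x : ℂ) + (y : ℂ) * Complex.I)) lam
      (freqExp lam (y * Complex.I) * c) := by
  have e : ∀ T : ℝ, ∫ x in (-T)..T, g ((x : ℂ) + (y : ℂ) * Complex.I) *
        freqExp (-lam) ((x : ℂ) + (y : ℂ) * Complex.I) = freqExp (-lam) (y * Complex.I) *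
      ∫ x in (-T)..T, g ((x : ℂ) + (y : ℂ) * Complex.I) * freqExp (-lam) x := fun T => by
    rw [← intervalIntegral.integral_const_mul]
    congr 1; ext x; rw [freqExp_add]; ring
  rw [hasMeanAt_iff, hasMeanR_iff]
  simp only [e]
  constructor
  · intro h
    refine (h.const_mul (freqExp lam (y * Complex.I))).congr fun T => ?_
    linear_combination (1 / (2 * (T : ℂ))) *
      (∫ x in (-T)..T, g ((x : ℂ) + (y : ℂ) * Complex.I) * freqExp (-lam) x) *
      freqExp_mul_neg lam (y * Complex.I)
  · intro h
    have h2 := h.const_mul (freqExp (-lam) (y * Complex.I))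
    rw [← mul_assoc, mul_comm (freqExp (-lam) _), freqExp_mul_neg, one_mul] at h2
    exact h2.congr fun T => by ring

lemma HasMeanAt.unique {g : ℂ → ℂ} {y lam : ℝ} {c c' : ℂ} (h : HasMeanAt g y lam c)
    (h' : HasMeanAt g y lam c') : c = c' := tendsto_nhds_unique h h'

lemma HasMeanAt.congr {g h : ℂ → ℂ} {y lam : ℝ} {c : ℂ} (hm : HasMeanAt g y lam c) (hy : 0 < y)
    (e : ∀ z ∈ UHP, h z = g z) : HasMeanAt h y lam c := by
  have : ∀ x : ℝ, h ((x : ℂ) + (y : ℂ) * Complex.I) = g ((x : ℂ) + (y : ℂ) * Complex.I) :=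
    fun x => e _ (by simpa [mem_UHP] using hy)
  unfold HasMeanAt at hm ⊢
  simpa only [this] using hm

lemma HasMeanAt.const_mul {g : ℂ → ℂ} {y lam : ℝ} {c : ℂ} (h : HasMeanAt g y lam c) (k : ℂ) :
    HasMeanAt (fun z => k * g z) y lam (k * c) := by
  rw [hasMeanAt_iff_hasMeanR] at h ⊢
  simpa only [mul_left_comm k] using h.const_mul k

lemma HasMeanAt.add {g h : ℂ → ℂ} {y lam : ℝ} {c d : ℂ} (hg : HasMeanAt g y lam c)
    (hh : HasMeanAt h y lam d) (hy : 0 < y) (hgc : ContinuousOn g UHP) (hhc : ContinuousOn h UHP) :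
    HasMeanAt (fun z => g z + h z) y lam (c + d) := by
  rw [hasMeanAt_iff] at *
  refine (hg.add hh).congr fun T => ?_
  rw [← mul_add, ← intervalIntegral.integral_add]
  · simp only [add_mul]
  · exact ((continuous_slice hgc hy).mul (by fun_prop)).intervalIntegrable _ _
  · exact ((continuous_slice hhc hy).mul (by fun_prop)).intervalIntegrable _ _

lemma hasMeanAt_zero (y lam : ℝ) : HasMeanAt (fun _ => 0) y lam 0 := by
  simp [hasMeanAt_iff]

lemma hasMeanAt_freqExp (μ y lam : ℝ) :
    HasMeanAt (freqExp μ) y lam (if lam = μ then 1 else 0) := by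
  rw [hasMeanAt_iff]
  split_ifs with h
  · subst h
    simp only [freqExp_mul_neg, intervalIntegral.integral_const]
    refine tendsto_const_nhds.congr' ?_
    filter_upwards [eventually_gt_atTop 0] with T hT
    have : (T : ℂ) ≠ 0 := by exact_mod_cast hT.ne'
    rw [Complex.real_smul]
    push_cast
    field_simp
    ring
  · have hν : μ - lam ≠ 0 := sub_ne_zero.mpr (Ne.symm h)
    set k : ℂ := 2 * Real.pi * Complex.I * (μ - lam : ℝ) with hk
    have hk0 : k ≠ 0 := by
      have : ((μ - lam : ℝ) : ℂ) ≠ 0 := by exact_mod_cast hν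
      simp [hk, this, Real.pi_ne_zero, -ofReal_sub]
    have e : ∀ T : ℝ, ∫ x in (-T)..T, freqExp μ ((x : ℂ) + (y : ℂ) * Complex.I) *
        freqExp (-lam) ((x : ℂ) + (y : ℂ) * Complex.I) =
        freqExp (μ - lam) (y * Complex.I) * ((freqExp (μ - lam) T - freqExp (μ - lam) (-T : ℝ)) / k) := by
      intro T
      have e1 : ∀ x : ℝ, freqExp (μ - lam) x = Complex.exp (k * x) := fun _ => rfl
      rw [e1, e1, ← integral_exp_mul_complex hk0, ← intervalIntegral.integral_const_mul]
      congr 1; ext x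
      rw [← freqExp_add_left, ← sub_eq_add_neg, freqExp_add, mul_comm]
      rfl
    simp only [e]
    refine squeeze_zero_norm' (a := fun T : ℝ => 1 / (2 * T) *
      (‖freqExp (μ - lam) (y * Complex.I)‖ * (2 / ‖k‖))) ?_ ?_
    · filter_upwards [eventually_gt_atTop 0] with T hT
      rw [norm_mul, norm_mul, norm_div _ k]
      have h1 : ‖1 / (2 * (T : ℂ))‖ = 1 / (2 * T) := by simp [abs_of_pos hT]
      have h2 : ‖freqExp (μ - lam) T - freqExp (μ - lam) (-T : ℝ)‖ ≤ 2 := by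
        refine (norm_sub_le _ _).trans ?_
        rw [norm_freqExp_real, norm_freqExp_real]; norm_num
      rw [h1]
      gcongr
    · have : Tendsto (fun T : ℝ => 1 / (2 * T)) atTop (𝓝 0) := by
        simp only [one_div]
        exact tendsto_inv_atTop_zero.comp (tendsto_id.const_mul_atTop two_pos)
      simpa using this.mul_const (‖freqExp (μ - lam) (y * Complex.I)‖ * (2 / ‖k‖))

lemma APH.hasMeanAt_indep {g : ℂ → ℂ} (hg : APH g) {y₁ y₂ lam : ℝ} {c : ℂ} (h₁ : 0 < y₁)
    (h₂ : 0 < y₂) (h : HasMeanAt g y₁ lam c) : HasMeanAt g y₂ lam c := by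
  rw [hasMeanAt_iff] at *
  set k : ℂ → ℂ := fun z => g z * freqExp (-lam) z with hk
  have hkd : DifferentiableOn ℂ k UHP := hg.1.mul (differentiable_freqExp _).differentiableOn
  have hpos : 0 < min y₁ y₂ := lt_min h₁ h₂
  obtain ⟨C, hC, hb⟩ := hg.exists_bound_strip hpos (max y₁ y₂)
  set E := Real.exp (2 * Real.pi * |lam| * max y₁ y₂)
  have hkb : ∀ z : ℂ, min y₁ y₂ ≤ z.im → z.im ≤ max y₁ y₂ → ‖k z‖ ≤ C * E := by
    intro z h3 h4
    rw [hk, norm_mul, norm_freqExp]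
    have : lam * z.im ≤ |lam| * max y₁ y₂ :=
      mul_le_mul (le_abs_self _) h4 (hpos.le.trans h3) (abs_nonneg _)
    refine mul_le_mul (hb z h3 h4) (Real.exp_le_exp.mpr ?_) (by positivity) hC.le
    nlinarith [Real.pi_pos]
  have hvert : ∀ T : ℝ, ‖∫ y in y₁..y₂, k (T + y * Complex.I)‖ ≤ C * E * |y₂ - y₁| := by
    refine fun T => intervalIntegral.norm_integral_le_of_norm_le_const fun y hy => ?_
    have hy' := uIoc_subset_uIcc hy
    rw [uIcc, mem_Icc] at hy'
    exact hkb _ (by simpa using hy'.1) (by simpa using hy'.2)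
  have hrect : ∀ T : ℝ, ‖(∫ x in (-T)..T, k (x + y₂ * Complex.I)) -
      ∫ x in (-T)..T, k (x + y₁ * Complex.I)‖ ≤ 2 * (C * E * |y₂ - y₁|) := by
    intro T
    have := Complex.integral_boundary_rect_eq_zero_of_differentiableOn k
      (-T + y₁ * Complex.I) (T + y₂ * Complex.I) (hkd.mono fun z hz => by
        have := (Complex.mem_reProdIm.mp hz).2
        simp only [Complex.add_im, Complex.neg_im, Complex.ofReal_im, Complex.mul_im,
          Complex.ofReal_re, Complex.I_im, Complex.I_re, uIcc, mem_Icc] at this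
        norm_num at this
        exact mem_UHP.mpr (lt_of_lt_of_le hpos (by simpa using this.1)))
    simp only [Complex.add_im, Complex.neg_im, Complex.ofReal_im, Complex.mul_im,
          Complex.ofReal_re, Complex.I_im, Complex.I_re, Complex.add_re, Complex.neg_re,
          Complex.mul_re, mul_zero, mul_one, add_zero, neg_zero, zero_add, sub_zero,
          smul_eq_mul] at this
    have e : (∫ x in (-T)..T, k (x + y₂ * Complex.I)) - ∫ x in (-T)..T, k (x + y₁ * Complex.I) =
        Complex.I * (∫ y in y₁..y₂, k (T + y * Complex.I)) -
        Complex.I * (∫ y in y₁..y₂, k ((-T : ℝ) + y * Complex.I)) := by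
      linear_combination -this
    rw [e]
    refine (norm_sub_le _ _).trans ?_
    rw [norm_mul, norm_mul, Complex.norm_I, one_mul, one_mul]
    linarith [hvert T, hvert (-T)]
  have hz : Tendsto (fun T : ℝ => (1 / (2 * (T : ℂ))) * ((∫ x in (-T)..T, k (x + y₂ * Complex.I)) -
      ∫ x in (-T)..T, k (x + y₁ * Complex.I))) atTop (𝓝 0) := by
    refine squeeze_zero_norm' (a := fun T : ℝ => 1 / (2 * T) * (2 * (C * E * |y₂ - y₁|))) ?_ ?_
    · filter_upwards [eventually_gt_atTop 0] with T hT
      have h1 : ‖1 / (2 * (T : ℂ))‖ = 1 / (2 * T) := by simp [abs_of_pos hT]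
      rw [norm_mul, h1]
      gcongr
      exact hrect T
    · have : Tendsto (fun T : ℝ => 1 / (2 * T)) atTop (𝓝 0) := by
        simp only [one_div]
        exact tendsto_inv_atTop_zero.comp (tendsto_id.const_mul_atTop two_pos)
      simpa using this.mul_const (2 * (C * E * |y₂ - y₁|))
  simpa using (h.add hz).congr fun T => by ring

lemma APH.exists_hasMeanAt {g : ℂ → ℂ} (hg : APH g) (lam : ℝ) :
    ∃ c, ∀ y > (0:ℝ), HasMeanAt g y lam c := by
  obtain ⟨c, hc⟩ := ((hg.apr_slice one_pos).mul_freqExp (-lam)).exists_hasUniformMean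
  refine ⟨freqExp (-lam) ((1 : ℝ) * Complex.I) * c, fun y hy => hg.hasMeanAt_indep one_pos hy ?_⟩
  rw [hasMeanAt_iff_hasMeanR, ← mul_assoc, freqExp_mul_neg, one_mul]
  exact HasUniformMean.hasMeanR hc

lemma APH.relDense_common {g : ℂ → ℂ} (hg : APH g) (μ : ℝ) {α β ε δ : ℝ} (hα : 0 < α)
    (hαβ : α < β) (hε : 0 < ε) (hδ : 0 < δ) :
    RelDense {t : ℝ | (∀ z : ℂ, α < z.im → z.im < β → ‖g z - g (z + t)‖ ≤ ε) ∧
      ‖freqExp μ t - 1‖ ≤ δ} := by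
  obtain ⟨τ, hτ, H⟩ := hg.2 α β (ε / 2) hα hαβ (by positivity)
  refine (hτ.sub_freqExp μ hδ).mono ?_
  rintro t ⟨s, hs, s', hs', rfl, ht⟩
  refine ⟨fun z h1 h2 => ?_, ht⟩
  have e1 := H s hs (z - s') (by simpa using h1) (by simpa using h2)
  have e2 := H s' hs' (z - s') (by simpa using h1) (by simpa using h2)
  rw [sub_add_cancel] at e2
  rw [show z + ((s - s' : ℝ) : ℂ) = z - s' + s by push_cast; ring]
  have := norm_sub_le (g (z - s') - g (z - s' + s)) (g (z - s') - g z)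
  rw [sub_sub_sub_cancel_left] at this
  linarith

lemma norm_freqExp_le {μ β : ℝ} {z : ℂ} (h0 : 0 < z.im) (h : z.im < β) :
    ‖freqExp μ z‖ ≤ Real.exp (2 * Real.pi * |μ| * β) := by
  rw [norm_freqExp]
  have : -μ * z.im ≤ |μ| * β :=
    mul_le_mul (neg_le_abs _) h.le h0.le (abs_nonneg _)
  gcongr
  nlinarith [Real.pi_pos]

lemma APH.add_const_mul_freqExp {g : ℂ → ℂ} (hg : APH g) (c : ℂ) (μ : ℝ) :
    APH fun z => g z + c * freqExp μ z := by
  refine ⟨hg.1.add ((differentiable_freqExp μ).const_mul c).differentiableOn,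
    fun α β ε hα hαβ hε => ?_⟩
  set E := Real.exp (2 * Real.pi * |μ| * β)
  refine ⟨_, hg.relDense_common μ hα hαβ (half_pos hε)
    (δ := ε / 2 / ((‖c‖ + 1) * E)) (by positivity), fun t ht z h1 h2 => ?_⟩
  have e : g z + c * freqExp μ z - (g (z + t) + c * freqExp μ (z + t)) =
      (g z - g (z + t)) - c * freqExp μ z * (freqExp μ t - 1) := by rw [freqExp_add]; ring
  rw [e]
  have h3 : ‖c * freqExp μ z * (freqExp μ t - 1)‖ ≤
      ((‖c‖ + 1) * E) * (ε / 2 / ((‖c‖ + 1) * E)) := by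
    rw [norm_mul, norm_mul]
    gcongr
    · linarith
    · exact norm_freqExp_le (hα.trans h1) h2
    · exact ht.2
  rw [mul_div_cancel₀ _ (by positivity)] at h3
  linarith [norm_sub_le (g z - g (z + t)) (c * freqExp μ z * (freqExp μ t - 1)), ht.1 z h1 h2]

lemma APH.mul_freqExp {g : ℂ → ℂ} (hg : APH g) (μ : ℝ) : APH fun z => g z * freqExp μ z := by
  refine ⟨hg.1.mul (differentiable_freqExp μ).differentiableOn, fun α β ε hα hαβ hε => ?_⟩
  set E := Real.exp (2 * Real.pi * |μ| * β)
  obtain ⟨C, hC, hb⟩ := hg.exists_bound_strip hα β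
  refine ⟨_, hg.relDense_common μ hα hαβ (ε := ε / 2 / E) (by positivity)
    (δ := ε / 2 / (C * E)) (by positivity), fun t ht z h1 h2 => ?_⟩
  have e : g z * freqExp μ z - g (z + t) * freqExp μ (z + t) =
      (g z - g (z + t)) * freqExp μ (z + t) - g z * freqExp μ z * (freqExp μ t - 1) := by
    rw [freqExp_add]; ring
  have h3 : ‖g z * freqExp μ z * (freqExp μ t - 1)‖ ≤ (C * E) * (ε / 2 / (C * E)) := by
    rw [norm_mul, norm_mul]
    gcongr
    · exact hb z h1.le h2.le
    · exact norm_freqExp_le (hα.trans h1) h2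
    · exact ht.2
  have h4 : ‖(g z - g (z + t)) * freqExp μ (z + t)‖ ≤ (ε / 2 / E) * E := by
    rw [norm_mul]
    gcongr
    · exact ht.1 z h1 h2
    · exact norm_freqExp_le (by simpa using hα.trans h1) (by simpa using h2)
  rw [mul_div_cancel₀ _ (by positivity)] at h3
  rw [div_mul_cancel₀ _ (by positivity)] at h4
  rw [e]
  linarith [norm_sub_le ((g z - g (z + t)) * freqExp μ (z + t))
    (g z * freqExp μ z * (freqExp μ t - 1))]

/-- The Poisson kernel of the upper half-plane. -/
def poissonKer (y s : ℝ) : ℝ := y / (Real.pi * (s ^ 2 + y ^ 2))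

lemma poissonKer_nonneg {y : ℝ} (hy : 0 < y) (s : ℝ) : 0 ≤ poissonKer y s := by
  unfold poissonKer; positivity

lemma integrable_poissonKer {y : ℝ} (hy : 0 < y) : Integrable (poissonKer y) := by
  have h := (integrable_inv_one_add_sq.comp_mul_right' (R := y⁻¹)
    (by positivity)).const_mul (1 / (Real.pi * y))
  refine h.congr (ae_of_all _ fun s => ?_)
  simp only [poissonKer]
  field_simp
  ring

lemma integral_exp_neg_abs_mul_exp {y : ℝ} (hy : 0 < y) (s : ℝ) :
    Integrable (fun v : ℝ => (Real.exp (-(2 * Real.pi * y * |v|)) : ℂ)) ∧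
    ∫ v : ℝ, Complex.exp (↑(-2 * Real.pi * v * s) * Complex.I) *
      (Real.exp (-(2 * Real.pi * y * |v|)) : ℂ) = poissonKer y s := by
  have hc : 0 < 2 * Real.pi * y := by positivity
  set a : ℂ := 2 * Real.pi * (y - s * Complex.I) with ha
  set b : ℂ := -(2 * Real.pi * (y + s * Complex.I)) with hb
  have har : 0 < a.re := by simp [ha]; positivity
  have hbr : b.re < 0 := by simp [hb]; positivity
  set Φ : ℝ → ℂ := fun v => Complex.exp (↑(-2 * Real.pi * v * s) * Complex.I) *
      (Real.exp (-(2 * Real.pi * y * |v|)) : ℂ) with hΦ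
  have e1 : ∀ v ∈ Iic (0:ℝ), Complex.exp (a * v) = Φ v := by
    intro v hv
    simp only [hΦ, Complex.ofReal_exp, ← Complex.exp_add, abs_of_nonpos (mem_Iic.mp hv), ha]
    congr 1; push_cast; ring
  have e2 : ∀ v ∈ Ioi (0:ℝ), Complex.exp (b * v) = Φ v := by
    intro v hv
    simp only [hΦ, Complex.ofReal_exp, ← Complex.exp_add, abs_of_pos (mem_Ioi.mp hv), hb]
    congr 1; push_cast; ring
  have i1 : IntegrableOn Φ (Iic 0) :=
    (integrableOn_exp_mul_complex_Iic har 0).congr_fun e1 measurableSet_Iic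
  have i2 : IntegrableOn Φ (Ioi 0) :=
    (integrableOn_exp_mul_complex_Ioi hbr 0).congr_fun e2 measurableSet_Ioi
  have i3 : Integrable Φ := by
    rw [← integrableOn_univ, ← Iic_union_Ioi (a := (0:ℝ))]; exact i1.union i2
  constructor
  · refine (integrable_norm_iff (by fun_prop)).mp (i3.norm.congr (ae_of_all _ fun v => ?_))
    simp only [hΦ, norm_mul, Complex.norm_exp_ofReal_mul_I, one_mul]
  · rw [← intervalIntegral.integral_Iic_add_Ioi i1 i2,
      ← setIntegral_congr_fun measurableSet_Iic e1, ← setIntegral_congr_fun measurableSet_Ioi e2,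
      integral_exp_mul_complex_Iic har, integral_exp_mul_complex_Ioi hbr]
    have ha0 : a ≠ 0 := fun h => by simp [h] at har
    have hb0 : b ≠ 0 := fun h => by simp [h] at hbr
    have hab : a * -b = 4 * Real.pi ^ 2 * (s ^ 2 + y ^ 2) := by
      rw [ha, hb]; linear_combination (-4 * (Real.pi:ℂ)^2 * s^2) * Complex.I_mul_I
    have hsum : a + -b = 4 * Real.pi * y := by rw [ha, hb]; ring
    have hsy : ((s:ℂ) ^ 2 + y ^ 2) ≠ 0 := by
      have : s ^ 2 + y ^ 2 ≠ 0 := by positivity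
      exact_mod_cast this
    have hpi : (Real.pi : ℂ) ≠ 0 := by simp [Real.pi_ne_zero]
    have : Complex.exp (a * (0:ℝ)) / a + -Complex.exp (b * (0:ℝ)) / b = (a + -b) / (a * -b) := by
      simp only [Complex.ofReal_zero, mul_zero, Complex.exp_zero]
      field_simp
      ring
    rw [this, hab, hsum, poissonKer]
    push_cast
    field_simp

open FourierTransform in
lemma integral_poissonKer_mul_freqExp {y : ℝ} (hy : 0 < y) (lam : ℝ) :
    ∫ s, (poissonKer y s : ℂ) * freqExp lam s = (Real.exp (-(2 * Real.pi * y * |lam|)) : ℂ) := by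
  set φ : ℝ → ℂ := fun v => (Real.exp (-(2 * Real.pi * y * |v|)) : ℂ) with hφ
  have hφi : Integrable φ := (integral_exp_neg_abs_mul_exp hy 0).1
  have hF : 𝓕 φ = fun s => (poissonKer y s : ℂ) := by
    ext s
    rw [Real.fourier_real_eq_integral_exp_smul]
    exact (integral_exp_neg_abs_mul_exp hy s).2
  have hinv := congrFun (Continuous.fourierInv_fourier_eq (f := φ) (by fun_prop) hφi
    (by rw [hF]; exact (integrable_poissonKer hy).ofReal)) lam
  rw [hF, Real.fourierInv_eq'] at hinv
  rw [← hφ] at *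
  refine Eq.trans ?_ hinv
  congr 1; ext s
  rw [smul_eq_mul, mul_comm, freqExp]
  congr 2
  simp
  ring

lemma integral_poissonKer {y : ℝ} (hy : 0 < y) : ∫ s, poissonKer y s = 1 := by
  have := integral_poissonKer_mul_freqExp hy 0
  simp only [freqExp_zero_left, mul_one, abs_zero, mul_zero, neg_zero, Real.exp_zero,
    Complex.ofReal_one] at this
  rw [integral_complex_ofReal] at this
  exact_mod_cast this

section Convolution

variable {u : ℝ → ℂ} {P : ℝ → ℝ}

lemma APR.integrable_mul_shift (hu : APR u) (hP : Integrable P) (x : ℝ) :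
    Integrable fun s : ℝ => (P s : ℂ) * u (x - s) := by
  obtain ⟨C, hC, hb⟩ := hu.exists_bound
  refine hP.ofReal.mul_bdd (c := C) ?_ (ae_of_all _ fun s => hb _)
  exact (hu.1.comp (by fun_prop)).aestronglyMeasurable

lemma APR.convolution (hu : APR u) (hP : Integrable P) :
    APR fun x => ∫ s, (P s : ℂ) * u (x - s) := by
  obtain ⟨C, hC, hb⟩ := hu.exists_bound
  refine ⟨?_, fun ε hε => ?_⟩
  · refine continuous_of_dominated (bound := fun s => ‖P s‖ * C)
      (fun x => (hu.integrable_mul_shift hP x).aestronglyMeasurable)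
      (fun x => ae_of_all _ fun s => ?_) (hP.norm.mul_const C) (ae_of_all _ fun s => ?_)
    · rw [norm_mul, Complex.norm_real]; gcongr; exact hb _
    · exact continuous_const.mul (hu.1.comp (by fun_prop))
  · set A := ∫ s, ‖P s‖
    have hA : 0 ≤ A := integral_nonneg fun _ => norm_nonneg _
    refine (hu.2 (ε / (A + 1)) (by positivity)).mono fun t ht x => ?_
    rw [← integral_sub (hu.integrable_mul_shift hP _) (hu.integrable_mul_shift hP _)]
    calc _ ≤ ∫ s, ‖P s‖ * (ε / (A + 1)) := by
          refine norm_integral_le_of_norm_le (hP.norm.mul_const _) (ae_of_all _ fun s => ?_)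
          rw [← mul_sub, norm_mul, Complex.norm_real, show x + t - s = x - s + t by ring]
          gcongr
          exact ht _
      _ = A * (ε / (A + 1)) := integral_mul_const _ _
      _ ≤ (A + 1) * (ε / (A + 1)) := by gcongr; linarith
      _ = ε := by field_simp

lemma HasMeanR.convolution (hu : APR u) (hP : Integrable P) {lam : ℝ} {c : ℂ}
    (h : HasMeanR u lam c) :
    HasMeanR (fun x => ∫ s, (P s : ℂ) * u (x - s)) lam
      ((∫ s, (P s : ℂ) * freqExp (-lam) s) * c) := by
  obtain ⟨C, hC, hb⟩ := hu.exists_bound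
  have hm := hu.hasUniformMean h
  have hwin : ∀ T s : ℝ, ∫ x in (-T)..T, u (x - s) * freqExp (-lam) x =
      freqExp (-lam) s * ∫ x in (-T - s)..(T - s), u x * freqExp (-lam) x := by
    intro T s
    rw [← intervalIntegral.integral_comp_sub_right, ← intervalIntegral.integral_const_mul]
    congr 1; ext x
    have : freqExp (-lam) x = freqExp (-lam) s * freqExp (-lam) ((x - s : ℝ) : ℂ) := by
      rw [← freqExp_add]; push_cast; ring_nf
    rw [this]; ring
  have hswap : ∀ T : ℝ, 0 < T → (1 / (2 * (T : ℂ))) *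
      ∫ x in (-T)..T, (∫ s, (P s : ℂ) * u (x - s)) * freqExp (-lam) x =
      ∫ s, (P s : ℂ) * freqExp (-lam) s * ((1 / (2 * (T : ℂ))) *
        ∫ x in (-T - s)..(T - s), u x * freqExp (-lam) x) := by
    intro T hT
    have e1 : ∫ x in (-T)..T, (∫ s, (P s : ℂ) * u (x - s)) * freqExp (-lam) x =
        ∫ s, ∫ x in (-T)..T, (P s : ℂ) * u (x - s) * freqExp (-lam) x := by
      simp only [← integral_mul_const]
      refine intervalIntegral_integral_swap ?_
      rw [uIoc_of_le (by linarith)]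
      have : Integrable (fun p : ℝ × ℝ => (1:ℂ) * (P p.2 : ℂ))
          ((volume.restrict (Ioc (-T) T)).prod volume) :=
        (integrable_const (1:ℂ)).mul_prod hP.ofReal
      simp only [one_mul] at this
      have h2 := this.mul_bdd (c := C) (g := fun p : ℝ × ℝ => u (p.1 - p.2) * freqExp (-lam) p.1)
        (((hu.1.comp (by fun_prop)).mul (by fun_prop)).aestronglyMeasurable)
        (ae_of_all _ fun p => by rw [norm_mul, norm_freqExp_real, mul_one]; exact hb _)
      simpa only [Function.uncurry_def, mul_assoc] using h2
    rw [e1, ← integral_const_mul]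
    congr 1; ext s
    simp only [mul_assoc, intervalIntegral.integral_const_mul, hwin]
    ring
  rw [hasMeanR_iff, ← integral_mul_const]
  have hlim : Tendsto (fun T : ℝ => ∫ s, (P s : ℂ) * freqExp (-lam) s * ((1 / (2 * (T : ℂ))) *
        ∫ x in (-T - s)..(T - s), u x * freqExp (-lam) x)) atTop
      (𝓝 (∫ s, (P s : ℂ) * freqExp (-lam) s * c)) := by
    have hcont : Continuous fun x : ℝ => u x * freqExp (-lam) x := hu.1.mul (by fun_prop)
    refine tendsto_integral_filter_of_dominated_convergence (fun s => ‖P s‖ * C) ?_ ?_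
      (hP.norm.mul_const C) (ae_of_all _ fun s => (hm.tendsto_window s).const_mul _)
    · refine Eventually.of_forall fun T => ?_
      refine (hP.ofReal.aestronglyMeasurable.mul
        (continuous_freqExp_real (-lam)).aestronglyMeasurable).mul
        (Continuous.aestronglyMeasurable (continuous_const.mul ?_))
      have : (fun s : ℝ => ∫ x in (-T - s)..(T - s), u x * freqExp (-lam) x) = fun s : ℝ =>
          (∫ x in (0:ℝ)..(T - s), u x * freqExp (-lam) x) -
          ∫ x in (0:ℝ)..(-T - s), u x * freqExp (-lam) x := by
        ext s
        rw [intervalIntegral.integral_interval_sub_left] <;> exact hcont.intervalIntegrable _ _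
      rw [this]
      have hF := intervalIntegral.continuous_primitive (fun a b => hcont.intervalIntegrable (μ := volume) a b) 0
      exact (hF.comp (by fun_prop)).sub (hF.comp (by fun_prop))
    · filter_upwards [eventually_gt_atTop 0] with T hT
      refine ae_of_all _ fun s => ?_
      rw [norm_mul, norm_mul, norm_freqExp_real, mul_one, Complex.norm_real, norm_mul]
      have h1 : ‖1 / (2 * (T : ℂ))‖ = 1 / (2 * T) := by simp [abs_of_pos hT]
      have h2 : ‖∫ x in (-T - s)..(T - s), u x * freqExp (-lam) x‖ ≤ C * |T - s - (-T - s)| :=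
        intervalIntegral.norm_integral_le_of_norm_le_const fun x _ => by
          rw [norm_mul, norm_freqExp_real, mul_one]; exact hb x
      rw [show T - s - (-T - s) = 2 * T by ring, abs_of_pos (by positivity)] at h2
      rw [h1]
      gcongr
      calc 1 / (2 * T) * _ ≤ 1 / (2 * T) * (C * (2 * T)) := by gcongr
        _ = C := by field_simp
  refine hlim.congr' ?_
  filter_upwards [eventually_gt_atTop 0] with T hT
  exact (hswap T hT).symm

end Convolution

lemma HasMeanR.sub {u v : ℝ → ℂ} {lam : ℝ} {c d : ℂ} (hu : HasMeanR u lam c)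
    (hv : HasMeanR v lam d) (huc : Continuous u) (hvc : Continuous v) :
    HasMeanR (fun x => u x - v x) lam (c - d) := by
  rw [hasMeanR_iff] at *
  refine (hu.sub hv).congr fun T => ?_
  rw [← mul_sub, ← intervalIntegral.integral_sub]
  · simp only [sub_mul]
  · exact (huc.mul (by fun_prop)).intervalIntegrable _ _
  · exact (hvc.mul (by fun_prop)).intervalIntegrable _ _

lemma HasMeanAt.mul_freqExp {g : ℂ → ℂ} {y lam μ : ℝ} {c : ℂ} (h : HasMeanAt g y (lam - μ) c) :
    HasMeanAt (fun z => g z * freqExp μ z) y lam c := by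
  rw [hasMeanAt_iff] at h ⊢
  refine h.congr fun T => ?_
  simp only [mul_assoc, ← freqExp_add_left]
  rw [show μ + -lam = -(lam - μ) by ring]

/-- An almost periodic function without negative frequencies is the Poisson integral of its
values on horizontal lines. -/
theorem APH.eq_poisson {g : ℂ → ℂ} (hg : APH g)
    (h : ∀ lam < 0, ∀ y > 0, HasMeanAt g y lam 0) {α y : ℝ} (hα : 0 < α) (hy : 0 < y) (x : ℝ) :
    g ((x : ℂ) + ((α + y : ℝ) : ℂ) * Complex.I) =
      ∫ s, (poissonKer y s : ℂ) * g (((x - s : ℝ) : ℂ) + (α : ℂ) * Complex.I) := by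
  have hu := hg.apr_slice hα
  have hv := hg.apr_slice (add_pos hα hy)
  have hP := integrable_poissonKer hy
  have hw := hu.convolution hP
  refine sub_eq_zero.mp (APR.eq_zero_of_hasMeanR_zero (u := fun x : ℝ =>
    g ((x : ℂ) + ((α + y : ℝ) : ℂ) * Complex.I) -
      ∫ s, (poissonKer y s : ℂ) * g (((x - s : ℝ) : ℂ) + (α : ℂ) * Complex.I)) ?_ ?_ x)
  · refine ⟨hv.1.sub hw.1, fun ε hε => ?_⟩
    obtain ⟨τ, hτ, H⟩ := hg.2 (α / 2) (α + y + 1) (ε / 2) (by positivity) (by linarith)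
      (by positivity)
    refine hτ.mono fun t ht x => ?_
    have e1 := H t ht ((x : ℂ) + ((α + y : ℝ) : ℂ) * Complex.I) (by simp; linarith) (by simp)
    rw [show (x : ℂ) + ((α + y : ℝ) : ℂ) * Complex.I + t =
      ((x + t : ℝ) : ℂ) + ((α + y : ℝ) : ℂ) * Complex.I by push_cast; ring] at e1
    have e2 : ‖(∫ s, (poissonKer y s : ℂ) * g (((x - s : ℝ) : ℂ) + (α : ℂ) * Complex.I)) -
        ∫ s, (poissonKer y s : ℂ) * g (((x + t - s : ℝ) : ℂ) + (α : ℂ) * Complex.I)‖ ≤ ε / 2 := by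
      rw [← integral_sub (hu.integrable_mul_shift hP _) (hu.integrable_mul_shift hP _)]
      refine (norm_integral_le_of_norm_le (hP.mul_const (ε / 2)) (ae_of_all _ fun s => ?_)).trans
        (by rw [integral_mul_const, integral_poissonKer hy, one_mul])
      rw [← mul_sub, norm_mul, Complex.norm_real, Real.norm_of_nonneg (poissonKer_nonneg hy s)]
      gcongr
      · exact poissonKer_nonneg hy s
      · have := H t ht (((x - s : ℝ) : ℂ) + (α : ℂ) * Complex.I) (by simp; linarith)
          (by simp; linarith)
        rwa [show ((x - s : ℝ) : ℂ) + (α : ℂ) * Complex.I + t =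
          ((x + t - s : ℝ) : ℂ) + (α : ℂ) * Complex.I by push_cast; ring] at this
    have := norm_sub_le (g ((x : ℂ) + ((α + y : ℝ) : ℂ) * Complex.I) -
      g (((x + t : ℝ) : ℂ) + ((α + y : ℝ) : ℂ) * Complex.I))
      ((∫ s, (poissonKer y s : ℂ) * g (((x - s : ℝ) : ℂ) + (α : ℂ) * Complex.I)) -
        ∫ s, (poissonKer y s : ℂ) * g (((x + t - s : ℝ) : ℂ) + (α : ℂ) * Complex.I))
    rw [sub_sub_sub_comm]
    linarith
  · intro lam
    obtain ⟨c, hc⟩ := hg.exists_hasMeanAt lam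
    have h1 := hasMeanAt_iff_hasMeanR.mp (hc (α + y) (by positivity))
    have h2 := HasMeanR.convolution hu hP (hasMeanAt_iff_hasMeanR.mp (hc α hα))
    have h3 := h1.sub h2 hv.1 hw.1
    convert h3 using 1
    rw [integral_poissonKer_mul_freqExp hy, abs_neg, freqExp_im, freqExp_im]
    rcases lt_or_ge lam 0 with hl | hl
    · rw [(hc α hα).unique (h lam hl α hα)]; simp
    · rw [abs_of_nonneg hl, ← mul_assoc, ← Complex.ofReal_mul, ← Real.exp_add, ← sub_mul]
      rw [show -(2 * Real.pi * y * lam) + -(2 * Real.pi * lam * α) =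
        -(2 * Real.pi * lam * (α + y)) by ring]
      simp

/-- Decay of order `e^{-2πNy}`, uniformly on `Im z ≥ α` for each `α > 0`. -/
def DecaysOfOrder (g : ℂ → ℂ) (N : ℝ) : Prop :=
  ∀ α > (0:ℝ), ∃ K > (0:ℝ), ∀ z : ℂ, α ≤ z.im → ‖g z‖ ≤ K * Real.exp (-(2 * Real.pi * N * z.im))

theorem APH.decaysOfOrder {g : ℂ → ℂ} (hg : APH g) {N : ℝ}
    (h : ∀ lam < N, ∀ y > 0, HasMeanAt g y lam 0) : DecaysOfOrder g N := by
  intro α hα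
  have hk := hg.mul_freqExp (-N)
  have hk0 : ∀ lam < 0, ∀ y > 0, HasMeanAt (fun z => g z * freqExp (-N) z) y lam 0 :=
    fun lam hl y hy => (h (lam - -N) (by linarith) y hy).mul_freqExp
  obtain ⟨C, hC, hb⟩ := hk.exists_bound_strip hα α
  have key : ∀ z : ℂ, α ≤ z.im → ‖g z * freqExp (-N) z‖ ≤ C := by
    intro z hz
    rcases hz.eq_or_lt with hz | hz
    · exact hb z hz.le hz.ge
    · have hy : 0 < z.im - α := sub_pos.mpr hz
      have e := hk.eq_poisson hk0 hα hy z.re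
      rw [add_sub_cancel, Complex.re_add_im] at e
      rw [e]
      refine (norm_integral_le_of_norm_le ((integrable_poissonKer hy).mul_const C)
        (ae_of_all _ fun s => ?_)).trans
        (by rw [integral_mul_const, integral_poissonKer hy, one_mul])
      rw [norm_mul, Complex.norm_real, Real.norm_of_nonneg (poissonKer_nonneg hy s)]
      exact mul_le_mul_of_nonneg_left (hb _ (by simp) (by simp)) (poissonKer_nonneg hy s)
  refine ⟨C, hC, fun z hz => ?_⟩
  have e : g z = g z * freqExp (-N) z * freqExp N z := by
    rw [mul_assoc, mul_comm (freqExp (-N) z), freqExp_mul_neg, mul_one]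
  rw [e, norm_mul, ← norm_freqExp N z]
  gcongr
  exact key z hz

/-- A decaying holomorphic function has no small frequencies. -/
lemma DecaysOfOrder.hasMeanAt_zero {g : ℂ → ℂ} {N : ℝ} (h : DecaysOfOrder g N) (hg : APH g)
    {lam : ℝ} (hl : lam < N) {y : ℝ} (hy : 0 < y) : HasMeanAt g y lam 0 := by
  obtain ⟨c, hc⟩ := hg.exists_hasMeanAt lam
  obtain ⟨K, hK, hb⟩ := h 1 one_pos
  have hbound : ∀ y ≥ (1:ℝ), ‖c‖ ≤ K * Real.exp (-(2 * Real.pi * (N - lam) * y)) := by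
    intro y hy1
    refine le_of_tendsto (hasMeanAt_iff.mp (hc y (by linarith))).norm ?_
    filter_upwards [eventually_gt_atTop 0] with T hT
    have h1 : ‖1 / (2 * (T : ℂ))‖ = 1 / (2 * T) := by simp [abs_of_pos hT]
    have h2 : ‖∫ x in (-T)..T, g ((x : ℂ) + (y : ℂ) * Complex.I) *
        freqExp (-lam) ((x : ℂ) + (y : ℂ) * Complex.I)‖ ≤
        K * Real.exp (-(2 * Real.pi * (N - lam) * y)) * |T - -T| := by
      refine intervalIntegral.norm_integral_le_of_norm_le_const fun x _ => ?_
      have h3 := hb ((x : ℂ) + (y : ℂ) * Complex.I) (by simpa using hy1)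
      rw [norm_mul, norm_freqExp]
      refine (mul_le_mul_of_nonneg_right h3 (Real.exp_pos _).le).trans (le_of_eq ?_)
      rw [mul_assoc, ← Real.exp_add]
      congr 2
      simp
      ring
    rw [norm_mul, h1]
    rw [sub_neg_eq_add, abs_of_pos (by positivity)] at h2
    calc 1 / (2 * T) * _ ≤ 1 / (2 * T) *
          (K * Real.exp (-(2 * Real.pi * (N - lam) * y)) * (T + T)) := by gcongr
      _ = _ := by field_simp; ring
  have hlim : Tendsto (fun y : ℝ => K * Real.exp (-(2 * Real.pi * (N - lam) * y))) atTop
      (𝓝 (K * 0)) := by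
    refine (Real.tendsto_exp_neg_atTop_nhds_zero.comp (tendsto_id.const_mul_atTop ?_)).const_mul K
    have := sub_pos.mpr hl
    positivity
  rw [mul_zero] at hlim
  have hc0 : ‖c‖ ≤ 0 := ge_of_tendsto hlim ((eventually_ge_atTop 1).mono hbound)
  rw [← norm_le_zero_iff.mp hc0]
  exact hc y hy

lemma DecaysOfOrder.mono {g : ℂ → ℂ} {N M : ℝ} (h : DecaysOfOrder g N) (hMN : M ≤ N) :
    DecaysOfOrder g M := by
  intro α hα
  obtain ⟨K, hK, hb⟩ := h α hα
  refine ⟨K, hK, fun z hz => (hb z hz).trans ?_⟩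
  have := mul_le_mul_of_nonneg_right hMN (hα.le.trans hz)
  gcongr K * Real.exp ?_
  nlinarith [Real.pi_pos]

lemma DecaysOfOrder.congr {g h : ℂ → ℂ} {N : ℝ} (hg : DecaysOfOrder g N)
    (e : ∀ z ∈ UHP, h z = g z) : DecaysOfOrder h N := by
  intro α hα
  obtain ⟨K, hK, hb⟩ := hg α hα
  exact ⟨K, hK, fun z hz => by rw [e z (mem_UHP.mpr (hα.trans_le hz))]; exact hb z hz⟩

lemma decaysOfOrder_freqExp (μ : ℝ) : DecaysOfOrder (freqExp μ) μ :=
  fun _ _ => ⟨1, one_pos, fun z _ => by rw [norm_freqExp, one_mul]⟩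

/-- The integral of `h` over the vertical half-line above `z`. -/
def vertIntegral (h : ℂ → ℂ) (z : ℂ) : ℂ := ∫ s in Ioi (0:ℝ), h (z + s * Complex.I)

section Vertical

variable {h : ℂ → ℂ} {N : ℝ}

lemma add_mul_I_mem {z : ℂ} (hz : z ∈ UHP) {s : ℝ} (hs : 0 ≤ s) :
    z + s * Complex.I ∈ UHP := by
  rw [mem_UHP] at *
  simp
  linarith

lemma norm_vertical_le {α K : ℝ}
    (hb : ∀ z : ℂ, α ≤ z.im → ‖h z‖ ≤ K * Real.exp (-(2 * Real.pi * N * z.im))) {z : ℂ}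
    (hz : α ≤ z.im) {s : ℝ} (hs : 0 ≤ s) :
    ‖h (z + s * Complex.I)‖ ≤
      K * Real.exp (-(2 * Real.pi * N * z.im)) * Real.exp (-(2 * Real.pi * N) * s) := by
  have := hb (z + s * Complex.I) (by simp; linarith)
  rw [mul_assoc, ← Real.exp_add]
  convert this using 3
  simp
  ring

lemma integrableOn_vertical (hN : 0 < N) (hc : ContinuousOn h UHP) (hd : DecaysOfOrder h N)
    {z : ℂ} (hz : z ∈ UHP) : IntegrableOn (fun s : ℝ => h (z + s * Complex.I)) (Ioi 0) := by
  obtain ⟨K, hK, hb⟩ := hd z.im hz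
  refine Integrable.mono' ((integrableOn_exp_mul_Ioi (a := -(2 * Real.pi * N))
    (by have := Real.pi_pos; simp; positivity) 0).const_mul _)
    (ContinuousOn.aestronglyMeasurable ?_ measurableSet_Ioi)
    ((ae_restrict_iff' measurableSet_Ioi).mpr (ae_of_all _ fun s hs =>
      norm_vertical_le hb le_rfl (mem_Ioi.mp hs).le))
  exact hc.comp (by fun_prop) fun s hs => add_mul_I_mem hz (mem_Ioi.mp hs).le

lemma norm_vertIntegral_le (hN : 0 < N) {α K : ℝ}
    (hb : ∀ z : ℂ, α ≤ z.im → ‖h z‖ ≤ K * Real.exp (-(2 * Real.pi * N * z.im))) {z : ℂ}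
    (hz : α ≤ z.im) :
    ‖vertIntegral h z‖ ≤ K / (2 * Real.pi * N) * Real.exp (-(2 * Real.pi * N * z.im)) := by
  have ha : -(2 * Real.pi * N) < 0 := by have := Real.pi_pos; simp; positivity
  refine (norm_integral_le_of_norm_le ((integrableOn_exp_mul_Ioi ha 0).const_mul _)
    ((ae_restrict_iff' measurableSet_Ioi).mpr (ae_of_all _ fun s hs =>
      norm_vertical_le hb hz (mem_Ioi.mp hs).le))).trans (le_of_eq ?_)
  rw [integral_const_mul, integral_exp_mul_Ioi ha]
  simp
  field_simp

lemma DecaysOfOrder.vertIntegral (hN : 0 < N) (hd : DecaysOfOrder h N) :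
    DecaysOfOrder (vertIntegral h) N := by
  intro α hα
  obtain ⟨K, hK, hb⟩ := hd α hα
  exact ⟨K / (2 * Real.pi * N), by positivity, fun z hz => norm_vertIntegral_le hN hb hz⟩

lemma vertIntegral_eq_add (hN : 0 < N) (hc : ContinuousOn h UHP) (hd : DecaysOfOrder h N)
    {z : ℂ} (hz : z ∈ UHP) {R : ℝ} (hR : 0 ≤ R) :
    vertIntegral h z = (∫ s in (0:ℝ)..R, h (z + s * Complex.I)) +
      vertIntegral h (z + R * Complex.I) := by
  have hi := integrableOn_vertical hN hc hd hz
  have e : vertIntegral h (z + R * Complex.I) = ∫ s in Ioi R, h (z + s * Complex.I) := by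
    have := (measurePreserving_add_right volume R).setIntegral_preimage_emb
      (measurableEmbedding_addRight R) (fun s : ℝ => h (z + s * Complex.I)) (Ioi R)
    rw [preimage_add_const_Ioi, sub_self] at this
    rw [← this, vertIntegral]
    congr 1; ext s
    push_cast
    ring_nf
  rw [e, vertIntegral, intervalIntegral.integral_interval_add_Ioi hi
    (hi.mono_set (Ioi_subset_Ioi hR))]

lemma continuous_vertical_max (hc : ContinuousOn h UHP) {z : ℂ} (hz : z ∈ UHP) :
    Continuous fun s : ℝ => h (z + ((max s 0 : ℝ) : ℂ) * Complex.I) :=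
  hc.comp_continuous (by fun_prop) fun _ => add_mul_I_mem hz (le_max_right _ _)

lemma intervalIntegrable_vertical (hc : ContinuousOn h UHP) {z : ℂ} (hz : z ∈ UHP) {R : ℝ}
    (hR : 0 ≤ R) : IntervalIntegrable (fun s : ℝ => h (z + s * Complex.I)) volume 0 R := by
  refine ContinuousOn.intervalIntegrable (hc.comp (by fun_prop) fun s hs => ?_)
  rw [uIcc_of_le hR] at hs
  exact add_mul_I_mem hz hs.1

/-- Almost periods are inherited by vertical integrals. -/
lemma vertIntegral_almost_period (hN : 0 < N) (hc : ContinuousOn h UHP)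
    (hd : DecaysOfOrder h N) {α ε : ℝ} (β : ℝ) (hα : 0 < α) (hε : 0 < ε) :
    ∃ β' > β, ∃ δ > (0:ℝ), ∀ t : ℝ, (∀ z : ℂ, α < z.im → z.im < β' → ‖h z - h (z + t)‖ ≤ δ) →
      ∀ z : ℂ, α < z.im → z.im < β → ‖vertIntegral h z - vertIntegral h (z + t)‖ ≤ ε := by
  obtain ⟨K, hK, hb⟩ := hd α hα
  have hlim : Tendsto (fun R : ℝ => K / (2 * Real.pi * N) * Real.exp (-(2 * Real.pi * N * R))) atTop
      (𝓝 (K / (2 * Real.pi * N) * 0)) :=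
    (Real.tendsto_exp_neg_atTop_nhds_zero.comp
      (tendsto_id.const_mul_atTop (by positivity))).const_mul _
  rw [mul_zero] at hlim
  obtain ⟨R, hRε, hR⟩ := ((hlim.eventually (gt_mem_nhds (show 0 < ε / 4 by positivity))).and
    (eventually_gt_atTop 0)).exists
  refine ⟨β + R + 1, by linarith, ε / (2 * R), by positivity, fun t ht z h1 h2 => ?_⟩
  have hz : z ∈ UHP := mem_UHP.mpr (hα.trans h1)
  have hzt : z + t ∈ UHP := by simpa [mem_UHP] using hz
  have htail : ∀ w : ℂ, α < w.im → ‖vertIntegral h (w + R * Complex.I)‖ ≤ ε / 4 := by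
    intro w hw
    refine (norm_vertIntegral_le hN hb (by simp; linarith)).trans (le_trans ?_ hRε.le)
    gcongr
    simp
    linarith
  have hmid : ‖(∫ s in (0:ℝ)..R, h (z + s * Complex.I)) -
      ∫ s in (0:ℝ)..R, h (z + t + s * Complex.I)‖ ≤ ε / (2 * R) * |R - 0| := by
    rw [← intervalIntegral.integral_sub (intervalIntegrable_vertical hc hz hR.le)
      (intervalIntegrable_vertical hc hzt hR.le)]
    refine intervalIntegral.norm_integral_le_of_norm_le_const fun s hs => ?_
    rw [uIoc_of_le hR.le] at hs
    rw [show z + t + s * Complex.I = z + s * Complex.I + t by ring]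
    exact ht _ (by simp; linarith [hs.1]) (by simp; linarith [hs.2])
  rw [sub_zero, abs_of_pos hR, show ε / (2 * R) * R = ε / 2 by field_simp] at hmid
  rw [vertIntegral_eq_add hN hc hd hz hR.le, vertIntegral_eq_add hN hc hd hzt hR.le,
    add_sub_add_comm]
  have h3 := htail z h1
  have h4 := htail (z + t) (by simpa using h1)
  refine (norm_add_le _ _).trans ?_
  linarith [norm_sub_le (vertIntegral h (z + R * Complex.I)) (vertIntegral h (z + t + R * Complex.I))]

end Vertical

lemma eq_mul_exp_integral {φ k : ℝ → ℂ} (hk : Continuous k) {t : ℝ} (ht : 0 ≤ t)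
    (hφ : ∀ s ∈ Icc 0 t, HasDerivAt φ (k s * φ s) s) :
    φ t = φ 0 * Complex.exp (∫ s in (0:ℝ)..t, k s) := by
  have hd : ∀ s ∈ Icc 0 t, HasDerivAt (fun s => φ s * Complex.exp (-∫ r in (0:ℝ)..s, k r)) 0 s := by
    intro s hs
    have h1 := (hk.integral_hasStrictDerivAt 0 s).hasDerivAt.neg.cexp
    exact ((hφ s hs).mul h1).congr_deriv (by ring)
  have := constant_of_has_deriv_right_zero
    (fun s hs => (hd s hs).continuousAt.continuousWithinAt)
    (fun s hs => (hd s (Ico_subset_Icc_self hs)).hasDerivWithinAt) t (right_mem_Icc.mpr ht)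
  simp only [intervalIntegral.integral_same, neg_zero, Complex.exp_zero, mul_one] at this
  rw [← this, mul_assoc, ← Complex.exp_add, neg_add_cancel, Complex.exp_zero, mul_one]

/-- A solution of `i F' = g F` with `g` decaying is a constant multiple of the exponential of
the vertical integral of `-g`. -/
theorem exists_eq_mul_exp_vertIntegral {F g : ℂ → ℂ} {N : ℝ} (hN : 0 < N)
    (hgc : ContinuousOn g UHP) (hgd : DecaysOfOrder g N)
    (hF : ∀ z ∈ UHP, HasDerivAt F (-Complex.I * g z * F z) z) :
    ∃ c : ℂ, ∀ z ∈ UHP, F z = c * Complex.exp (-vertIntegral g z) := by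
  set C : ℂ → ℂ := fun z => F z * Complex.exp (vertIntegral g z) with hC
  have hvert : ∀ z ∈ UHP, ∀ t ≥ (0:ℝ), C (z + t * Complex.I) = C z := by
    intro z hz t ht
    have h1 := eq_mul_exp_integral (φ := fun s : ℝ => F (z + s * Complex.I))
      (continuous_vertical_max hgc hz) ht fun s hs => by
        have h2 : HasDerivAt (fun s : ℝ => z + s * Complex.I) Complex.I s := by
          simpa using ((Complex.ofRealCLM.hasDerivAt (x := s)).mul_const Complex.I).const_add z
        refine ((hF _ (add_mul_I_mem hz hs.1)).comp s h2).congr_deriv ?_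
        rw [max_eq_left hs.1]
        linear_combination (-g (z + s * Complex.I) * F (z + s * Complex.I)) * Complex.I_mul_I
    have h3 : ∫ s in (0:ℝ)..t, g (z + ((max s 0 : ℝ) : ℂ) * Complex.I) =
        ∫ s in (0:ℝ)..t, g (z + s * Complex.I) := by
      refine intervalIntegral.integral_congr fun s hs => ?_
      rw [uIcc_of_le ht] at hs
      simp only [max_eq_left hs.1]
    simp only [Complex.ofReal_zero, zero_mul, add_zero] at h1
    simp only [hC]
    rw [h1, vertIntegral_eq_add hN hgc hgd hz ht, h3, mul_assoc, ← Complex.exp_add]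
  have hhor : ∀ z ∈ UHP, ∀ x ≥ (0:ℝ), C (z + x) = C z := by
    intro z hz x hx
    obtain ⟨K, hK, hb⟩ := hgd z.im hz
    set E : ℝ → ℂ := fun t => (∫ r in (0:ℝ)..x, -Complex.I * g (z + t * Complex.I + r)) +
      vertIntegral g (z + t * Complex.I + x) - vertIntegral g (z + t * Complex.I) with hE
    have hCE : ∀ t ≥ (0:ℝ), C (z + x) = C z * Complex.exp (E t) := by
      intro t ht
      have hzt := add_mul_I_mem hz ht
      have hmem : ∀ r : ℝ, z + t * Complex.I + r ∈ UHP := fun r => by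
        simpa [mem_UHP] using hzt
      have h1 := eq_mul_exp_integral (φ := fun r : ℝ => F (z + t * Complex.I + r))
        (k := fun r : ℝ => -Complex.I * g (z + t * Complex.I + r))
        (continuous_const.mul (hgc.comp_continuous (by fun_prop) hmem)) hx fun r _ => by
          have h2 : HasDerivAt (fun r : ℝ => z + t * Complex.I + r) 1 r := by
            simpa using (Complex.ofRealCLM.hasDerivAt (x := r)).const_add (z + t * Complex.I)
          exact ((hF _ (hmem r)).comp r h2).congr_deriv (by ring)
      rw [← hvert z hz t ht, ← hvert (z + x) (by simpa [mem_UHP] using hz) t ht]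
      simp only [Complex.ofReal_zero, add_zero] at h1
      simp only [hC]
      rw [show z + x + t * Complex.I = z + t * Complex.I + x by ring, h1, mul_assoc, mul_assoc,
        ← Complex.exp_add, ← Complex.exp_add, hE]
      ring_nf
    set M := K * x + 2 * (K / (2 * Real.pi * N))
    have hEle : ∀ t ≥ (0:ℝ), ‖E t‖ ≤ M * Real.exp (-(2 * Real.pi * N * t)) := by
      intro t ht
      have hexp : ∀ w : ℂ, w.im = z.im + t →
          Real.exp (-(2 * Real.pi * N * w.im)) ≤ Real.exp (-(2 * Real.pi * N * t)) := by
        intro w hw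
        rw [hw]
        gcongr
        linarith [mem_UHP.mp hz]
      have h1 : ‖∫ r in (0:ℝ)..x, -Complex.I * g (z + t * Complex.I + r)‖ ≤
          K * Real.exp (-(2 * Real.pi * N * t)) * |x - 0| := by
        refine intervalIntegral.norm_integral_le_of_norm_le_const fun r _ => ?_
        rw [norm_mul, norm_neg, Complex.norm_I, one_mul]
        exact (hb _ (by simpa using ht)).trans (mul_le_mul_of_nonneg_left (hexp _ (by simp)) hK.le)
      rw [sub_zero, abs_of_nonneg hx] at h1
      have h2 : ∀ w : ℂ, w.im = z.im + t → ‖vertIntegral g w‖ ≤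
          K / (2 * Real.pi * N) * Real.exp (-(2 * Real.pi * N * t)) := fun w hw =>
        (norm_vertIntegral_le hN hb (by rw [hw]; linarith)).trans
          (mul_le_mul_of_nonneg_left (hexp _ hw) (by positivity))
      have h3 := h2 (z + t * Complex.I + x) (by simp)
      have h4 := h2 (z + t * Complex.I) (by simp)
      have h5 := norm_sub_le ((∫ r in (0:ℝ)..x, -Complex.I * g (z + t * Complex.I + r)) +
        vertIntegral g (z + t * Complex.I + x)) (vertIntegral g (z + t * Complex.I))
      have h6 := norm_add_le (∫ r in (0:ℝ)..x, -Complex.I * g (z + t * Complex.I + r))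
        (vertIntegral g (z + t * Complex.I + x))
      calc ‖E t‖ ≤ _ := h5
        _ ≤ K * Real.exp (-(2 * Real.pi * N * t)) * x +
            K / (2 * Real.pi * N) * Real.exp (-(2 * Real.pi * N * t)) +
            K / (2 * Real.pi * N) * Real.exp (-(2 * Real.pi * N * t)) := by linarith
        _ = _ := by simp only [M]; ring
    have hlim : Tendsto E atTop (𝓝 0) := by
      refine squeeze_zero_norm' ((eventually_ge_atTop 0).mono hEle) ?_
      have := (Real.tendsto_exp_neg_atTop_nhds_zero.comp
        (tendsto_id.const_mul_atTop (show 0 < 2 * Real.pi * N by positivity))).const_mul M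
      rwa [mul_zero] at this
    have h7 := (((Complex.continuous_exp.tendsto 0).comp hlim).const_mul (C z))
    rw [Complex.exp_zero, mul_one] at h7
    exact tendsto_nhds_unique (tendsto_const_nhds.congr'
      ((eventually_ge_atTop 0).mono hCE)) h7
  have hle : ∀ z ∈ UHP, ∀ w ∈ UHP, z.re ≤ w.re → C z = C w := by
    intro z hz w hw h
    have h1 := hvert z hz (max z.im w.im - z.im) (sub_nonneg.mpr (le_max_left _ _))
    have h2 := hvert w hw (max z.im w.im - w.im) (sub_nonneg.mpr (le_max_right _ _))
    have h3 := hhor _ (add_mul_I_mem hz (sub_nonneg.mpr (le_max_left z.im w.im)))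
      (w.re - z.re) (sub_nonneg.mpr h)
    rw [← h1, ← h2, ← h3]
    congr 1
    apply Complex.ext <;> simp
  refine ⟨C Complex.I, fun z hz => ?_⟩
  have hI : Complex.I ∈ UHP := by simp [mem_UHP]
  have : C Complex.I = C z := by
    rcases le_total z.re Complex.I.re with h | h
    · exact (hle z hz _ hI h).symm
    · exact hle _ hI z hz h
  rw [this, hC]
  simp only [mul_assoc, ← Complex.exp_add, add_neg_cancel, Complex.exp_zero, mul_one]

lemma DecaysOfOrder.add {g h : ℂ → ℂ} {N : ℝ} (hg : DecaysOfOrder g N) (hh : DecaysOfOrder h N) :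
    DecaysOfOrder (g + h) N := by
  intro α hα
  obtain ⟨K, hK, hb⟩ := hg α hα
  obtain ⟨L, hL, hc⟩ := hh α hα
  refine ⟨K + L, by positivity, fun z hz => (norm_add_le _ _).trans ?_⟩
  rw [add_mul]
  exact add_le_add (hb z hz) (hc z hz)

lemma DecaysOfOrder.mul {g h : ℂ → ℂ} {N M : ℝ} (hg : DecaysOfOrder g N)
    (hh : DecaysOfOrder h M) : DecaysOfOrder (g * h) (N + M) := by
  intro α hα
  obtain ⟨K, hK, hb⟩ := hg α hα
  obtain ⟨L, hL, hc⟩ := hh α hα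
  refine ⟨K * L, by positivity, fun z hz => ?_⟩
  rw [Pi.mul_apply, norm_mul]
  refine (mul_le_mul (hb z hz) (hc z hz) (norm_nonneg _) (by positivity)).trans (le_of_eq ?_)
  rw [mul_mul_mul_comm, ← Real.exp_add]
  ring_nf

lemma decaysOfOrder_zero (N : ℝ) : DecaysOfOrder 0 N :=
  fun _ _ => ⟨1, one_pos, fun z _ => by simp; positivity⟩

lemma DecaysOfOrder.const_smul {g : ℂ → ℂ} {N : ℝ} (hg : DecaysOfOrder g N) (c : ℂ) :
    DecaysOfOrder (c • g) N := by
  intro α hα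
  obtain ⟨K, hK, hb⟩ := hg α hα
  refine ⟨(‖c‖ + 1) * K, by positivity, fun z hz => ?_⟩
  rw [Pi.smul_apply, norm_smul, mul_assoc]
  exact mul_le_mul (by linarith) (hb z hz) (norm_nonneg _) (by positivity)

lemma DecaysOfOrder.neg {g : ℂ → ℂ} {N : ℝ} (hg : DecaysOfOrder g N) :
    DecaysOfOrder (-g) N := by
  simpa using hg.const_smul (-1)

/-- Taylor remainders of the exponential of a decaying function decay at a multiple of the
rate. -/
lemma DecaysOfOrder.exp_sub_sum {v : ℂ → ℂ} {N : ℝ} (hN : 0 ≤ N) (hv : DecaysOfOrder v N)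
    (n : ℕ) :
    DecaysOfOrder (fun z => Complex.exp (v z) - ∑ m ∈ Finset.range n, v z ^ m / m.factorial)
      (n * N) := by
  intro α hα
  obtain ⟨K, hK, hb⟩ := hv α hα
  refine ⟨K ^ n * Real.exp K, by positivity, fun z hz => ?_⟩
  have h1 : ‖v z‖ ≤ K := (hb z hz).trans <| mul_le_of_le_one_right hK.le <|
    Real.exp_le_one_iff.mpr (by
      have := hα.le.trans hz
      have := Real.pi_pos
      rw [neg_nonpos]; positivity)
  calc _ ≤ ‖v z‖ ^ n * Real.exp ‖v z‖ := Complex.norm_exp_sub_sum_le_norm_mul_exp _ _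
    _ ≤ (K * Real.exp (-(2 * Real.pi * N * z.im))) ^ n * Real.exp K := by
        gcongr
        exact hb z hz
    _ = _ := by
        rw [mul_pow, ← Real.exp_nat_mul]
        ring_nf

/-- An exponential of a vertical integral of a decaying almost periodic function is almost
periodic. -/
theorem APH.of_eq_mul_exp {g H : ℂ → ℂ} {N : ℝ} {c : ℂ} (hg : APH g) (hN : 0 < N)
    (hd : DecaysOfOrder g N) (hH : DifferentiableOn ℂ H UHP)
    (e : ∀ z ∈ UHP, H z = c * Complex.exp (-vertIntegral g z)) : APH H := by
  refine ⟨hH, fun α β ε hα hαβ hε => ?_⟩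
  obtain ⟨K, hK, hb⟩ := hd.vertIntegral hN α hα
  have hbd : ∀ z : ℂ, α ≤ z.im → ‖vertIntegral g z‖ ≤ K := fun z hz =>
    (hb z hz).trans <| mul_le_of_le_one_right hK.le <| Real.exp_le_one_iff.mpr (by
      have := hα.le.trans hz
      have := Real.pi_pos
      rw [neg_nonpos]; positivity)
  set η := min 1 (ε / (2 * (‖c‖ + 1) * Real.exp K)) with hη
  obtain ⟨β', hβ', δ, hδ, hper⟩ := vertIntegral_almost_period hN hg.continuousOn hd β hα
    (show 0 < η by positivity)
  obtain ⟨τ, hτ, ht⟩ := hg.2 α β' δ hα (hαβ.trans hβ') hδ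
  refine ⟨τ, hτ, fun t htτ z h1 h2 => ?_⟩
  have h3 := hper t (ht t htτ) z h1 h2
  have hz : z ∈ UHP := mem_UHP.mpr (hα.trans h1)
  rw [e z hz, e (z + t) (by simpa [mem_UHP] using hz)]
  set a := vertIntegral g z
  set a' := vertIntegral g (z + t)
  have h4 : ‖Complex.exp (-a)‖ ≤ Real.exp K := by
    rw [Complex.norm_exp]
    gcongr
    exact (Complex.re_le_norm _).trans (by rw [norm_neg]; exact hbd z h1.le)
  have h5 := Complex.norm_exp_sub_one_le (h3.trans (min_le_left _ _))
  have h6 : c * Complex.exp (-a) - c * Complex.exp (-a') =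
      -(c * Complex.exp (-a) * (Complex.exp (a - a') - 1)) := by
    rw [mul_sub, mul_one, mul_assoc, ← Complex.exp_add]
    ring_nf
  rw [h6, norm_neg, norm_mul, norm_mul]
  calc ‖c‖ * ‖Complex.exp (-a)‖ * ‖Complex.exp (a - a') - 1‖
      ≤ (‖c‖ + 1) * Real.exp K * (2 * (ε / (2 * (‖c‖ + 1) * Real.exp K))) := by
        gcongr
        · linarith
        · exact h5.trans (by linarith [h3.trans (min_le_right _ _)])
    _ = ε := by field_simp

section TrigSum

variable {ι : Type*}

lemma APH.sub_sum {g : ℂ → ℂ} (hg : APH g) (S : Finset ι) (d : ι → ℂ) (φ : ι → ℝ) :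
    APH fun z => g z - ∑ i ∈ S, d i * freqExp (φ i) z := by
  classical
  induction S using Finset.induction_on with
  | empty => simpa using hg
  | insert j S hj ih =>
    convert ih.add_const_mul_freqExp (-d j) (φ j) using 2
    rw [Finset.sum_insert hj]
    ring

lemma HasMeanAt.sub_sum {g : ℂ → ℂ} {y lam : ℝ} {c : ℂ} (h : HasMeanAt g y lam c) (hg : APH g)
    (hy : 0 < y) (S : Finset ι) (d : ι → ℂ) (φ : ι → ℝ) :
    HasMeanAt (fun z => g z - ∑ i ∈ S, d i * freqExp (φ i) z) y lam
      (c - ∑ i ∈ S, d i * if lam = φ i then 1 else 0) := by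
  classical
  induction S using Finset.induction_on with
  | empty => simpa using h
  | insert j S hj ih =>
    convert ih.add ((hasMeanAt_freqExp (φ j) y lam).const_mul (-d j)) hy
      (hg.sub_sum S d φ).continuousOn (by fun_prop) using 1
    · ext z
      rw [Finset.sum_insert hj]
      ring
    · rw [Finset.sum_insert hj]
      ring

/-- A function which is a trigonometric sum up to a decaying error has only the frequencies of
that sum below the decay rate. -/
lemma APH.hasMeanAt_zero_of_decays {g : ℂ → ℂ} (hg : APH g) {S : Finset ι} {d : ι → ℂ}
    {φ : ι → ℝ} {N : ℝ} (hd : DecaysOfOrder (fun z => g z - ∑ i ∈ S, d i * freqExp (φ i) z) N)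
    {lam : ℝ} (hl : lam < N) (hS : ∀ i ∈ S, lam ≠ φ i) {y : ℝ} (hy : 0 < y) :
    HasMeanAt g y lam 0 := by
  obtain ⟨c, hc⟩ := hg.exists_hasMeanAt lam
  have h1 := (hc y hy).sub_sum hg hy S d φ
  rw [Finset.sum_eq_zero fun i hi => by rw [if_neg (hS i hi), mul_zero], sub_zero] at h1
  rw [← h1.unique (hd.hasMeanAt_zero (hg.sub_sum S d φ) hl hy)]
  exact hc y hy

end TrigSum

/-- If the spectrum below `N` is contained in a finite set, the function is a trigonometric sum
over that set up to an error of order `N`. -/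
lemma APH.exists_decays_sub_sum {g : ℂ → ℂ} (hg : APH g) {N : ℝ} (S : Finset ℝ)
    (hS : ∀ lam < N, lam ∉ S → ∀ y > 0, HasMeanAt g y lam 0) :
    ∃ d : ℝ → ℂ, DecaysOfOrder (fun z => g z - ∑ μ ∈ S, d μ * freqExp μ z) N := by
  choose d hd using fun lam => hg.exists_hasMeanAt lam
  refine ⟨d, (hg.sub_sum S d id).decaysOfOrder fun lam hl y hy => ?_⟩
  have h1 := (hd lam y hy).sub_sum hg hy S d id
  convert h1 using 1
  by_cases h : lam ∈ S
  · simp [h]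
  · simp [h, (hd lam y hy).unique (hS lam hl h y hy)]

lemma vertIntegral_freqExp {μ : ℝ} (hμ : 0 < μ) (z : ℂ) :
    vertIntegral (freqExp μ) z = (2 * Real.pi * μ)⁻¹ * freqExp μ z := by
  have ha : ((-(2 * Real.pi * μ) : ℝ) : ℂ).re < 0 := by
    have := Real.pi_pos
    rw [Complex.ofReal_re, neg_lt_zero]; positivity
  have e : ∀ s : ℝ, freqExp μ (z + s * Complex.I) =
      freqExp μ z * Complex.exp (((-(2 * Real.pi * μ) : ℝ) : ℂ) * s) := by
    intro s
    rw [freqExp_add, freqExp_im, Complex.ofReal_exp]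
    push_cast
    ring_nf
  have hμ' : (μ : ℂ) ≠ 0 := by exact_mod_cast hμ.ne'
  have hpi : (Real.pi : ℂ) ≠ 0 := by exact_mod_cast Real.pi_ne_zero
  simp only [vertIntegral, e]
  rw [integral_const_mul, integral_exp_mul_complex_Ioi ha]
  push_cast
  simp
  field_simp

lemma vertIntegral_sub_sum {g : ℂ → ℂ} {N : ℝ} (hN : 0 < N) (hc : ContinuousOn g UHP)
    (hd : DecaysOfOrder g N) (S : Finset ℝ) (hS : ∀ μ ∈ S, 0 < μ) (d : ℝ → ℂ) {z : ℂ}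
    (hz : z ∈ UHP) :
    vertIntegral (fun w => g w - ∑ μ ∈ S, d μ * freqExp μ w) z =
      vertIntegral g z - ∑ μ ∈ S, d μ * (2 * Real.pi * μ)⁻¹ * freqExp μ z := by
  have hi : ∀ μ ∈ S, IntegrableOn (fun s : ℝ => d μ * freqExp μ (z + s * Complex.I)) (Ioi 0) :=
    fun μ hμ => (integrableOn_vertical (hS μ hμ) (by fun_prop) (decaysOfOrder_freqExp μ)
      hz).const_mul _
  rw [vertIntegral, integral_sub (integrableOn_vertical hN hc hd hz)
    (integrable_finsetSum _ hi), integral_finsetSum _ hi, vertIntegral]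
  congr 1
  refine Finset.sum_congr rfl fun μ hμ => ?_
  rw [integral_const_mul, mul_assoc, ← vertIntegral_freqExp (hS μ hμ), vertIntegral]

/-- Evaluation of trigonometric polynomials with nonnegative frequencies. -/
def trigEval : AddMonoidAlgebra ℂ NNReal →ₐ[ℂ] (ℂ → ℂ) :=
  AddMonoidAlgebra.lift ℂ (ℂ → ℂ) NNReal
    { toFun := fun μ => freqExp (μ.toAdd : ℝ)
      map_one' := funext fun z => freqExp_zero_left z
      map_mul' := fun μ ν => funext fun z => by
        simp [freqExp_add_left] }

lemma trigEval_apply (P : AddMonoidAlgebra ℂ NNReal) (z : ℂ) :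
    trigEval P z = ∑ μ ∈ P.coeff.support, P.coeff μ * freqExp μ z := by
  simp [trigEval, AddMonoidAlgebra.lift_apply, Finsupp.sum]


lemma trigEval_single (μ : NNReal) (c : ℂ) :
    trigEval (AddMonoidAlgebra.single μ c) = fun z => c * freqExp μ z := by
  ext z
  simp [trigEval]

lemma decaysOfOrder_trigEval (P : AddMonoidAlgebra ℂ NNReal) : DecaysOfOrder (trigEval P) 0 := by
  have e : trigEval P = ∑ μ ∈ P.coeff.support, P.coeff μ • freqExp μ := by
    ext z
    simp [trigEval_apply]
  rw [e]
  exact Finset.sum_induction _ (fun h => DecaysOfOrder h 0) (fun _ _ => DecaysOfOrder.add)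
    (decaysOfOrder_zero 0) fun μ _ =>
      ((decaysOfOrder_freqExp μ).mono μ.2).const_smul _

/-- The algebra of functions which agree with a trigonometric polynomial of nonnegative
frequencies up to an error decaying of order `N`. -/
def trigModDecay (N : ℝ) (hN : 0 ≤ N) : Subalgebra ℂ (ℂ → ℂ) where
  carrier := {h | ∃ P, DecaysOfOrder (h - trigEval P) N}
  mul_mem' := by
    rintro g h ⟨P, hP⟩ ⟨Q, hQ⟩
    refine ⟨P * Q, ?_⟩
    have h1 : DecaysOfOrder ((g - trigEval P) * (h - trigEval Q)) N :=
      (hP.mul hQ).mono (by linarith)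
    have h2 : DecaysOfOrder ((g - trigEval P) * trigEval Q) N := by
      simpa using hP.mul (decaysOfOrder_trigEval Q)
    have h3 : DecaysOfOrder (trigEval P * (h - trigEval Q)) N := by
      simpa using (decaysOfOrder_trigEval P).mul hQ
    convert (h1.add h2).add h3 using 1
    rw [map_mul]
    ring
  add_mem' := by
    rintro g h ⟨P, hP⟩ ⟨Q, hQ⟩
    refine ⟨P + Q, ?_⟩
    rw [map_add, add_sub_add_comm]
    exact hP.add hQ
  algebraMap_mem' c := ⟨algebraMap ℂ _ c, by
    rw [AlgHom.commutes, sub_self]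
    exact decaysOfOrder_zero N⟩

lemma mem_trigModDecay {N : ℝ} {hN : 0 ≤ N} {h : ℂ → ℂ} :
    h ∈ trigModDecay N hN ↔ ∃ P, DecaysOfOrder (h - trigEval P) N := Iff.rfl

lemma DecaysOfOrder.mem_trigModDecay {N : ℝ} {hN : 0 ≤ N} {h : ℂ → ℂ} (hh : DecaysOfOrder h N) :
    h ∈ trigModDecay N hN := ⟨0, by simpa using hh⟩

lemma freqExp_mem_trigModDecay {N : ℝ} {hN : 0 ≤ N} {μ : ℝ} (hμ : 0 ≤ μ) :
    freqExp μ ∈ trigModDecay N hN := by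
  lift μ to NNReal using hμ
  refine ⟨AddMonoidAlgebra.single μ 1, ?_⟩
  convert decaysOfOrder_zero N using 1
  ext z
  simp [trigEval_single]

/-- Below every level the spectrum of an exponential of a vertical integral is finite if the one
of the integrand is. -/
theorem finite_freq_of_eq_mul_exp {g H : ℂ → ℂ} {b N : ℝ} {c : ℂ} (hg : APH g) (hH : APH H)
    (hb : 0 < b) (hN : 0 < N) (hd : DecaysOfOrder g b)
    (e : ∀ z ∈ UHP, H z = c * Complex.exp (-vertIntegral g z)) {S : Finset ℝ}
    (hS : ∀ μ ∈ S, 0 < μ) (hfin : ∀ lam < N, lam ∉ S → ∀ y > 0, HasMeanAt g y lam 0) :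
    ∃ A : Finset ℝ, ∀ lam < N, lam ∉ A → ∀ y > 0, HasMeanAt H y lam 0 := by
  obtain ⟨d, hr⟩ := hg.exists_decays_sub_sum S hfin
  have hv : -vertIntegral g ∈ trigModDecay N hN.le := by
    refine neg_mem ?_
    have h1 : DecaysOfOrder (vertIntegral g -
        ∑ μ ∈ S, (d μ * (2 * Real.pi * μ)⁻¹ : ℂ) • freqExp μ) N :=
      (hr.vertIntegral hN).congr fun z hz => by
        rw [vertIntegral_sub_sum hb hg.continuousOn hd S hS d hz]
        simp
    rw [← sub_add_cancel (vertIntegral g)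
      (∑ μ ∈ S, (d μ * (2 * Real.pi * μ)⁻¹ : ℂ) • freqExp μ)]
    exact add_mem h1.mem_trigModDecay (sum_mem fun μ hμ =>
      Subalgebra.smul_mem _ (freqExp_mem_trigModDecay (hS μ hμ).le) _)
  obtain ⟨n, hn⟩ := exists_nat_ge (N / b)
  rw [div_le_iff₀ hb] at hn
  have hrem := (((hd.vertIntegral hb).neg.exp_sub_sum hb.le n).mono hn).mem_trigModDecay
    (hN := hN.le)
  have hexp : (fun z => Complex.exp ((-vertIntegral g) z)) ∈ trigModDecay N hN.le := by
    have hsum : ∑ m ∈ Finset.range n, ((m.factorial : ℂ)⁻¹) • (-vertIntegral g) ^ m ∈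
        trigModDecay N hN.le :=
      sum_mem fun m _ => Subalgebra.smul_mem _ (pow_mem hv m) _
    convert add_mem hrem hsum using 1
    ext z
    simp [div_eq_inv_mul]
  obtain ⟨P, hP⟩ := Subalgebra.smul_mem _ hexp c
  refine ⟨P.coeff.support.image (fun μ : NNReal => (μ : ℝ)), fun lam hl hA y hy => ?_⟩
  refine hH.hasMeanAt_zero_of_decays (S := P.coeff.support) (d := P.coeff)
    (φ := fun μ : NNReal => (μ : ℝ)) (hP.congr fun z hz => ?_) hl (fun μ hμ h => hA ?_) hy
  · rw [e z hz, Pi.sub_apply, trigEval_apply]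
    rfl
  · exact Finset.mem_image.mpr ⟨μ, hμ, h.symm⟩

/-- The exponential of a vertical integral has no frequencies below the gap but zero. -/
theorem hasMeanAt_zero_of_eq_mul_exp {g H : ℂ → ℂ} {b : ℝ} {c : ℂ} (hH : APH H)
    (hb : 0 < b) (hd : DecaysOfOrder g b)
    (e : ∀ z ∈ UHP, H z = c * Complex.exp (-vertIntegral g z)) {lam : ℝ} (hl : lam < b)
    (h0 : lam ≠ 0) {y : ℝ} (hy : 0 < y) : HasMeanAt H y lam 0 := by
  have h1 := (hd.vertIntegral hb).neg.exp_sub_sum hb.le 1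
  rw [Nat.cast_one, one_mul] at h1
  refine hH.hasMeanAt_zero_of_decays (S := {()}) (d := fun _ => c) (φ := fun _ => 0)
    ((h1.const_smul c).congr fun z hz => ?_) hl (fun _ _ => h0) hy
  rw [e z hz]
  simp [freqExp_zero_left, mul_sub]

lemma hasMeanAt_zero_of_notMem_specH {g : ℂ → ℂ} {lam : ℝ} (h : lam ∉ specH g) {y : ℝ}
    (hy : 0 < y) : HasMeanAt g y lam 0 := by
  by_contra hn
  exact h ⟨y, hy, hn⟩

/-- Lemma 5.3: if `f ∈ AP(ℍ)` has spectrum in `{0} ∪ [b,∞)` and `iF'/F = f`, then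
`F ∈ AP(ℍ)` with spectrum in `{-ℰf(0)/2π} ∪ [-ℰf(0)/2π + b, ∞)`; local finiteness of
the spectrum is inherited. -/
theorem stmt17 (f F : ℂ → ℂ) (b : ℝ) (hb : 0 < b) (hf : APH f)
    (hspec : specH f ⊆ {0} ∪ Set.Ici b)
    (e₀ : ℝ) (he₀ : ∀ y > (0:ℝ), HasMeanAt f y 0 ((e₀ : ℝ) : ℂ))
    (hF : DifferentiableOn ℂ F UHP) (hFne : ∀ z ∈ UHP, F z ≠ 0)
    (hFd : ∀ z ∈ UHP, Complex.I * deriv F z = f z * F z) :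
    APH F ∧
    specH F ⊆ {-(e₀ / (2 * Real.pi))} ∪ Set.Ici (-(e₀ / (2 * Real.pi)) + b) ∧
    (LocFinSet (specH f) → LocFinSet (specH F)) := by
  set κ := e₀ / (2 * Real.pi) with hκ
  set g : ℂ → ℂ := fun z => f z + (-e₀ : ℂ) * freqExp 0 z with hg_def
  set H : ℂ → ℂ := fun z => F z * freqExp κ z with hH_def
  have hg : APH g := hf.add_const_mul_freqExp _ 0
  have hmean : ∀ lam y, 0 < y → (lam = 0 ∨ lam ∉ specH f) → HasMeanAt g y lam 0 := by
    intro lam y hy h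
    rcases eq_or_ne lam 0 with rfl | h0
    · have := (he₀ y hy).add ((hasMeanAt_freqExp 0 y 0).const_mul (-e₀ : ℂ)) hy hf.continuousOn
        (by fun_prop)
      simpa [hg_def] using this
    · have := (hasMeanAt_zero_of_notMem_specH (h.resolve_left h0) hy).add
        ((hasMeanAt_freqExp 0 y lam).const_mul (-e₀ : ℂ)) hy hf.continuousOn (by fun_prop)
      simpa [hg_def, h0] using this
  have hgd : DecaysOfOrder g b := hg.decaysOfOrder fun lam hl y hy => hmean lam y hy <|
    or_iff_not_imp_left.mpr fun h0 hm => (hspec hm).elim h0 fun h => not_le.mpr hl h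
  have hHd : ∀ z ∈ UHP, HasDerivAt H (-Complex.I * g z * H z) z := by
    intro z hz
    have h1 := (hF.differentiableAt (isOpen_UHP.mem_nhds hz)).hasDerivAt
    have h2 : HasDerivAt (freqExp κ) (Complex.I * e₀ * freqExp κ z) z := by
      refine ((((hasDerivAt_id z).const_mul (2 * (Real.pi : ℂ) * Complex.I * (κ : ℂ))).cexp)
        ).congr_deriv ?_
      have hpi : (Real.pi : ℂ) ≠ 0 := by exact_mod_cast Real.pi_ne_zero
      simp only [freqExp, hκ, id]
      push_cast
      field_simp
    refine (h1.mul h2).congr_deriv ?_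
    simp only [hg_def, hH_def, freqExp_zero_left]
    linear_combination (-Complex.I * freqExp κ z) * hFd z hz +
      (deriv F z * freqExp κ z) * Complex.I_mul_I
  obtain ⟨c, e⟩ := exists_eq_mul_exp_vertIntegral hb hg.continuousOn hgd hHd
  have hH : APH H := hg.of_eq_mul_exp hb hgd
    (hF.mul (differentiable_freqExp κ).differentiableOn) e
  have hFH : F = fun z => H z * freqExp (-κ) z := by
    ext z
    rw [hH_def, mul_assoc, freqExp_mul_neg, mul_one]
  have hmeanF : ∀ lam, (∀ y > 0, HasMeanAt H y (lam + κ) 0) → lam ∉ specH F := by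
    rintro lam h ⟨y, hy, hn⟩
    rw [hFH] at hn
    exact hn (HasMeanAt.mul_freqExp (by rw [sub_neg_eq_add]; exact h y hy))
  refine ⟨hFH ▸ hH.mul_freqExp (-κ), fun lam hlam => ?_, fun hfin p q => ?_⟩
  · by_contra hn
    rw [mem_union, not_or, mem_singleton_iff, mem_Ici, not_le] at hn
    exact hmeanF lam (fun y hy => hasMeanAt_zero_of_eq_mul_exp hH hb hgd e (by linarith [hn.2])
      (fun h => hn.1 (by linarith)) hy) hlam
  · set N := max (q + κ) 1
    have hN : 0 < N := by positivity
    set S := (hfin 0 N).toFinset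
    obtain ⟨A, hA⟩ := finite_freq_of_eq_mul_exp hg hH hb hN hgd e (S := S)
      (fun μ hμ => ((hfin 0 N).mem_toFinset.mp hμ).2.1) fun lam hl hS y hy => hmean lam y hy <| by
        by_contra! hn
        have h0 : 0 < lam := ((hspec hn.2).resolve_left hn.1).trans_lt' hb
        exact hS ((hfin 0 N).mem_toFinset.mpr ⟨hn.2, h0, hl⟩)
    refine (A.finite_toSet.image fun x => x - κ).subset fun lam hlam => ?_
    by_contra hn
    refine hmeanF lam (fun y hy => hA _ ?_ (fun h => hn ⟨_, h, by simp⟩) y hy) hlam.1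
    exact (add_lt_add_left hlam.2.2 κ).trans_le (le_max_left _ _)
end
end

section
/- Let f : ℍ → ℂ be holomorphic and set g = exp(f). The following are equivalent: (1) there is a real-valued locally finite measure μ on ℝ with deg(μ) ≤ 2 such that (f(z) + conj(f(w)))/(z − conj(w)) = (1/2πi) ∫_ℝ dμ(t)/((t−z)(t−conj(w))) for every z, w ∈ ℍ; (2) g is of bounded type and its mean type ϑ(g) = limsup_{y→∞} log|g(iy)|/y equals 0. -/
open MeasureTheory Complex Filter Topology Set
open scoped ENNReal

noncomputable section

/-- The Herglotz transform `(2πi)⁻¹ ∫ (1 + t z) / (t - z) dm(t)` on the upper half-plane. -/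
def herglotzTransform (m : Measure ℝ) (z : ℂ) : ℂ :=
  (1 / (2 * (Real.pi : ℂ) * I)) * ∫ t : ℝ, (1 + (t : ℂ) * z) / ((t : ℂ) - z) ∂m

lemma convex_UHP : Convex ℝ UHP := convex_halfSpace_im_gt 0

lemma ofReal_sub_ne_zero {z : ℂ} (hz : z ∈ UHP) (t : ℝ) : (t : ℂ) - z ≠ 0 := by
  intro h
  have h1 := congrArg Complex.im h
  have h2 : 0 < z.im := hz
  simp at h1
  linarith

lemma ofReal_sub_conj_ne_zero {z : ℂ} (hz : z ∈ UHP) (t : ℝ) :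
    (t : ℂ) - (starRingEnd ℂ) z ≠ 0 := by
  have := (map_ne_zero (starRingEnd ℂ)).2 (ofReal_sub_ne_zero hz t)
  simpa using this

lemma norm_ofReal_sub_conj (z : ℂ) (t : ℝ) :
    ‖(t : ℂ) - (starRingEnd ℂ) z‖ = ‖(t : ℂ) - z‖ := by
  rw [← Complex.norm_conj ((t : ℂ) - z)]
  simp

lemma im_le_norm_ofReal_sub (z : ℂ) (t : ℝ) : z.im ≤ ‖(t : ℂ) - z‖ := by
  have h := Complex.abs_im_le_norm ((t : ℂ) - z)
  simp only [sub_im, ofReal_im, zero_sub, abs_neg] at h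
  exact (le_abs_self _).trans h

lemma norm_inv_ofReal_sub_le {z : ℂ} (hz : z ∈ UHP) (t : ℝ) :
    ‖((t : ℂ) - z)⁻¹‖ ≤ z.im⁻¹ := by
  rw [norm_inv]
  exact inv_anti₀ hz (im_le_norm_ofReal_sub z t)

lemma continuous_inv_ofReal_sub {z : ℂ} (hz : z ∈ UHP) :
    Continuous fun t : ℝ => ((t : ℂ) - z)⁻¹ :=
  (by fun_prop : Continuous fun t : ℝ => (t : ℂ) - z).inv₀ (ofReal_sub_ne_zero hz)

lemma sub_conj_ne_zero {z w : ℂ} (hz : z ∈ UHP) (hw : w ∈ UHP) :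
    z - (starRingEnd ℂ) w ≠ 0 := by
  intro h
  have h1 := congrArg Complex.im h
  have h2 : 0 < z.im := hz
  have h3 : 0 < w.im := hw
  simp at h1
  linarith

lemma exists_norm_add_I_le {z : ℂ} (hz : z ∈ UHP) :
    ∃ C : ℝ, ∀ t : ℝ, ‖(t : ℂ) + I‖ ≤ C * ‖(t : ℂ) - z‖ := by
  have hz' : 0 < z.im := hz
  refine ⟨1 + ‖z + I‖ / z.im, fun t => ?_⟩
  have h1 : ‖(t : ℂ) + I‖ ≤ ‖(t : ℂ) - z‖ + ‖z + I‖ := by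
    have h : (t : ℂ) + I = ((t : ℂ) - z) + (z + I) := by ring
    exact h ▸ norm_add_le ((t : ℂ) - z) (z + I)
  have h2 : ‖z + I‖ ≤ ‖z + I‖ / z.im * ‖(t : ℂ) - z‖ := by
    rw [div_mul_eq_mul_div, le_div_iff₀ hz']
    exact mul_le_mul_of_nonneg_left (im_le_norm_ofReal_sub z t) (norm_nonneg _)
  linarith

lemma norm_one_add_sq (t : ℝ) : ‖(1 + (t : ℂ) ^ 2)‖ = 1 + t ^ 2 := by
  have : (1 + (t : ℂ) ^ 2) = ((1 + t ^ 2 : ℝ) : ℂ) := by push_cast; ring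
  rw [this, Complex.norm_real, Real.norm_of_nonneg (by positivity)]

lemma norm_ofReal_add_I_sq (t : ℝ) : ‖(t : ℂ) + I‖ ^ 2 = 1 + t ^ 2 := by
  rw [← Complex.normSq_eq_norm_sq, Complex.normSq_apply]
  simp
  ring

lemma exists_kernel_bound {z w : ℂ} (hz : z ∈ UHP) (hw : w ∈ UHP) :
    ∃ C : ℝ, ∀ t : ℝ, (1 + t ^ 2) *
      ‖1 / (((t : ℂ) - z) * ((t : ℂ) - (starRingEnd ℂ) w))‖ ≤ C := by
  obtain ⟨C, hC⟩ := exists_norm_add_I_le hz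
  obtain ⟨D, hD⟩ := exists_norm_add_I_le hw
  refine ⟨C * D, fun t => ?_⟩
  have h1 := norm_pos_iff.2 (ofReal_sub_ne_zero hz t)
  have h2 := norm_pos_iff.2 (ofReal_sub_ne_zero hw t)
  rw [norm_div, norm_mul, norm_ofReal_sub_conj, norm_one, mul_one_div,
    div_le_iff₀ (mul_pos h1 h2), ← norm_ofReal_add_I_sq, sq]
  calc _ ≤ (C * ‖(t : ℂ) - z‖) * (D * ‖(t : ℂ) - w‖) :=
        mul_le_mul (hC t) (hD t) (norm_nonneg _) ((norm_nonneg _).trans (hC t))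
    _ = _ := by ring

lemma continuous_kernel {z w : ℂ} (hz : z ∈ UHP) (hw : w ∈ UHP) :
    Continuous fun t : ℝ => 1 / (((t : ℂ) - z) * ((t : ℂ) - (starRingEnd ℂ) w)) :=
  continuous_const.div (by fun_prop)
    fun t => mul_ne_zero (ofReal_sub_ne_zero hz t) (ofReal_sub_conj_ne_zero hw t)

section HerglotzTransform

variable (m : Measure ℝ) [IsFiniteMeasure m]

lemma integrable_inv_ofReal_sub {z : ℂ} (hz : z ∈ UHP) :
    Integrable (fun t : ℝ => ((t : ℂ) - z)⁻¹) m :=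
  Integrable.of_bound (continuous_inv_ofReal_sub hz).aestronglyMeasurable z.im⁻¹
    (Eventually.of_forall (norm_inv_ofReal_sub_le hz))

lemma herglotz_kernel_eq {z : ℂ} (hz : z ∈ UHP) (t : ℝ) :
    (1 + (t : ℂ) * z) / ((t : ℂ) - z) = z + (1 + z ^ 2) * ((t : ℂ) - z)⁻¹ := by
  have := ofReal_sub_ne_zero hz t
  field_simp
  ring

lemma integrable_herglotz_kernel {z : ℂ} (hz : z ∈ UHP) :
    Integrable (fun t : ℝ => (1 + (t : ℂ) * z) / ((t : ℂ) - z)) m := by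
  simp_rw [herglotz_kernel_eq hz]
  exact (integrable_const _).add ((integrable_inv_ofReal_sub m hz).const_mul _)

lemma differentiableOn_integral_inv_ofReal_sub :
    DifferentiableOn ℂ (fun z => ∫ t : ℝ, ((t : ℂ) - z)⁻¹ ∂m) UHP := by
  intro z hz
  have hz' : 0 < z.im := hz
  have hV : {x : ℂ | z.im / 2 < x.im} ∈ 𝓝 z :=
    (isOpen_lt continuous_const continuous_im).mem_nhds (by simp; linarith)
  have hU : ∀ x ∈ {x : ℂ | z.im / 2 < x.im}, x ∈ UHP := fun x hx => by
    have : z.im / 2 < x.im := hx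
    change 0 < x.im
    linarith
  have key := hasDerivAt_integral_of_dominated_loc_of_deriv_le (μ := m) (𝕜 := ℂ)
    (F := fun (x : ℂ) (t : ℝ) => ((t : ℂ) - x)⁻¹)
    (F' := fun (x : ℂ) (t : ℝ) => (((t : ℂ) - x)⁻¹) ^ 2)
    (bound := fun _ => ((z.im / 2)⁻¹) ^ 2) hV ?_ (integrable_inv_ofReal_sub m hz) ?_ ?_
    (integrable_const _) ?_
  · exact key.2.differentiableAt.differentiableWithinAt
  · filter_upwards [hV] with x hx
    exact (continuous_inv_ofReal_sub (hU x hx)).aestronglyMeasurable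
  · exact ((continuous_inv_ofReal_sub hz).pow 2).aestronglyMeasurable
  · refine Eventually.of_forall fun t x hx => ?_
    have hx' : z.im / 2 < x.im := hx
    rw [norm_pow]
    exact pow_le_pow_left₀ (norm_nonneg _)
      ((norm_inv_ofReal_sub_le (hU x hx) t).trans (inv_anti₀ (by linarith) hx'.le)) 2
  · refine Eventually.of_forall fun t x hx => ?_
    have h := ((hasDerivAt_id x).const_sub (t : ℂ)).inv (ofReal_sub_ne_zero (hU x hx) t)
    convert! h using 1
    simp

lemma differentiableOn_herglotzTransform : DifferentiableOn ℂ (herglotzTransform m) UHP := by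
  have h : DifferentiableOn ℂ (fun z => (1 / (2 * (Real.pi : ℂ) * I)) *
      ((m.real univ : ℂ) * z + (1 + z ^ 2) * ∫ t : ℝ, ((t : ℂ) - z)⁻¹ ∂m)) UHP :=
    (((differentiable_id.const_mul _).differentiableOn).add
      ((by fun_prop : DifferentiableOn ℂ (fun z : ℂ => 1 + z ^ 2) UHP).mul
        (differentiableOn_integral_inv_ofReal_sub m))).const_mul _
  refine h.congr fun z hz => ?_
  rw [herglotzTransform]
  simp_rw [herglotz_kernel_eq hz]
  rw [integral_add (integrable_const _) ((integrable_inv_ofReal_sub m hz).const_mul _),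
    integral_const, integral_const_mul]
  simp

lemma herglotzTransform_add_conj {z w : ℂ} (hz : z ∈ UHP) (hw : w ∈ UHP) :
    herglotzTransform m z + (starRingEnd ℂ) (herglotzTransform m w) =
      (z - (starRingEnd ℂ) w) * ((1 / (2 * (Real.pi : ℂ) * I)) *
        ∫ t : ℝ, (1 + (t : ℂ) ^ 2) *
          (1 / (((t : ℂ) - z) * ((t : ℂ) - (starRingEnd ℂ) w))) ∂m) := by
  have hconj : Integrable (fun t : ℝ =>
      (starRingEnd ℂ) ((1 + (t : ℂ) * w) / ((t : ℂ) - w))) m :=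
    (integrable_herglotz_kernel m hw).norm.mono'
      (Complex.continuous_conj.comp_aestronglyMeasurable
        (integrable_herglotz_kernel m hw).aestronglyMeasurable)
      (Eventually.of_forall fun t => (Complex.norm_conj _).le)
  have h1 : (starRingEnd ℂ) (1 / (2 * (Real.pi : ℂ) * I)) = -(1 / (2 * (Real.pi : ℂ) * I)) := by
    simp [Complex.conj_ofNat]
  simp only [herglotzTransform]
  rw [map_mul, h1, ← integral_conj, neg_mul, ← sub_eq_add_neg, ← mul_sub,
    ← integral_sub (integrable_herglotz_kernel m hz) hconj, mul_left_comm (z - _)]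
  congr 1
  rw [← integral_const_mul]
  refine integral_congr_ae (Eventually.of_forall fun t => ?_)
  have h2 := ofReal_sub_ne_zero hz t
  have h3 := ofReal_sub_conj_ne_zero hw t
  simp only [map_div₀, map_add, map_sub, map_mul, map_one, conj_ofReal]
  field_simp
  ring

lemma herglotzTransform_re {z : ℂ} (hz : z ∈ UHP) :
    (herglotzTransform m z).re =
      z.im / (2 * Real.pi) * ∫ t : ℝ, (1 + t ^ 2) / ‖(t : ℂ) - z‖ ^ 2 ∂m := by
  have h := herglotzTransform_add_conj m hz hz
  have h1 : ∀ t : ℝ, (1 + (t : ℂ) ^ 2) * (1 / (((t : ℂ) - z) * ((t : ℂ) - (starRingEnd ℂ) z))) =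
      (((1 + t ^ 2) / ‖(t : ℂ) - z‖ ^ 2 : ℝ) : ℂ) := by
    intro t
    have : (t : ℂ) - (starRingEnd ℂ) z = (starRingEnd ℂ) ((t : ℂ) - z) := by simp
    rw [this, Complex.mul_conj, Complex.normSq_eq_norm_sq]
    push_cast
    ring
  simp_rw [h1] at h
  rw [integral_complex_ofReal, Complex.add_conj, Complex.sub_conj] at h
  have h2 : ((2 * (herglotzTransform m z).re : ℝ) : ℂ) = ((2 * (z.im / (2 * Real.pi) *
      ∫ t : ℝ, (1 + t ^ 2) / ‖(t : ℂ) - z‖ ^ 2 ∂m) : ℝ) : ℂ) := by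
    rw [h]
    push_cast
    have := Complex.I_ne_zero
    have : (Real.pi : ℂ) ≠ 0 := by exact_mod_cast Real.pi_ne_zero
    field_simp
  have h3 := Complex.ofReal_injective h2
  linarith

lemma herglotzTransform_re_nonneg {z : ℂ} (hz : z ∈ UHP) : 0 ≤ (herglotzTransform m z).re := by
  rw [herglotzTransform_re m hz]
  have : 0 < z.im := hz
  have : 0 ≤ ∫ t : ℝ, (1 + t ^ 2) / ‖(t : ℂ) - z‖ ^ 2 ∂m :=
    integral_nonneg fun t => by positivity
  positivity

lemma ofReal_mul_I_mem_UHP {y : ℝ} (hy : 0 < y) : (y : ℂ) * I ∈ UHP := by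
  simpa [UHP] using hy

lemma norm_ofReal_sub_mul_I_sq (t y : ℝ) : ‖(t : ℂ) - y * I‖ ^ 2 = t ^ 2 + y ^ 2 := by
  rw [← Complex.normSq_eq_norm_sq, Complex.normSq_apply]
  simp
  ring

lemma tendsto_herglotzTransform_re_div :
    Tendsto (fun y : ℝ => (herglotzTransform m (y * I)).re / y) atTop (𝓝 0) := by
  have h : Tendsto (fun y : ℝ => ∫ t : ℝ, (1 + t ^ 2) / (t ^ 2 + y ^ 2) ∂m) atTop
      (𝓝 (∫ _ : ℝ, (0 : ℝ) ∂m)) := by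
    refine tendsto_integral_filter_of_dominated_convergence (fun _ => 1) ?_ ?_
      (integrable_const _) ?_
    · filter_upwards [eventually_gt_atTop 0] with y hy
      exact (Continuous.div (by fun_prop) (by fun_prop)
        fun t => by positivity).aestronglyMeasurable
    · filter_upwards [eventually_ge_atTop 1] with y hy
      refine Eventually.of_forall fun t => ?_
      rw [Real.norm_of_nonneg (by positivity), div_le_one (by positivity)]
      nlinarith
    · refine Eventually.of_forall fun t => ?_
      exact Tendsto.div_atTop tendsto_const_nhds
        (tendsto_atTop_add_const_left _ _ (tendsto_pow_atTop two_ne_zero))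
  have h' := h.const_mul (1 / (2 * Real.pi))
  rw [integral_zero, mul_zero] at h'
  refine h'.congr' ?_
  filter_upwards [eventually_gt_atTop 0] with y hy
  rw [herglotzTransform_re m (ofReal_mul_I_mem_UHP hy)]
  simp_rw [norm_ofReal_sub_mul_I_sq]
  simp
  field_simp

end HerglotzTransform

section Disc

open InnerProductSpace Metric

lemma poissonKernel_mul_circleMap {r : ℝ} (hr : 0 < r) (w : ℂ) (θ : ℝ) :
    poissonKernel 0 (r * w) (circleMap 0 r θ) = poissonKernel 0 w (circleMap 0 1 θ) := by
  have h : circleMap 0 r θ = r * circleMap 0 1 θ := by simp [circleMap]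
  simp only [poissonKernel, sub_zero, h]
  rw [← mul_sub, norm_mul, norm_mul, norm_mul, Complex.norm_real, Real.norm_of_nonneg hr.le,
    mul_pow, mul_pow, mul_pow, ← mul_sub, mul_div_mul_left _ _ (by positivity)]

lemma circleMap_sub_ne_zero {w : ℂ} (hw : w ∈ ball (0 : ℂ) 1) (θ : ℝ) :
    circleMap 0 1 θ - w ≠ 0 := by
  intro h
  have h1 : ‖w‖ < 1 := by simpa using hw
  rw [← sub_eq_zero.1 h] at h1
  simp at h1

lemma continuous_poissonKernel_circleMap {w : ℂ} (hw : w ∈ ball (0 : ℂ) 1) :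
    Continuous fun θ : ℝ => poissonKernel 0 w (circleMap 0 1 θ) := by
  simp only [poissonKernel, sub_zero]
  have := continuous_circleMap 0 1
  exact Continuous.div (by fun_prop) (by fun_prop)
    fun θ => pow_ne_zero _ (norm_ne_zero_iff.2 (circleMap_sub_ne_zero hw θ))

lemma norm_poissonKernel_circleMap_le {w : ℂ} (hw : w ∈ ball (0 : ℂ) 1) (θ : ℝ) :
    ‖poissonKernel 0 w (circleMap 0 1 θ)‖ ≤ 1 / (1 - ‖w‖) ^ 2 := by
  have h1 : ‖w‖ < 1 := by simpa using hw
  have h2 : 1 - ‖w‖ ≤ ‖circleMap 0 1 θ - w‖ := by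
    simpa using norm_sub_norm_le (circleMap 0 1 θ) w
  have h3 : ‖w‖ ^ 2 ≤ 1 := pow_le_one₀ (norm_nonneg _) h1.le
  simp only [poissonKernel, sub_zero, norm_circleMap_zero, abs_one, one_pow]
  rw [Real.norm_of_nonneg (div_nonneg (by linarith) (by positivity))]
  gcongr
  nlinarith [sq_nonneg ‖w‖]

lemma exists_measure_eq_integral_poissonKernel_mul {U : ℂ → ℝ}
    (hU : HarmonicOnNhd U (ball (0 : ℂ) 1))
    (h0 : ∀ z ∈ ball (0 : ℂ) 1, 0 ≤ U z) {r : ℝ} (hr0 : 0 < r) (hr1 : r < 1) :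
    ∃ ν : FiniteMeasure ℝ, ν.mass ≤ (U 0).toNNReal ∧ ν (Icc 0 (2 * Real.pi))ᶜ = 0 ∧
      ∀ w ∈ ball (0 : ℂ) 1,
        U (r * w) = ∫ θ, poissonKernel 0 w (circleMap 0 1 θ) ∂(ν : Measure ℝ) := by
  have hmem : ∀ θ : ℝ, circleMap 0 r θ ∈ ball (0 : ℂ) 1 := fun θ => by
    simpa [abs_of_pos hr0] using hr1
  set ρ : ℝ → ℝ := fun θ => (2 * Real.pi)⁻¹ * U (circleMap 0 r θ) with hρ
  have hρc : Continuous ρ :=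
    continuous_const.mul (hU.continuousOn.comp_continuous (continuous_circleMap 0 r) hmem)
  have hρ0 : ∀ θ, 0 ≤ ρ θ := fun θ => mul_nonneg (by positivity) (h0 _ (hmem θ))
  set ν : Measure ℝ := (volume.restrict (Ioc 0 (2 * Real.pi))).withDensity
    fun θ => ENNReal.ofReal (ρ θ) with hν
  have hint : Integrable ρ (volume.restrict (Ioc 0 (2 * Real.pi))) :=
    (hρc.integrableOn_Icc (a := 0) (b := 2 * Real.pi)).mono_set Ioc_subset_Icc_self
  have hfin : IsFiniteMeasure ν := isFiniteMeasure_withDensity_ofReal hint.2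
  have key : ∀ w ∈ ball (0 : ℂ) 1,
      U (r * w) = ∫ θ, poissonKernel 0 w (circleMap 0 1 θ) ∂ν := by
    intro w hw
    have hw' : (r * w : ℂ) ∈ ball (0 : ℂ) r := by
      have : ‖w‖ < 1 := by simpa using hw
      simp [abs_of_pos hr0]
      nlinarith
    have h := HarmonicOnNhd.circleAverage_poissonKernel_smul
      (fun z hz => hU z (closedBall_subset_ball hr1 hz)) hw'
    rw [← h, Real.circleAverage_def, intervalIntegral.integral_of_le (by positivity),
      hν, integral_withDensity_eq_integral_toReal_smul (by fun_prop) (by simp),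
      ← integral_smul]
    refine integral_congr_ae (Eventually.of_forall fun θ => ?_)
    have h1 := ENNReal.toReal_ofReal (hρ0 θ)
    simp only [hρ] at h1
    simp only [h1, Pi.smul_apply', smul_eq_mul, poissonKernel_mul_circleMap hr0, hρ]
    ring
  refine ⟨⟨ν, hfin⟩, ?_, ?_, key⟩
  · have h := key 0 (by simp)
    simp only [mul_zero, poissonKernel, sub_zero, norm_circleMap_zero, abs_one, one_pow,
      norm_zero, ne_eq, OfNat.ofNat_ne_zero, not_false_eq_true, zero_pow, div_one,
      integral_const, smul_eq_mul, mul_one] at h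
    rw [h, ← NNReal.coe_le_coe, Real.coe_toNNReal _ measureReal_nonneg]
    rfl
  · have h : ν (Icc 0 (2 * Real.pi))ᶜ = 0 := by
      refine withDensity_absolutelyContinuous _ _ ?_
      rw [Measure.restrict_apply measurableSet_Icc.compl]
      convert! measure_empty (μ := volume)
      ext x
      simp only [mem_inter_iff, mem_compl_iff, mem_Icc, mem_Ioc, mem_empty_iff_false]
      grind
    simp [h]

/-- **Herglotz representation**: a nonnegative harmonic function on the unit disc is the Poisson
integral of a finite measure on the circle. -/
lemma exists_measure_eq_integral_poissonKernel {U : ℂ → ℝ}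
    (hU : HarmonicOnNhd U (ball (0 : ℂ) 1)) (h0 : ∀ z ∈ ball (0 : ℂ) 1, 0 ≤ U z) :
    ∃ ν : Measure ℝ, IsFiniteMeasure ν ∧
      ∀ w ∈ ball (0 : ℂ) 1, U w = ∫ θ, poissonKernel 0 w (circleMap 0 1 θ) ∂ν := by
  set r : ℕ → ℝ := fun n => 1 - 1 / ((n : ℝ) + 2) with hr
  have hr0 : ∀ n, 0 < r n := fun n => by
    have : 1 / ((n : ℝ) + 2) < 1 := by
      rw [div_lt_one (by positivity)]
      linarith [(Nat.cast_nonneg n : (0 : ℝ) ≤ n)]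
    simp only [hr]
    linarith
  have hr1 : ∀ n, r n < 1 := fun n => by
    have : 0 < 1 / ((n : ℝ) + 2) := by positivity
    simp only [hr]
    linarith
  have hrt : Tendsto r atTop (𝓝 1) := by
    have : Tendsto (fun n : ℕ => 1 / ((n : ℝ) + 2)) atTop (𝓝 0) :=
      tendsto_const_nhds.div_atTop
        (tendsto_atTop_add_const_right _ _ tendsto_natCast_atTop_atTop)
    simpa [hr] using this.const_sub 1
  choose ν hmass hsupp hν using fun n =>
    exists_measure_eq_integral_poissonKernel_mul hU h0 (hr0 n) (hr1 n)
  have hK := isCompact_setOfPred_finiteMeasure_le_of_isCompact (U 0).toNNReal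
    (isCompact_Icc (a := 0) (b := 2 * Real.pi))
  obtain ⟨μ, -, hμ⟩ := hK.ultrafilter_le_nhds ((hyperfilter ℕ).map ν)
    (le_principal_iff.2 (show ν ⁻¹' _ ∈ (hyperfilter ℕ : Filter ℕ) from
      univ_mem' fun n => ⟨hmass n, hsupp n⟩))
  have hlim : Tendsto ν (hyperfilter ℕ) (𝓝 μ) := hμ
  refine ⟨μ, inferInstance, fun w hw => ?_⟩
  have h1 := FiniteMeasure.tendsto_iff_forall_integral_tendsto.1 hlim
    (BoundedContinuousFunction.ofNormedAddCommGroup _ (continuous_poissonKernel_circleMap hw) _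
      (norm_poissonKernel_circleMap_le hw))
  simp only [BoundedContinuousFunction.coe_ofNormedAddCommGroup, ← hν _ w hw] at h1
  refine tendsto_nhds_unique ?_ h1
  refine Tendsto.mono_left ?_ Nat.hyperfilter_le_atTop
  have h2 : Tendsto (fun n => (r n : ℂ) * w) atTop (𝓝 w) := by
    simpa using ((Complex.continuous_ofReal.tendsto 1).comp hrt).mul_const w
  exact ((hU.continuousOn.continuousAt (isOpen_ball.mem_nhds hw)).tendsto).comp h2

end Disc

section HalfPlane

open InnerProductSpace Metric

lemma add_I_ne_zero {z : ℂ} (hz : z ∈ UHP) : z + I ≠ 0 := by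
  intro h
  have h1 := congrArg Complex.im h
  have h2 : 0 < z.im := hz
  simp at h1
  linarith

lemma ofReal_add_I_ne_zero (t : ℝ) : (t : ℂ) + I ≠ 0 := by
  intro h
  simpa using congrArg Complex.im h

lemma one_sub_norm_cayley_sq {z : ℂ} (hz : z ∈ UHP) :
    1 - ‖(z - I) / (z + I)‖ ^ 2 = 4 * z.im / ‖z + I‖ ^ 2 := by
  have h0 : ‖z + I‖ ^ 2 ≠ 0 := pow_ne_zero _ (norm_ne_zero_iff.2 (add_I_ne_zero hz))
  have h1 : ‖z - I‖ ^ 2 = ‖z + I‖ ^ 2 - 4 * z.im := by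
    rw [← Complex.normSq_eq_norm_sq, ← Complex.normSq_eq_norm_sq, Complex.normSq_apply,
      Complex.normSq_apply]
    simp
    ring
  rw [norm_div, div_pow, h1, eq_div_iff h0, sub_mul, div_mul_cancel₀ _ h0]
  ring

lemma cayley_mem_ball {z : ℂ} (hz : z ∈ UHP) : (z - I) / (z + I) ∈ ball (0 : ℂ) 1 := by
  have h0 : 0 < ‖z + I‖ := norm_pos_iff.2 (add_I_ne_zero hz)
  have h1 := one_sub_norm_cayley_sq hz
  have h2 : 0 < z.im := hz
  have h3 : 0 < 4 * z.im / ‖z + I‖ ^ 2 := by positivity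
  rw [mem_ball_zero_iff]
  nlinarith [norm_nonneg ((z - I) / (z + I))]

lemma one_sub_ne_zero_of_mem_ball {w : ℂ} (hw : w ∈ ball (0 : ℂ) 1) : 1 - w ≠ 0 := by
  intro h
  rw [← sub_eq_zero.1 h] at hw
  simp at hw

lemma inverse_cayley_mem_UHP {w : ℂ} (hw : w ∈ ball (0 : ℂ) 1) :
    I * (1 + w) / (1 - w) ∈ UHP := by
  have h0 : 0 < normSq (1 - w) := Complex.normSq_pos.2 (one_sub_ne_zero_of_mem_ball hw)
  have h1 : normSq w < 1 := by
    rw [Complex.normSq_eq_norm_sq]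
    have : ‖w‖ < 1 := by simpa using hw
    nlinarith [norm_nonneg w]
  have h2 : (I * (1 + w) / (1 - w)).im = (1 - normSq w) / normSq (1 - w) := by
    rw [Complex.div_im, div_sub_div_same]
    congr 1
    simp [Complex.normSq_apply]
    ring
  change 0 < (I * (1 + w) / (1 - w)).im
  rw [h2]
  exact div_pos (by linarith) h0

lemma inverse_cayley_cayley {z : ℂ} (hz : z ∈ UHP) :
    I * (1 + (z - I) / (z + I)) / (1 - (z - I) / (z + I)) = z := by
  have h0 := add_I_ne_zero hz
  have h1 := I_ne_zero
  have h2 : 1 - (z - I) / (z + I) = 2 * I / (z + I) := by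
    field_simp
    ring
  rw [h2]
  field_simp
  ring

/-- The point of the real line corresponding to the point `ζ` of the unit circle. -/
def circleToLine (ζ : ℂ) : ℝ := (I * (1 + ζ) / (1 - ζ)).re

lemma ofReal_circleToLine {ζ : ℂ} (hζ : ‖ζ‖ = 1) :
    (circleToLine ζ : ℂ) = I * (1 + ζ) / (1 - ζ) := by
  refine Complex.conj_eq_iff_re.1 ?_
  have h0 : ζ ≠ 0 := norm_ne_zero_iff.1 (by simp [hζ])
  rcases eq_or_ne ζ 1 with rfl | h1
  · simp
  have h2 : 1 - ζ ≠ 0 := sub_ne_zero.2 h1.symm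
  have h3 : ζ - 1 ≠ 0 := sub_ne_zero.2 h1
  simp only [map_div₀, map_mul, map_add, map_sub, map_one, conj_I, ← Complex.inv_eq_conj hζ]
  have h4 : 1 - ζ⁻¹ = (ζ - 1) / ζ := by
    field_simp
  rw [h4]
  field_simp
  ring

lemma eq_div_circleToLine {ζ : ℂ} (hζ : ‖ζ‖ = 1) (h1 : ζ ≠ 1) :
    ζ = ((circleToLine ζ : ℂ) - I) / ((circleToLine ζ : ℂ) + I) := by
  have h2 : 1 - ζ ≠ 0 := sub_ne_zero.2 h1.symm
  rw [eq_div_iff (ofReal_add_I_ne_zero _), ofReal_circleToLine hζ]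
  field_simp
  ring

lemma poissonKernel_cayley_one {z : ℂ} (hz : z ∈ UHP) :
    poissonKernel 0 ((z - I) / (z + I)) 1 = z.im := by
  have h0 := add_I_ne_zero hz
  have h1 : 0 < ‖z + I‖ := norm_pos_iff.2 h0
  have h2 : 1 - (z - I) / (z + I) = 2 * I / (z + I) := by
    field_simp
    ring
  simp only [poissonKernel, sub_zero, norm_one, one_pow]
  rw [one_sub_norm_cayley_sq hz, h2, norm_div, norm_mul, norm_I]
  simp
  field_simp
  ring

lemma poissonKernel_cayley {z ζ : ℂ} (hz : z ∈ UHP) (hζ : ‖ζ‖ = 1) (hne : ζ ≠ 1) :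
    poissonKernel 0 ((z - I) / (z + I)) ζ =
      z.im * ((1 + circleToLine ζ ^ 2) / ‖(circleToLine ζ : ℂ) - z‖ ^ 2) := by
  have h0 := add_I_ne_zero hz
  have h1 : 0 < ‖z + I‖ := norm_pos_iff.2 h0
  have h2 := ofReal_sub_ne_zero hz (circleToLine ζ)
  have h3 := ofReal_add_I_ne_zero (circleToLine ζ)
  have h4 : 0 < ‖(circleToLine ζ : ℂ) - z‖ := norm_pos_iff.2 h2
  have h5 : ζ - (z - I) / (z + I) =
      2 * I * ((circleToLine ζ : ℂ) - z) / (((circleToLine ζ : ℂ) + I) * (z + I)) := by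
    nth_rewrite 1 [eq_div_circleToLine hζ hne]
    field_simp
    ring
  have h6 : 0 < 1 + circleToLine ζ ^ 2 := by positivity
  simp only [poissonKernel, sub_zero, hζ, one_pow]
  rw [one_sub_norm_cayley_sq hz, h5, norm_div, norm_mul, norm_mul, norm_mul, norm_I, div_pow,
    mul_pow, mul_pow, mul_pow, norm_ofReal_add_I_sq]
  simp
  field_simp
  ring

/-- A zero-free contractive holomorphic function on the half-plane has `-log ‖Q‖` equal to a
multiple of `z.im` plus the real part of a Herglotz transform. -/
lemma exists_neg_log_norm_eq {Q : ℂ → ℂ} (hQ : DifferentiableOn ℂ Q UHP)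
    (hQ0 : ∀ z ∈ UHP, Q z ≠ 0) (hQ1 : ∀ z ∈ UHP, ‖Q z‖ ≤ 1) :
    ∃ (c : ℝ) (m : Measure ℝ), IsFiniteMeasure m ∧
      ∀ z ∈ UHP, -Real.log ‖Q z‖ = c * z.im + (herglotzTransform m z).re := by
  set φ : ℂ → ℂ := fun w => I * (1 + w) / (1 - w) with hφ
  have hφd : DifferentiableOn ℂ φ (ball 0 1) :=
    DifferentiableOn.div (by fun_prop) (by fun_prop) fun w hw => one_sub_ne_zero_of_mem_ball hw
  have hQφ : DifferentiableOn ℂ (fun w => Q (φ w)) (ball 0 1) :=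
    hQ.comp hφd fun w hw => inverse_cayley_mem_UHP hw
  have hU : HarmonicOnNhd (-fun w => Real.log ‖Q (φ w)‖) (ball (0 : ℂ) 1) :=
    HarmonicOnNhd.neg fun w hw => AnalyticAt.harmonicAt_log_norm
      (hQφ.analyticAt (isOpen_ball.mem_nhds hw)) (hQ0 _ (inverse_cayley_mem_UHP hw))
  obtain ⟨ν, hν, hrep⟩ := exists_measure_eq_integral_poissonKernel hU fun w hw => by
    simp only [Pi.neg_apply, Left.nonneg_neg_iff]
    exact Real.log_nonpos (norm_nonneg _) (hQ1 _ (inverse_cayley_mem_UHP hw))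
  set A : Set ℝ := {θ | circleMap 0 1 θ = 1} with hA
  have hAm : MeasurableSet A :=
    (isClosed_eq (continuous_circleMap 0 1) continuous_const).measurableSet
  have hT : Measurable fun θ : ℝ => circleToLine (circleMap 0 1 θ) := by
    have := (continuous_circleMap 0 1).measurable
    unfold circleToLine
    fun_prop
  refine ⟨ν.real A, (2 * Real.pi).toNNReal •
    (ν.restrict Aᶜ).map fun θ => circleToLine (circleMap 0 1 θ), inferInstance, fun z hz => ?_⟩
  have h := hrep _ (cayley_mem_ball hz)
  simp only [Pi.neg_apply, hφ, inverse_cayley_cayley hz] at h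
  have hint : Integrable (fun θ => poissonKernel 0 ((z - I) / (z + I)) (circleMap 0 1 θ)) ν :=
    Integrable.of_bound
      (continuous_poissonKernel_circleMap (cayley_mem_ball hz)).aestronglyMeasurable _
      (Eventually.of_forall (norm_poissonKernel_circleMap_le (cayley_mem_ball hz)))
  have hcont : Continuous fun t : ℝ => (1 + t ^ 2) / ‖(t : ℂ) - z‖ ^ 2 :=
    Continuous.div (by fun_prop) (by fun_prop)
      fun t => pow_ne_zero _ (norm_ne_zero_iff.2 (ofReal_sub_ne_zero hz t))
  rw [h, ← integral_add_compl hAm hint, herglotzTransform_re _ hz,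
    integral_smul_nnreal_measure, integral_map hT.aemeasurable hcont.aestronglyMeasurable]
  congr 1
  · rw [setIntegral_congr_fun hAm (g := fun _ => z.im)]
    · simp
    · intro θ hθ
      have hθ' : circleMap 0 1 θ = 1 := hθ
      simp only [hθ', poissonKernel_cayley_one hz]
  · rw [NNReal.smul_def, Real.coe_toNNReal _ (by positivity), smul_eq_mul, ← mul_assoc,
      div_mul_cancel₀ _ (by positivity), ← integral_const_mul]
    exact setIntegral_congr_fun hAm.compl fun θ hθ => poissonKernel_cayley hz (by simp) hθ

end HalfPlane

section RealMeasures

lemma CMeasure.degLE_two_iff (μ : CMeasure) :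
    μ.DegLE 2 ↔ Integrable (fun t : ℝ => (1 + t ^ 2)⁻¹) μ.ν := by
  have h : (fun t : ℝ => (1 + t ^ 2) ^ (-((2 : ℕ) : ℝ) / 2)) = fun t : ℝ => (1 + t ^ 2)⁻¹ := by
    ext t
    rw [← Real.rpow_neg_one]
    norm_num
  rw [CMeasure.DegLE, h]

lemma continuous_inv_one_add_sq : Continuous fun t : ℝ => (1 + t ^ 2)⁻¹ :=
  Continuous.inv₀ (by fun_prop) fun t => by positivity

lemma isLocallyFiniteMeasure_of_integrable_inv {ν : Measure ℝ}
    (h : Integrable (fun t : ℝ => (1 + t ^ 2)⁻¹) ν) : IsLocallyFiniteMeasure ν := by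
  refine ⟨fun x => ?_⟩
  have hx : 0 < (1 + x ^ 2)⁻¹ / 2 := by positivity
  refine ⟨_, ?_, h.measure_ge_lt_top hx⟩
  filter_upwards [continuous_inv_one_add_sq.continuousAt.eventually (lt_mem_nhds (half_lt_self
    (by positivity : 0 < (1 + x ^ 2)⁻¹)))] with t ht
  exact ht.le

/-- The difference of two finite measures, multiplied by `1 + t²`, is a real measure of
degree at most two. -/
lemma exists_cmeasure_of_finite (m₁ m₂ : Measure ℝ) [IsFiniteMeasure m₁] [IsFiniteMeasure m₂] :
    ∃ μ : CMeasure, μ.RealValued ∧ μ.DegLE 2 ∧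
      ∀ φ : ℝ → ℂ, Continuous φ → (∃ C, ∀ t, (1 + t ^ 2) * ‖φ t‖ ≤ C) →
        ∫ t, φ t * μ.w t ∂μ.ν =
          (∫ t : ℝ, (1 + (t : ℂ) ^ 2) * φ t ∂m₁) - ∫ t : ℝ, (1 + (t : ℂ) ^ 2) * φ t ∂m₂ := by
  set σ := m₁ + m₂ with hσ
  have hac₁ : m₁ ≪ σ := Measure.absolutelyContinuous_of_le (Measure.le_add_right le_rfl)
  have hac₂ : m₂ ≪ σ := Measure.absolutelyContinuous_of_le (Measure.le_add_left le_rfl)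
  set d : ℝ → ℝ := fun t => (m₁.rnDeriv σ t).toReal - (m₂.rnDeriv σ t).toReal with hd
  have hdm : Measurable d := (Measure.measurable_rnDeriv _ _).ennreal_toReal.sub
    (Measure.measurable_rnDeriv _ _).ennreal_toReal
  have hdi : Integrable d σ :=
    Measure.integrable_toReal_rnDeriv.sub Measure.integrable_toReal_rnDeriv
  have hρm : Measurable fun t : ℝ => ENNReal.ofReal (|d t| * (1 + t ^ 2)) := by fun_prop
  have hρ : ∀ t : ℝ, (ENNReal.ofReal (|d t| * (1 + t ^ 2))).toReal = |d t| * (1 + t ^ 2) :=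
    fun t => ENNReal.toReal_ofReal (by positivity)
  refine ⟨⟨σ.withDensity fun t => ENNReal.ofReal (|d t| * (1 + t ^ 2)),
    fun t => if 0 ≤ d t then 1 else -1,
    Measurable.ite (measurableSet_le measurable_const hdm) measurable_const measurable_const,
    Eventually.of_forall fun t => by split_ifs <;> simp⟩,
    Eventually.of_forall fun t => ?_, ?_, fun φ hφ hC => ?_⟩
  · dsimp only
    split_ifs <;> simp
  · rw [CMeasure.degLE_two_iff, integrable_withDensity_iff_integrable_smul' hρm
      (Eventually.of_forall fun t => ENNReal.ofReal_lt_top)]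
    refine hdi.abs.congr (Eventually.of_forall fun t => ?_)
    simp only [hρ, smul_eq_mul]
    have : (1 + t ^ 2) ≠ 0 := by positivity
    field_simp
  · obtain ⟨C, hC⟩ := hC
    have hψ : ∀ m : Measure ℝ, IsFiniteMeasure m →
        Integrable (fun t : ℝ => (1 + (t : ℂ) ^ 2) * φ t) m := fun m _ =>
      Integrable.of_bound (by fun_prop : Continuous _).aestronglyMeasurable C
        (Eventually.of_forall fun t => by rw [norm_mul, norm_one_add_sq]; exact hC t)
    rw [integral_withDensity_eq_integral_toReal_smul hρm
      (Eventually.of_forall fun t => ENNReal.ofReal_lt_top),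
      ← integral_rnDeriv_smul hac₁, ← integral_rnDeriv_smul hac₂,
      ← integral_sub ((integrable_rnDeriv_smul_iff hac₁).2 (hψ m₁ inferInstance))
        ((integrable_rnDeriv_smul_iff hac₂).2 (hψ m₂ inferInstance))]
    refine integral_congr_ae (Eventually.of_forall fun t => ?_)
    have h1 : ((|d t| : ℝ) : ℂ) * (if 0 ≤ d t then 1 else -1) = d t := by
      split_ifs with h
      · rw [abs_of_nonneg h, mul_one]
      · rw [abs_of_neg (not_le.1 h)]
        simp
    have h2 : (d t : ℂ) = ((m₁.rnDeriv σ t).toReal : ℂ) - ((m₂.rnDeriv σ t).toReal : ℂ) := by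
      simp [hd]
    simp only [hρ, Complex.real_smul]
    push_cast
    linear_combination (1 + (t : ℂ) ^ 2) * φ t * h1 + (1 + (t : ℂ) ^ 2) * φ t * h2

/-- A real measure of degree at most two is the difference of two finite measures, multiplied
by `1 + t²`. -/
lemma CMeasure.exists_finite {μ : CMeasure} (hr : μ.RealValued) (hdeg : μ.DegLE 2) :
    ∃ m₁ m₂ : Measure ℝ, IsFiniteMeasure m₁ ∧ IsFiniteMeasure m₂ ∧
      ∀ φ : ℝ → ℂ, Continuous φ → (∃ C, ∀ t, (1 + t ^ 2) * ‖φ t‖ ≤ C) →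
        ∫ t, φ t * μ.w t ∂μ.ν =
          (∫ t : ℝ, (1 + (t : ℂ) ^ 2) * φ t ∂m₁) - ∫ t : ℝ, (1 + (t : ℂ) ^ 2) * φ t ∂m₂ := by
  rw [CMeasure.degLE_two_iff] at hdeg
  set S : Set ℝ := {t | 0 ≤ (μ.w t).re} with hS
  have hSm : MeasurableSet S :=
    measurableSet_le measurable_const (Complex.measurable_re.comp μ.meas)
  set m : Measure ℝ := μ.ν.withDensity fun t => ENNReal.ofReal ((1 + t ^ 2)⁻¹) with hm
  have hfin : IsFiniteMeasure m := isFiniteMeasure_withDensity_ofReal hdeg.2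
  have hρm : Measurable fun t : ℝ => ENNReal.ofReal ((1 + t ^ 2)⁻¹) := by fun_prop
  refine ⟨m.restrict S, m.restrict Sᶜ, inferInstance, inferInstance, fun φ hφ hC => ?_⟩
  obtain ⟨C, hC⟩ := hC
  have hint : Integrable (fun t => φ t * μ.w t) μ.ν := by
    refine (hdeg.const_mul C).mono' (hφ.aestronglyMeasurable.mul μ.meas.aestronglyMeasurable) ?_
    filter_upwards [μ.unit] with t ht
    rw [norm_mul, ht, mul_one, ← div_eq_mul_inv, le_div_iff₀ (by positivity), mul_comm]
    exact hC t
  have hset : ∀ A : Set ℝ, MeasurableSet A →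
      ∫ t in A, (1 + (t : ℂ) ^ 2) * φ t ∂m = ∫ t in A, φ t ∂μ.ν := by
    intro A hA
    rw [hm, setIntegral_withDensity_eq_setIntegral_toReal_smul hρm (by simp) _ hA]
    refine integral_congr_ae (Eventually.of_forall fun t => ?_)
    have h1 : (1 + (t : ℂ) ^ 2) ≠ 0 := by
      rw [← norm_ne_zero_iff, norm_one_add_sq]
      positivity
    simp only [ENNReal.toReal_ofReal (by positivity : 0 ≤ (1 + t ^ 2)⁻¹), Complex.real_smul]
    push_cast
    field_simp
  have hw : ∀ᵐ t ∂μ.ν, (t ∈ S → μ.w t = 1) ∧ (t ∈ Sᶜ → μ.w t = -1) := by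
    filter_upwards [μ.unit, hr] with t h1 h2
    have h3 : μ.w t = ((μ.w t).re : ℂ) := Complex.ext rfl (by simp [h2])
    have h4 : |(μ.w t).re| = 1 := by
      rw [h3, Complex.norm_real, Real.norm_eq_abs] at h1
      exact h1
    refine ⟨fun hs => ?_, fun hs => ?_⟩
    · have hs' : 0 ≤ (μ.w t).re := hs
      rw [abs_of_nonneg hs'] at h4
      rw [h3, h4, ofReal_one]
    · have hs' : (μ.w t).re < 0 := not_le.1 hs
      rw [abs_of_neg hs'] at h4
      rw [h3, ← neg_neg (μ.w t).re, h4, ofReal_neg, ofReal_one]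
  rw [hset S hSm, hset Sᶜ hSm.compl, ← integral_add_compl hSm hint, sub_eq_add_neg, ← integral_neg]
  congr 1
  · refine setIntegral_congr_ae hSm ?_
    filter_upwards [hw] with t ht hs
    rw [ht.1 hs, mul_one]
  · refine setIntegral_congr_ae hSm.compl ?_
    filter_upwards [hw] with t ht hs
    rw [ht.2 hs, mul_neg_one]

end RealMeasures

lemma tendsto_log_norm_exp_div {f : ℂ → ℂ} {c : ℝ} {m₁ m₂ : Measure ℝ} [IsFiniteMeasure m₁]
    [IsFiniteMeasure m₂] (h : ∀ z ∈ UHP, (f z).re =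
      c * z.im + ((herglotzTransform m₁ z).re - (herglotzTransform m₂ z).re)) :
    Tendsto (fun y : ℝ => Real.log ‖Complex.exp (f (y * I))‖ / y) atTop (𝓝 c) := by
  have h1 := ((tendsto_herglotzTransform_re_div m₁).sub
    (tendsto_herglotzTransform_re_div m₂)).const_add c
  rw [sub_zero, add_zero] at h1
  refine h1.congr' ?_
  filter_upwards [eventually_gt_atTop 0] with y hy
  rw [Complex.norm_exp, Real.log_exp, h _ (ofReal_mul_I_mem_UHP hy)]
  simp only [mul_im, ofReal_re, I_im, mul_one, ofReal_im, I_re, mul_zero, add_zero]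
  field_simp

lemma norm_exp_neg_herglotzTransform_le (m : Measure ℝ) [IsFiniteMeasure m] {z : ℂ}
    (hz : z ∈ UHP) : ‖Complex.exp (-herglotzTransform m z)‖ ≤ 1 := by
  rw [Complex.norm_exp, Real.exp_le_one_iff, neg_re, neg_nonpos]
  exact herglotzTransform_re_nonneg m hz

/-- A zero-free quotient of bounded functions has `log ‖g‖` equal to a multiple of `z.im` plus a
difference of real parts of Herglotz transforms. -/
lemma BoundedType.exists_log_norm_eq {g : ℂ → ℂ} (hg : BoundedType g)
    (hg0 : ∀ z ∈ UHP, g z ≠ 0) :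
    ∃ (c : ℝ) (m₁ m₂ : Measure ℝ), IsFiniteMeasure m₁ ∧ IsFiniteMeasure m₂ ∧
      ∀ z ∈ UHP, Real.log ‖g z‖ =
        c * z.im + ((herglotzTransform m₁ z).re - (herglotzTransform m₂ z).re) := by
  obtain ⟨P, Q, hP, hQ, ⟨A, hA⟩, ⟨B, hB⟩, hQ0, hgPQ⟩ := hg
  set M : ℝ := max (max A B) 1 with hM
  have hM0 : 0 < M := lt_of_lt_of_le one_pos (le_max_right _ _)
  have hMA : A ≤ M := (le_max_left _ _).trans (le_max_left _ _)
  have hMB : B ≤ M := (le_max_right _ _).trans (le_max_left _ _)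
  have hM0' : (M : ℂ) ≠ 0 := by exact_mod_cast hM0.ne'
  have hP0 : ∀ z ∈ UHP, P z ≠ 0 := fun z hz h => hg0 z hz (by rw [hgPQ z hz, h, zero_div])
  have hle : ∀ {x : ℂ}, ‖x‖ ≤ M → ‖x / M‖ ≤ 1 := fun {x} hx => by
    rw [norm_div, Complex.norm_real, Real.norm_of_nonneg hM0.le]
    exact (div_le_one hM0).2 hx
  obtain ⟨c₁, m₁, h₁, hm₁⟩ := exists_neg_log_norm_eq (hQ.div_const (M : ℂ))
    (fun z hz => div_ne_zero (hQ0 z hz) hM0') fun z hz => hle ((hB z hz).trans hMB)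
  obtain ⟨c₂, m₂, h₂, hm₂⟩ := exists_neg_log_norm_eq (hP.div_const (M : ℂ))
    (fun z hz => div_ne_zero (hP0 z hz) hM0') fun z hz => hle ((hA z hz).trans hMA)
  refine ⟨c₁ - c₂, m₁, m₂, h₁, h₂, fun z hz => ?_⟩
  have e : g z = (P z / M) / (Q z / M) := by
    rw [hgPQ z hz, div_div_div_cancel_right₀ hM0']
  rw [e, norm_div, Real.log_div (norm_ne_zero_iff.2 (div_ne_zero (hP0 z hz) hM0'))
    (norm_ne_zero_iff.2 (div_ne_zero (hQ0 z hz) hM0'))]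
  linarith [hm₁ z hz, hm₂ z hz]

lemma herglotzTransform_sub_add_conj {μ : CMeasure} {m₁ m₂ : Measure ℝ} [IsFiniteMeasure m₁]
    [IsFiniteMeasure m₂]
    (h : ∀ φ : ℝ → ℂ, Continuous φ → (∃ C, ∀ t, (1 + t ^ 2) * ‖φ t‖ ≤ C) →
      ∫ t, φ t * μ.w t ∂μ.ν =
        (∫ t : ℝ, (1 + (t : ℂ) ^ 2) * φ t ∂m₁) - ∫ t : ℝ, (1 + (t : ℂ) ^ 2) * φ t ∂m₂)
    {z w : ℂ} (hz : z ∈ UHP) (hw : w ∈ UHP) :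
    (herglotzTransform m₁ z - herglotzTransform m₂ z) +
        (starRingEnd ℂ) (herglotzTransform m₁ w - herglotzTransform m₂ w) =
      (z - (starRingEnd ℂ) w) * ((1 / (2 * (Real.pi : ℂ) * Complex.I)) *
        ∫ t, (1 / (((t : ℂ) - z) * ((t : ℂ) - (starRingEnd ℂ) w))) * μ.w t ∂μ.ν) := by
  rw [h _ (continuous_kernel hz hw) (exists_kernel_bound hz hw), mul_sub, mul_sub,
    ← herglotzTransform_add_conj m₁ hz hw, ← herglotzTransform_add_conj m₂ hz hw, map_sub]
  ring

/-- Lemma 5.4: the Herglotz-type kernel representation with a real measure of degree ≤ 2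
is equivalent to `exp(f)` being of bounded type with zero mean type. -/
theorem stmt18 (f : ℂ → ℂ) (hf : DifferentiableOn ℂ f UHP) :
    (∃ μ : CMeasure, IsLocallyFiniteMeasure μ.ν ∧ μ.RealValued ∧ μ.DegLE 2 ∧
      ∀ z ∈ UHP, ∀ w ∈ UHP,
        (f z + (starRingEnd ℂ) (f w)) / (z - (starRingEnd ℂ) w) =
          (1 / (2 * (Real.pi : ℂ) * Complex.I)) *
            ∫ t, (1 / (((t : ℂ) - z) * ((t : ℂ) - (starRingEnd ℂ) w))) * μ.w t ∂μ.ν) ↔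
    (BoundedType (fun z => Complex.exp (f z)) ∧
      MeanType (fun z => Complex.exp (f z)) = 0) := by
  constructor
  · rintro ⟨μ, -, hr, hdeg, hrep⟩
    obtain ⟨m₁, m₂, h₁, h₂, hμ⟩ := CMeasure.exists_finite hr hdeg
    have key : ∀ z ∈ UHP, ∀ w ∈ UHP, f z + (starRingEnd ℂ) (f w) =
        (herglotzTransform m₁ z - herglotzTransform m₂ z) +
          (starRingEnd ℂ) (herglotzTransform m₁ w - herglotzTransform m₂ w) := by
      intro z hz w hw
      rw [herglotzTransform_sub_add_conj hμ hz hw, ← hrep z hz w hw,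
        mul_div_cancel₀ _ (sub_conj_ne_zero hz hw)]
    have hI : I ∈ UHP := by simp [UHP]
    set a : ℂ := (starRingEnd ℂ) (herglotzTransform m₁ I - herglotzTransform m₂ I) -
      (starRingEnd ℂ) (f I) with ha
    have hf' : ∀ z ∈ UHP, f z = a + (herglotzTransform m₁ z - herglotzTransform m₂ z) := by
      intro z hz
      linear_combination key z hz I hI
    have hre : ∀ z ∈ UHP, (f z).re =
        0 * z.im + ((herglotzTransform m₁ z).re - (herglotzTransform m₂ z).re) := by
      intro z hz
      have := congrArg Complex.re (key z hz z hz)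
      simp only [add_re, sub_re, conj_re] at this
      linarith
    refine ⟨⟨fun z => Complex.exp a * Complex.exp (-herglotzTransform m₂ z),
      fun z => Complex.exp (-herglotzTransform m₁ z),
      ((differentiableOn_herglotzTransform m₂).neg.cexp).const_mul _,
      (differentiableOn_herglotzTransform m₁).neg.cexp, ⟨‖Complex.exp a‖, fun z hz => ?_⟩,
      ⟨1, fun z hz => norm_exp_neg_herglotzTransform_le m₁ hz⟩,
      fun z _ => Complex.exp_ne_zero _, fun z hz => ?_⟩,
      (tendsto_log_norm_exp_div hre).limsup_eq⟩
    · rw [norm_mul]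
      exact mul_le_of_le_one_right (norm_nonneg _) (norm_exp_neg_herglotzTransform_le m₂ hz)
    · dsimp only
      rw [← Complex.exp_add, ← Complex.exp_sub, hf' z hz]
      congr 1
      ring
  · rintro ⟨hbt, hmt⟩
    obtain ⟨c, m₁, m₂, h₁, h₂, hlog⟩ :=
      hbt.exists_log_norm_eq fun z _ => Complex.exp_ne_zero _
    simp only [Complex.norm_exp, Real.log_exp] at hlog
    have hc : c = 0 := (tendsto_log_norm_exp_div hlog).limsup_eq.symm.trans hmt
    have hre : ∀ z ∈ UHP,
        (f z - (herglotzTransform m₁ z - herglotzTransform m₂ z)).re = 0 := by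
      intro z hz
      rw [sub_re, sub_re, hlog z hz, hc]
      ring
    obtain ⟨b, hb⟩ := AnalyticOnNhd.eq_const_of_re_eq_const
      ((hf.sub ((differentiableOn_herglotzTransform m₁).sub
        (differentiableOn_herglotzTransform m₂))).analyticOnNhd isOpen_UHP) hre isOpen_UHP
      (convex_UHP.isConnected ⟨I, by simp [UHP]⟩)
    have hI : I ∈ UHP := by simp [UHP]
    have hb' : b + (starRingEnd ℂ) b = 0 := by
      have := hre I hI
      rw [Complex.add_conj, ← hb I hI]
      simp only [Pi.sub_apply]
      rw [this]
      simp
    have hf' : ∀ z ∈ UHP, f z = b + (herglotzTransform m₁ z - herglotzTransform m₂ z) := by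
      intro z hz
      rw [← hb z hz]
      simp
    obtain ⟨μ, hr, hdeg, hμ⟩ := exists_cmeasure_of_finite m₁ m₂
    refine ⟨μ, isLocallyFiniteMeasure_of_integrable_inv (μ.degLE_two_iff.1 hdeg), hr, hdeg,
      fun z hz w hw => ?_⟩
    rw [div_eq_iff (sub_conj_ne_zero hz hw), mul_comm,
      ← herglotzTransform_sub_add_conj hμ hz hw, hf' z hz, hf' w hw, map_add]
    linear_combination hb'
end
end
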